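/- (Gromov) If a finitely generated group G has polynomial growth, then G contains a nilpotent subgroup of finite index. -/

import Mathlib

open scoped BigOperators

/-- The ball of radius `n` in a group `G` with respect to a set `S`:
elements expressible as a product of at most `n` elements of `S`. -/
def ball {G : Type*} [Group G] (S : Set G) (n : ℕ) : Set G :=
  {g | ∃ l : List G, (∀ x ∈ l, x ∈ S) ∧ l.length ≤ n ∧ l.prod = g}

/-- The growth function of `G` relative to `S`: `γ_S(n) = |B_S(n)|`. -/
noncomputable def growth {G : Type*} [Group G] (S : Set G) (n : ℕ) : ℕ := (ball S n).ncard

/-- A finite symmetric generating set of `G`. -/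
def IsSymmGen {G : Type*} [Group G] (S : Finset G) : Prop :=
  (∀ x ∈ S, x⁻¹ ∈ S) ∧ Subgroup.closure (S : Set G) = ⊤

/-- `G` has polynomial growth: for some finite symmetric generating set `S`
there are `C > 0` and `k : ℕ` with `γ_S(n) ≤ C * n ^ k` for all `n ≥ 1`. -/
def HasPolyGrowth (G : Type*) [Group G] : Prop :=
  ∃ S : Finset G, IsSymmGen S ∧ ∃ C : ℝ, 0 < C ∧ ∃ k : ℕ,
    ∀ n : ℕ, 1 ≤ n → (growth (S : Set G) n : ℝ) ≤ C * (n : ℝ) ^ k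

set_option autoImplicit false

/-- `G` has growth of degree at most `d` with respect to every finite subset. -/
def GrowthLE (G : Type*) [Group G] (d : ℕ) : Prop :=
  ∀ T : Finset G, ∃ C : ℝ, 0 < C ∧ ∀ n : ℕ, 1 ≤ n →
    (growth (T : Set G) n : ℝ) ≤ C * (n : ℝ) ^ d

section Ball

variable {G : Type*} [Group G]

theorem one_mem_ball (S : Set G) (n : ℕ) : (1 : G) ∈ ball S n :=
  ⟨[], by simp, by simp, by simp⟩

theorem mem_ball_one {S : Set G} {s : G} (hs : s ∈ S) : s ∈ ball S 1 :=
  ⟨[s], by simpa using hs, by simp, by simp⟩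

theorem ball_mono (S : Set G) {m n : ℕ} (h : m ≤ n) : ball S m ⊆ ball S n := by
  rintro g ⟨l, h1, h2, h3⟩
  exact ⟨l, h1, h2.trans h, h3⟩

theorem mul_mem_ball {S : Set G} {m n : ℕ} {a b : G} (ha : a ∈ ball S m) (hb : b ∈ ball S n) :
    a * b ∈ ball S (m + n) := by
  obtain ⟨l, h1, h2, rfl⟩ := ha
  obtain ⟨l', h1', h2', rfl⟩ := hb
  refine ⟨l ++ l', ?_, by simp; omega, by simp⟩
  intro x hx
  rcases List.mem_append.1 hx with h | h
  exacts [h1 x h, h1' x h]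

theorem pow_mem_ball_mul {S : Set G} {m : ℕ} {a : G} (ha : a ∈ ball S m) (k : ℕ) :
    a ^ k ∈ ball S (k * m) := by
  induction k with
  | zero => simpa using one_mem_ball S 0
  | succ k ih => rw [pow_succ, Nat.succ_mul]; exact mul_mem_ball ih ha

theorem inv_mem_ball {S : Set G} (hS : ∀ x ∈ S, x⁻¹ ∈ S) {n : ℕ} {a : G} (ha : a ∈ ball S n) :
    a⁻¹ ∈ ball S n := by
  obtain ⟨l, h1, h2, rfl⟩ := ha
  refine ⟨(l.map (·⁻¹)).reverse, ?_, by simpa using h2, by rw [List.prod_inv_reverse]⟩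
  intro x hx
  simp only [List.mem_reverse, List.mem_map] at hx
  obtain ⟨y, hy, rfl⟩ := hx
  exact hS y (h1 y hy)

theorem ball_zero (S : Set G) : ball S 0 = {1} := by
  ext g
  constructor
  · rintro ⟨l, -, h2, rfl⟩
    have : l = [] := List.length_eq_zero_iff.1 (by omega)
    simp [this]
  · rintro rfl
    exact one_mem_ball S 0

theorem ball_succ_subset (S : Set G) (n : ℕ) :
    ball S (n + 1) ⊆ ball S n ∪ Set.image2 (· * ·) S (ball S n) := by
  rintro g ⟨l, h1, h2, rfl⟩
  cases l with
  | nil => exact Or.inl (by simpa using one_mem_ball S n)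
  | cons a l =>
    refine Or.inr ⟨a, h1 a (by simp), l.prod, ⟨l, fun x hx => h1 x (by simp [hx]), ?_, rfl⟩, ?_⟩
    · simpa using h2
    · simp

theorem ball_finite {S : Set G} (hS : S.Finite) (n : ℕ) : (ball S n).Finite := by
  induction n with
  | zero => simp [ball_zero]
  | succ n ih => exact (ih.union (hS.image2 _ ih)).subset (ball_succ_subset S n)

theorem exists_mem_ball {S : Set G} (hS : ∀ x ∈ S, x⁻¹ ∈ S) (hc : Subgroup.closure S = ⊤) (g : G) :
    ∃ n, g ∈ ball S n := by
  have hg : g ∈ Subgroup.closure S := by rw [hc]; trivial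
  induction hg using Subgroup.closure_induction with
  | mem x hx => exact ⟨1, mem_ball_one hx⟩
  | one => exact ⟨0, one_mem_ball S 0⟩
  | mul x y _ _ hx hy =>
    obtain ⟨m, hm⟩ := hx
    obtain ⟨n, hn⟩ := hy
    exact ⟨m + n, mul_mem_ball hm hn⟩
  | inv x _ hx =>
    obtain ⟨m, hm⟩ := hx
    exact ⟨m, inv_mem_ball hS hm⟩

theorem ball_subset_ball_of_subset {S T : Set G} {L : ℕ} (h : T ⊆ ball S L) (n : ℕ) :
    ball T n ⊆ ball S (n * L) := by
  induction n with
  | zero => simp [ball_zero]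
  | succ n ih =>
    refine (ball_succ_subset T n).trans (Set.union_subset (ih.trans (ball_mono S ?_)) ?_)
    · exact Nat.mul_le_mul_right _ (Nat.le_succ n)
    · rintro _ ⟨a, ha, b, hb, rfl⟩
      have := mul_mem_ball (h ha) (ih hb)
      rwa [show L + n * L = (n + 1) * L by ring] at this

theorem image_ball {H : Type*} [Group H] (f : H →* G) (T : Set H) (n : ℕ) :
    f '' ball T n = ball (f '' T) n := by
  ext g
  constructor
  · rintro ⟨_, ⟨l, h1, h2, rfl⟩, rfl⟩
    refine ⟨l.map f, ?_, by simpa using h2, by simp [map_list_prod]⟩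
    intro x hx
    obtain ⟨y, hy, rfl⟩ := List.mem_map.1 hx
    exact ⟨y, h1 y hy, rfl⟩
  · rintro ⟨l, h1, h2, rfl⟩
    choose! c hc hc' using h1
    refine ⟨(l.map c).prod, ⟨l.map c, ?_, by simpa using h2, rfl⟩, ?_⟩
    · intro x hx
      obtain ⟨y, hy, rfl⟩ := List.mem_map.1 hx
      exact hc y hy
    · rw [map_list_prod, List.map_map]
      congr 1
      conv_rhs => rw [← List.map_id l]
      exact List.map_congr_left fun x hx => hc' x hx

theorem growth_pos {S : Set G} (hS : S.Finite) (n : ℕ) : 0 < growth S n :=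
  (Set.ncard_pos (ball_finite hS n)).2 ⟨1, one_mem_ball S n⟩

theorem IsSymmGen.exists_mem_ball {S : Finset G} (hS : IsSymmGen S) (g : G) :
    ∃ n, g ∈ ball (S : Set G) n :=
  _root_.exists_mem_ball (fun x hx => by simpa using hS.1 x (by simpa using hx)) hS.2 g

theorem IsSymmGen.inv_mem_ball {S : Finset G} (hS : IsSymmGen S) {n : ℕ} {g : G}
    (hg : g ∈ ball (S : Set G) n) : g⁻¹ ∈ ball (S : Set G) n :=
  _root_.inv_mem_ball (fun x hx => by simpa using hS.1 x (by simpa using hx)) hg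

theorem exists_ball_of_finset {S : Finset G} (hS : IsSymmGen S) (T : Finset G) :
    ∃ L, (T : Set G) ⊆ ball (S : Set G) L := by
  choose c hc using fun g => hS.exists_mem_ball g
  exact ⟨T.sup c, fun g hg => ball_mono _ (Finset.le_sup (f := c) hg) (hc g)⟩

theorem HasPolyGrowth.exists_growthLE (h : HasPolyGrowth G) : ∃ d, GrowthLE G d := by
  obtain ⟨S, hS, C, hC, k, h⟩ := h
  refine ⟨k, fun T => ?_⟩
  obtain ⟨L, hL⟩ := exists_ball_of_finset hS T
  refine ⟨C * ((L : ℝ) + 1) ^ k, by positivity, fun n hn => ?_⟩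
  have h1 : growth (T : Set G) n ≤ growth (S : Set G) (n * (L + 1)) :=
    Set.ncard_le_ncard ((ball_subset_ball_of_subset hL n).trans
      (ball_mono _ (Nat.mul_le_mul_left _ (Nat.le_succ L)))) (ball_finite S.finite_toSet _)
  have h2 := h (n * (L + 1)) (Nat.mul_pos hn (Nat.succ_pos L))
  calc (growth (T : Set G) n : ℝ) ≤ growth (S : Set G) (n * (L + 1)) := by exact_mod_cast h1
    _ ≤ _ := h2
    _ = _ := by push_cast; rw [mul_pow]; ring

theorem GrowthLE.of_injective {H : Type*} [Group H] {d : ℕ} (h : GrowthLE G d) (f : H →* G)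
    (hf : Function.Injective f) : GrowthLE H d := by
  classical
  intro T
  obtain ⟨C, hC, h⟩ := h (T.image f)
  refine ⟨C, hC, fun n hn => ?_⟩
  have : growth (T : Set H) n = growth ((T.image f : Finset G) : Set G) n := by
    rw [growth, growth, Finset.coe_image, ← image_ball, Set.ncard_image_of_injective _ hf]
  rw [this]
  exact h n hn

theorem exists_isSymmGen (h : Group.FG G) : ∃ S : Finset G, IsSymmGen S := by
  classical
  obtain ⟨T, hT⟩ := Group.fg_iff'.1 h |>.imp fun n h => h
  obtain ⟨T, -, hT⟩ := hT
  refine ⟨T ∪ T.image (·⁻¹), ?_, ?_⟩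
  · intro x hx
    simp only [Finset.mem_union, Finset.mem_image] at hx ⊢
    rcases hx with hx | ⟨y, hy, rfl⟩
    · exact Or.inr ⟨x, hx, rfl⟩
    · exact Or.inl (by simpa using hy)
  · rw [eq_top_iff, ← hT]
    exact Subgroup.closure_mono (by simp)

open scoped Pointwise in
theorem succ_le_growth [Infinite G] {S : Finset G} (hS : IsSymmGen S) (n : ℕ) :
    n + 1 ≤ growth (S : Set G) n := by
  classical
  have h := Finset.add_one_le_card_pow (X := insert 1 S) (by simp) (by
    have : Subgroup.closure (((insert 1 S : Finset G)) : Set G) = ⊤ := by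
      rw [eq_top_iff, ← hS.2]
      exact Subgroup.closure_mono (by simp)
    rw [this]
    simpa using Set.infinite_univ) n
  refine h.trans ?_
  rw [← Set.ncard_coe_finset]
  refine Set.ncard_le_ncard ?_ (ball_finite S.finite_toSet n)
  clear h
  induction n with
  | zero => simp [ball_zero]
  | succ n ih =>
    rw [pow_succ, Finset.coe_mul]
    rintro _ ⟨a, ha, b, hb, rfl⟩
    refine mul_mem_ball (ih ha) ?_
    have hb : b = 1 ∨ b ∈ S := by simpa using hb
    rcases hb with rfl | hb
    · exact one_mem_ball _ _
    · exact mem_ball_one hb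

end Ball

set_option linter.unusedSectionVars false
open scoped InnerProductSpace

section Laplacian

variable {G : Type*} [Group G] {H : Type*} [NormedAddCommGroup H] [InnerProductSpace ℝ H]

/-- The lazy Laplacian associated with a finite set of isometries. -/
noncomputable def lapl (S : Finset G) (R : G → H →ₗᵢ[ℝ] H) : H →ₗ[ℝ] H :=
  (2 * (S.card : ℝ))⁻¹ • ∑ s ∈ S, (LinearMap.id - (R s).toLinearMap)

theorem lapl_apply (S : Finset G) (R : G → H →ₗᵢ[ℝ] H) (f : H) :
    lapl S R f = (2 * (S.card : ℝ))⁻¹ • ∑ s ∈ S, (f - R s f) := by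
  simp [lapl, LinearMap.sum_apply]

theorem inner_lapl_self (S : Finset G) (R : G → H →ₗᵢ[ℝ] H) (f : H) :
    ⟪lapl S R f, f⟫_ℝ = (4 * (S.card : ℝ))⁻¹ * ∑ s ∈ S, ‖R s f - f‖ ^ 2 := by
  rw [lapl_apply, real_inner_smul_left, sum_inner, Finset.mul_sum, Finset.mul_sum]
  refine Finset.sum_congr rfl fun s _ => ?_
  have h : ‖R s f - f‖ ^ 2 = 2 * ⟪f - R s f, f⟫_ℝ := by
    rw [norm_sub_sq_real, inner_sub_left, (R s).norm_map, real_inner_self_eq_norm_sq]; ring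
  rw [h, mul_inv, mul_inv]; ring

theorem inner_lapl_self_nonneg (S : Finset G) (R : G → H →ₗᵢ[ℝ] H) (f : H) :
    0 ≤ ⟪lapl S R f, f⟫_ℝ := by
  rw [inner_lapl_self]; positivity

theorem inner_lapl_self_le (S : Finset G) (R : G → H →ₗᵢ[ℝ] H) (f : H) :
    ⟪lapl S R f, f⟫_ℝ ≤ ‖f‖ ^ 2 := by
  rw [inner_lapl_self]
  rcases S.eq_empty_or_nonempty with rfl | hS
  · simp
  have hc : (0 : ℝ) < S.card := by exact_mod_cast hS.card_pos
  have : ∑ s ∈ S, ‖R s f - f‖ ^ 2 ≤ ∑ s ∈ S, 4 * ‖f‖ ^ 2 := by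
    refine Finset.sum_le_sum fun s _ => ?_
    have h : ‖R s f - f‖ ≤ 2 * ‖f‖ := by
      have := norm_sub_le (R s f) f
      rw [(R s).norm_map] at this; linarith
    calc ‖R s f - f‖ ^ 2 ≤ (2 * ‖f‖) ^ 2 := by gcongr
      _ = _ := by ring
  rw [Finset.sum_const, nsmul_eq_mul] at this
  calc _ ≤ (4 * (S.card : ℝ))⁻¹ * (S.card * (4 * ‖f‖ ^ 2)) := by gcongr
    _ = _ := by field_simp

theorem lapl_symm {S : Finset G} (hS : ∀ x ∈ S, x⁻¹ ∈ S) {R : G → H →ₗᵢ[ℝ] H}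
    (hR : ∀ x f, R x (R x⁻¹ f) = f) (f g : H) :
    ⟪lapl S R f, g⟫_ℝ = ⟪f, lapl S R g⟫_ℝ := by
  rw [lapl_apply, lapl_apply, real_inner_smul_left, real_inner_smul_right, sum_inner, inner_sum]
  congr 1
  simp only [inner_sub_left, inner_sub_right, Finset.sum_sub_distrib]
  congr 1
  refine Finset.sum_bij (fun s _ => s⁻¹) (fun s hs => hS s hs) (by simp) 
    (fun s hs => ⟨s⁻¹, hS s hs, by simp⟩) fun s _ => ?_
  rw [← (R s).inner_map_map f, hR]

theorem inner_lapl_step {S : Finset G} (hS : ∀ x ∈ S, x⁻¹ ∈ S) {R : G → H →ₗᵢ[ℝ] H}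
    (hR : ∀ x f, R x (R x⁻¹ f) = f) (f : H) :
    ⟪lapl S R (f - lapl S R f), f - lapl S R f⟫_ℝ ≤ ⟪lapl S R f, f⟫_ℝ - ‖lapl S R f‖ ^ 2 := by
  have h1 := inner_lapl_self_le S R (lapl S R f)
  have h2 := lapl_symm hS hR (lapl S R f) f
  rw [map_sub, inner_sub_left, inner_sub_right, inner_sub_right, h2]
  rw [real_inner_self_eq_norm_sq]
  linarith

theorem norm_sub_le_of_energy {S : Finset G} {R : G → H →ₗᵢ[ℝ] H} {s : G} (hs : s ∈ S) (f : H) :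
    ‖R s f - f‖ ^ 2 ≤ 4 * S.card * ⟪lapl S R f, f⟫_ℝ := by
  have hc : (0 : ℝ) < S.card := by exact_mod_cast Finset.card_pos.2 ⟨s, hs⟩
  rw [inner_lapl_self, ← mul_assoc, mul_inv_cancel₀ (by positivity), one_mul]
  exact Finset.single_le_sum (f := fun s => ‖R s f - f‖ ^ 2) (fun _ _ => by positivity) hs

end Laplacian

section RightTranslation

variable {G : Type*} [Group G]

theorem memlp_two_iff (f : G → ℝ) : Memℓp f 2 ↔ Summable fun x => f x ^ 2 := by
  rw [memℓp_gen_iff (by norm_num)]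
  simp

/-- Right translation on `ℓ²(G)`. -/
noncomputable def rightTrans (g : G) : lp (fun _ : G => ℝ) 2 →ₗᵢ[ℝ] lp (fun _ : G => ℝ) 2 where
  toFun f := ⟨fun x => f (x * g), by
    have h := (memlp_two_iff _).1 (lp.memℓp f)
    exact (memlp_two_iff _).2 ((Equiv.mulRight g).summable_iff.2 h)⟩
  map_add' f f' := by ext; rfl
  map_smul' c f := by ext; rfl
  norm_map' f := by
    rw [← sq_eq_sq₀ (norm_nonneg _) (norm_nonneg _), ← real_inner_self_eq_norm_sq,
      ← real_inner_self_eq_norm_sq, lp.inner_eq_tsum, lp.inner_eq_tsum]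
    exact (Equiv.mulRight g).tsum_eq (fun x => ⟪f x, f x⟫_ℝ)

theorem rightTrans_apply (g x : G) (f : lp (fun _ : G => ℝ) 2) :
    rightTrans g f x = f (x * g) := rfl

theorem rightTrans_mul (g h : G) (f : lp (fun _ : G => ℝ) 2) :
    rightTrans (g * h) f = rightTrans g (rightTrans h f) := by
  ext x
  simp [rightTrans_apply, mul_assoc]

theorem rightTrans_rightTrans_inv (g : G) (f : lp (fun _ : G => ℝ) 2) :
    rightTrans g (rightTrans g⁻¹ f) = f := by
  ext x
  simp [rightTrans_apply]

theorem norm_rightTrans_sub_le {S : Finset G} {n : ℕ} {g : G} (hg : g ∈ ball (S : Set G) n)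
    (f : lp (fun _ : G => ℝ) 2) :
    ‖rightTrans g f - f‖ ≤ n * √(4 * S.card * ⟪lapl S rightTrans f, f⟫_ℝ) := by
  obtain ⟨l, h1, h2, rfl⟩ := hg
  have key : ‖rightTrans l.prod f - f‖
      ≤ l.length * √(4 * S.card * ⟪lapl S rightTrans f, f⟫_ℝ) := by
    clear h2
    induction l with
    | nil =>
      have : rightTrans (1 : G) f = f := by ext; simp [rightTrans_apply]
      simp [this]
    | cons a l ih =>
      have ih := ih fun x hx => h1 x (by simp [hx])
      have ha : ‖rightTrans a f - f‖ ≤ √(4 * S.card * ⟪lapl S rightTrans f, f⟫_ℝ) :=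
        Real.le_sqrt_of_sq_le (norm_sub_le_of_energy (h1 a (by simp)) f)
      rw [List.prod_cons, rightTrans_mul]
      have : rightTrans a (rightTrans l.prod f) - f
          = rightTrans a (rightTrans l.prod f - f) + (rightTrans a f - f) := by
        rw [map_sub]; abel
      rw [this]
      refine (norm_add_le _ _).trans ?_
      rw [(rightTrans a).norm_map, List.length_cons]
      push_cast
      linarith
  exact key.trans (by gcongr)

end RightTranslation

open scoped InnerProductSpace

section Walk

variable {G : Type*} [Group G]

open Classical in
/-- The distribution of the lazy random walk after `n` steps, as an element of `ℓ²(G)`. -/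
noncomputable def walk (S : Finset G) : ℕ → lp (fun _ : G => ℝ) 2
  | 0 => lp.single 2 (1 : G) (1 : ℝ)
  | n + 1 => walk S n - lapl S rightTrans (walk S n)

theorem walk_succ_apply {S : Finset G} (hS : S.Nonempty) (n : ℕ) (x : G) :
    walk S (n + 1) x = 2⁻¹ * walk S n x + (2 * (S.card : ℝ))⁻¹ * ∑ s ∈ S, walk S n (x * s) := by
  have hc : (0 : ℝ) < S.card := by exact_mod_cast hS.card_pos
  have h : (lapl S rightTrans (walk S n)) x
      = (2 * (S.card : ℝ))⁻¹ * ∑ s ∈ S, (walk S n x - walk S n (x * s)) := by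
    rw [lapl_apply, lp.coeFn_smul, Pi.smul_apply, lp.coeFn_sum, Finset.sum_apply, smul_eq_mul]
    rfl
  have h2 : walk S (n + 1) x = walk S n x - (lapl S rightTrans (walk S n)) x := rfl
  rw [h2, h, Finset.sum_sub_distrib, Finset.sum_const, nsmul_eq_mul]
  field_simp
  ring

theorem walk_nonneg {S : Finset G} (hS : S.Nonempty) (n : ℕ) (x : G) : 0 ≤ walk S n x := by
  classical
  induction n generalizing x with
  | zero =>
    simp only [walk, lp.coeFn_single, Pi.single_apply]
    split_ifs <;> norm_num
  | succ n ih =>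
    rw [walk_succ_apply hS]
    have := ih x
    have h2 : 0 ≤ ∑ s ∈ S, walk S n (x * s) := Finset.sum_nonneg fun s _ => ih _
    positivity

theorem hasSum_walk {S : Finset G} (hS : S.Nonempty) (n : ℕ) :
    HasSum (fun x => walk S n x) 1 := by
  classical
  have hc : (0 : ℝ) < S.card := by exact_mod_cast hS.card_pos
  induction n with
  | zero =>
    simp only [walk, lp.coeFn_single]
    exact hasSum_pi_single (1 : G) (1 : ℝ)
  | succ n ih =>
    have h : HasSum (fun x => 2⁻¹ * walk S n x
        + (2 * (S.card : ℝ))⁻¹ * ∑ s ∈ S, walk S n (x * s))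
        (2⁻¹ * 1 + (2 * (S.card : ℝ))⁻¹ * ∑ s ∈ S, 1) :=
      (ih.mul_left _).add ((hasSum_sum fun s _ => 
        (Equiv.mulRight s).hasSum_iff.2 ih).mul_left _)
    simp_rw [walk_succ_apply hS]
    convert h using 1
    simp
    field_simp
    norm_num

theorem walk_eq_zero {S : Finset G} (hS : IsSymmGen S) (hne : S.Nonempty) (n : ℕ) {x : G}
    (hx : x ∉ ball (S : Set G) n) : walk S n x = 0 := by
  classical
  induction n generalizing x with
  | zero =>
    have : x ≠ 1 := by simpa [ball_zero] using hx
    simp [walk, this]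
  | succ n ih =>
    rw [walk_succ_apply hne, ih fun h => hx (ball_mono _ (Nat.le_succ n) h), 
      Finset.sum_eq_zero, mul_zero, mul_zero, add_zero]
    intro s hs
    refine ih fun h => hx ?_
    have := mul_mem_ball h (mem_ball_one (S := (S : Set G)) (by exact_mod_cast hS.1 s hs))
    simpa using this

theorem norm_sq_eq_tsum (f : lp (fun _ : G => ℝ) 2) : ‖f‖ ^ 2 = ∑' x, f x ^ 2 := by
  rw [← real_inner_self_eq_norm_sq, lp.inner_eq_tsum]
  simp [pow_two]

theorem one_le_growth_mul_norm_walk {S : Finset G} (hS : IsSymmGen S) (hne : S.Nonempty) (n : ℕ) :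
    1 ≤ (growth (S : Set G) n : ℝ) * ‖walk S n‖ ^ 2 := by
  classical
  set B := (ball_finite S.finite_toSet n).toFinset with hB
  have h1 : ∑ x ∈ B, walk S n x = 1 := by
    refine (hasSum_sum_of_ne_finset_zero fun x hx => ?_).unique (hasSum_walk hne n)
    exact walk_eq_zero hS hne n (by simpa [hB] using hx)
  have h2 : ∑ x ∈ B, walk S n x ^ 2 ≤ ‖walk S n‖ ^ 2 := by
    rw [norm_sq_eq_tsum]
    exact ((memlp_two_iff _).1 (lp.memℓp (walk S n))).sum_le_tsum B fun _ _ => sq_nonneg _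
  have h3 := sq_sum_le_card_mul_sum_sq (s := B) (f := fun x => walk S n x)
  rw [h1] at h3
  have h4 : (B.card : ℝ) = growth (S : Set G) n := by
    rw [growth, Set.ncard_eq_toFinset_card _ (ball_finite S.finite_toSet n)]
  rw [← h4]
  calc (1 : ℝ) = 1 ^ 2 := by norm_num
    _ ≤ _ := h3
    _ ≤ _ := by gcongr

theorem walk_le [Infinite G] {S : Finset G} (hS : IsSymmGen S) (hne : S.Nonempty) (n k : ℕ)
    (x : G) :
    walk S n x ≤ ((k : ℝ) + 1)⁻¹
      + k * √(4 * S.card * ⟪lapl S rightTrans (walk S n), walk S n⟫_ℝ) := by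
  classical
  set B := (ball_finite S.finite_toSet k).toFinset with hB
  set δ := (k : ℝ) * √(4 * S.card * ⟪lapl S rightTrans (walk S n), walk S n⟫_ℝ) with hδ
  have h1 : ∀ g ∈ B, walk S n x ≤ walk S n (x * g) + δ := by
    intro g hg
    have := norm_rightTrans_sub_le (S := S) (n := k) (g := g) (by simpa [hB] using hg) (walk S n)
    have h' := lp.norm_apply_le_norm two_ne_zero (rightTrans g (walk S n) - walk S n) x
    have h'' : (rightTrans g (walk S n) - walk S n) x = walk S n (x * g) - walk S n x := rfl
    rw [h'', Real.norm_eq_abs] at h'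
    have := (abs_le.1 (h'.trans this)).1
    linarith
  have h2 : ∑ g ∈ B, walk S n (x * g) ≤ 1 :=
    sum_le_hasSum B (fun g _ => walk_nonneg hne n _)
      ((Equiv.mulLeft x).hasSum_iff.2 (hasSum_walk hne n))
  have h3 := Finset.sum_le_sum h1
  rw [Finset.sum_const, nsmul_eq_mul, Finset.sum_add_distrib, Finset.sum_const, nsmul_eq_mul] at h3
  have h4 : (k : ℝ) + 1 ≤ B.card := by
    have := succ_le_growth hS k
    rw [growth, Set.ncard_eq_toFinset_card _ (ball_finite S.finite_toSet k)] at this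
    exact_mod_cast this
  have hB0 : (0 : ℝ) < B.card := lt_of_lt_of_le (by positivity) h4
  have h5 : walk S n x ≤ (B.card : ℝ)⁻¹ + δ := by
    rw [← mul_le_mul_iff_right₀ hB0, mul_add, mul_inv_cancel₀ hB0.ne']
    linarith
  refine h5.trans ?_
  gcongr

theorem norm_sq_walk_le {S : Finset G} (hne : S.Nonempty) (n : ℕ) {M : ℝ}
    (hM : ∀ x, walk S n x ≤ M) : ‖walk S n‖ ^ 2 ≤ M := by
  rw [norm_sq_eq_tsum]
  have h := (hasSum_walk hne n).mul_left M
  rw [mul_one] at h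
  refine hasSum_le (fun x => ?_) ((memlp_two_iff _).1 (lp.memℓp (walk S n))).hasSum h
  rw [pow_two]
  exact mul_le_mul_of_nonneg_right (hM x) (walk_nonneg hne n x)

theorem exists_lapl_small [Infinite G] {S : Finset G} (hS : IsSymmGen S) (hne : S.Nonempty)
    {d : ℕ} (hG : GrowthLE G d) {ε : ℝ} (hε : 0 < ε) :
    ∃ f : lp (fun _ : G => ℝ) 2, 0 < ⟪lapl S rightTrans f, f⟫_ℝ ∧
      ‖lapl S rightTrans f‖ ^ 2 ≤ ε * ⟪lapl S rightTrans f, f⟫_ℝ := by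
  by_contra hcon
  push Not at hcon
  set δ := min ε (1 / 2) with hδ
  have hδ0 : 0 < δ := by positivity
  have hδ1 : δ ≤ 1 / 2 := min_le_right _ _
  set q := 1 - δ with hq
  have hq0 : 0 < q := by linarith
  have hq1 : q < 1 := by linarith
  have hlow : ∀ f : lp (fun _ : G => ℝ) 2,
      δ * ⟪lapl S rightTrans f, f⟫_ℝ ≤ ‖lapl S rightTrans f‖ ^ 2 := by
    intro f
    rcases (inner_lapl_self_nonneg S rightTrans f).eq_or_lt with h | h
    · rw [← h]; simp
    · refine le_trans ?_ (hcon f h).le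
      gcongr
      exact min_le_left _ _
  have he : ∀ n, ⟪lapl S rightTrans (walk S n), walk S n⟫_ℝ
      ≤ q ^ n * ⟪lapl S rightTrans (walk S 0), walk S 0⟫_ℝ := by
    intro n
    induction n with
    | zero => simp
    | succ n ih =>
      have h1 := inner_lapl_step hS.1 rightTrans_rightTrans_inv (walk S n)
      have h2 := hlow (walk S n)
      change ⟪lapl S rightTrans (walk S n - lapl S rightTrans (walk S n)), 
        walk S n - lapl S rightTrans (walk S n)⟫_ℝ ≤ _
      calc _ ≤ _ := h1
        _ ≤ q * ⟪lapl S rightTrans (walk S n), walk S n⟫_ℝ := by rw [hq]; linarith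
        _ ≤ q * (q ^ n * ⟪lapl S rightTrans (walk S 0), walk S 0⟫_ℝ) := by gcongr
        _ = _ := by ring
  set A := 4 * S.card * ⟪lapl S rightTrans (walk S 0), walk S 0⟫_ℝ with hA
  obtain ⟨C, hC, hgr⟩ := hG S
  have main : ∀ n : ℕ, 1 ≤ n →
      1 / C ≤ 1 / (n : ℝ) + √A * ((n : ℝ) ^ (2 * d + 1) * √q ^ n) := by
    intro n hn
    have hn0 : (0 : ℝ) < n := by exact_mod_cast hn
    have h1 := one_le_growth_mul_norm_walk hS hne n
    have h2 := norm_sq_walk_le hne n (walk_le hS hne n (n ^ (d + 1)))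
    have h3 := hgr n hn
    have h4 : √(4 * S.card * ⟪lapl S rightTrans (walk S n), walk S n⟫_ℝ) ≤ √A * √q ^ n := by
      have h7 : √(q ^ n) = √q ^ n := by
        rw [← Real.sqrt_sq (show 0 ≤ √q ^ n by positivity), ← pow_mul, mul_comm n 2, pow_mul,
          Real.sq_sqrt hq0.le]
      rw [← h7, ← Real.sqrt_mul' _ (by positivity)]
      apply Real.sqrt_le_sqrt
      have := he n
      calc _ ≤ 4 * (S.card : ℝ) * (q ^ n * ⟪lapl S rightTrans (walk S 0), walk S 0⟫_ℝ) := by gcongr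
        _ = _ := by rw [hA]; ring
    have h5 : ‖walk S n‖ ^ 2 ≤ ((n : ℝ) ^ (d + 1))⁻¹ + (n : ℝ) ^ (d + 1) * (√A * √q ^ n) := by
      refine h2.trans ?_
      push_cast
      gcongr
      linarith
    have h6 : 1 ≤ C * (n : ℝ) ^ d * 
        (((n : ℝ) ^ (d + 1))⁻¹ + (n : ℝ) ^ (d + 1) * (√A * √q ^ n)) := by
      refine h1.trans ?_
      gcongr
    rw [div_le_iff₀ hC]
    refine h6.trans (le_of_eq ?_)
    field_simp
    ring
  have hlim : Filter.Tendsto (fun n : ℕ => 1 / (n : ℝ) + √A * ((n : ℝ) ^ (2 * d + 1) * √q ^ n))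
      Filter.atTop (nhds (0 + √A * 0)) := by
    refine tendsto_one_div_atTop_nhds_zero_nat.add (Filter.Tendsto.const_mul _ ?_)
    refine tendsto_pow_const_mul_const_pow_of_lt_one _ (Real.sqrt_nonneg _) ?_
    rw [Real.sqrt_lt' one_pos]; simpa using hq1
  have := ge_of_tendsto hlim (Filter.eventually_atTop.2 ⟨1, main⟩)
  simp only [mul_zero, add_zero] at this
  have h0 : 0 < 1 / C := by positivity
  linarith

end Walk

set_option linter.unusedSectionVars false
open scoped InnerProductSpace

section Harmonic

variable {G : Type*} [Group G]

/-- The space of Lipschitz functions on `G` that are harmonic for right multiplication by `S`. -/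
def lipHarm (S : Finset G) : Submodule ℝ (G → ℝ) where
  carrier := {f | (∃ L : ℝ, ∀ x, ∀ s ∈ S, |f (x * s) - f x| ≤ L) ∧
    ∀ x, ∑ s ∈ S, (f (x * s) - f x) = 0}
  zero_mem' := ⟨⟨0, by simp⟩, by simp⟩
  add_mem' := by
    rintro f g ⟨⟨L, hL⟩, hf⟩ ⟨⟨M, hM⟩, hg⟩
    refine ⟨⟨L + M, fun x s hs => ?_⟩, fun x => ?_⟩
    · have := (abs_add_le (f (x * s) - f x) (g (x * s) - g x)).trans
        (add_le_add (hL x s hs) (hM x s hs))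
      refine le_trans (le_of_eq ?_) this
      congr 1
      simp only [Pi.add_apply]; ring
    · have := congrArg₂ (· + ·) (hf x) (hg x)
      simp only [← Finset.sum_add_distrib, add_zero] at this
      rw [← this]
      refine Finset.sum_congr rfl fun s _ => ?_
      simp only [Pi.add_apply]; ring
  smul_mem' := by
    rintro c f ⟨⟨L, hL⟩, hf⟩
    refine ⟨⟨|c| * L, fun x s hs => ?_⟩, fun x => ?_⟩
    · simp only [Pi.smul_apply, smul_eq_mul, ← mul_sub, abs_mul]
      exact mul_le_mul_of_nonneg_left (hL x s hs) (abs_nonneg c)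
    · simp only [Pi.smul_apply, smul_eq_mul, ← mul_sub, ← Finset.mul_sum, hf x, mul_zero]

theorem exists_almost_harmonic [Infinite G] {S : Finset G} (hS : IsSymmGen S) (hne : S.Nonempty)
    {d : ℕ} (hG : GrowthLE G d) {ε : ℝ} (hε : 0 < ε) :
    ∃ F : G → ℝ, F 1 = 0 ∧ (∀ x, ∀ s ∈ S, |F (x * s) - F x| ≤ 4 * S.card) ∧
      (∀ x, |∑ s ∈ S, (F (x * s) - F x)| ≤ ε) ∧ 4 ≤ ∑ t ∈ S, |F t| := by
  have hc : (0 : ℝ) < S.card := by exact_mod_cast hne.card_pos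
  set η := (ε / (4 * S.card * √S.card)) ^ 2 with hη
  have hη0 : 0 < η := by positivity
  obtain ⟨f₀, hf₀, hf₀'⟩ := exists_lapl_small hS hne hG hη0
  set e := ⟪lapl S rightTrans f₀, f₀⟫_ℝ with he
  set f := (√e)⁻¹ • f₀ with hf
  have hse : √e * √e = e := Real.mul_self_sqrt hf₀.le
  have hse0 : 0 < √e := Real.sqrt_pos.2 hf₀
  have hfe : ⟪lapl S rightTrans f, f⟫_ℝ = 1 := by
    rw [hf, map_smul, real_inner_smul_left, real_inner_smul_right, ← he, ← mul_assoc, 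
      ← mul_inv, hse, inv_mul_cancel₀ hf₀.ne']
  have hfl : ‖lapl S rightTrans f‖ ≤ ε / (4 * S.card * √S.card) := by
    rw [← sq_le_sq₀ (norm_nonneg _) (by positivity), ← hη, hf, map_smul, norm_smul, mul_pow,
      Real.norm_eq_abs, sq_abs, inv_pow, Real.sq_sqrt hf₀.le, inv_mul_le_iff₀ hf₀]
    linarith
  have hb : ∀ s ∈ S, ‖rightTrans s f - f‖ ≤ 2 * √S.card := by
    intro s hs
    have := norm_sub_le_of_energy (R := rightTrans) hs f
    rw [hfe, mul_one] at this
    rw [← sq_le_sq₀ (norm_nonneg _) (by positivity), mul_pow, Real.sq_sqrt hc.le]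
    linarith
  obtain ⟨s₀, hs₀, hs₀'⟩ : ∃ s ∈ S, 4 ≤ ‖rightTrans s f - f‖ ^ 2 := by
    by_contra! hcon
    have h1 := inner_lapl_self S rightTrans f
    have h2 : ∑ s ∈ S, ‖rightTrans s f - f‖ ^ 2 < ∑ s ∈ S, 4 := Finset.sum_lt_sum_of_nonempty hne hcon
    rw [Finset.sum_const, nsmul_eq_mul] at h2
    rw [hfe] at h1
    have : (4 * (S.card : ℝ))⁻¹ * ∑ s ∈ S, ‖rightTrans s f - f‖ ^ 2 < (4 * (S.card : ℝ))⁻¹ * (S.card * 4) := by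
      gcongr
    rw [← h1] at this
    field_simp at this
    linarith
  set v := rightTrans s₀ f - f with hv
  have hdiff : ∀ x s, ⟪rightTrans (x * s) f - f, v⟫_ℝ - ⟪rightTrans x f - f, v⟫_ℝ
      = ⟪rightTrans x (rightTrans s f - f), v⟫_ℝ := by
    intro x s
    rw [← inner_sub_left, rightTrans_mul, map_sub]
    congr 1
    abel
  refine ⟨fun x => ⟪rightTrans x f - f, v⟫_ℝ, ?_, ?_, ?_, ?_⟩
  · have : rightTrans (1 : G) f = f := by ext; simp [rightTrans_apply]
    simp only [this, sub_self, inner_zero_left]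
  · intro x s hs
    rw [hdiff]
    refine (abs_real_inner_le_norm _ _).trans ?_
    rw [(rightTrans x).norm_map]
    calc _ ≤ (2 * √S.card) * (2 * √S.card) := by gcongr; exacts [hb s hs, hb s₀ hs₀]
      _ = 4 * (√S.card * √S.card) := by ring
      _ = _ := by rw [Real.mul_self_sqrt hc.le]
  · intro x
    simp only [hdiff]
    rw [← sum_inner, ← map_sum]
    have h1 : ∑ s ∈ S, (rightTrans s f - f) = -((2 * (S.card : ℝ)) • lapl S rightTrans f) := by
      rw [lapl_apply, smul_smul, mul_inv_cancel₀ (by positivity), one_smul, ← Finset.sum_neg_distrib]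
      exact Finset.sum_congr rfl fun s _ => by abel
    rw [h1]
    refine (abs_real_inner_le_norm _ _).trans ?_
    rw [(rightTrans x).norm_map, norm_neg, norm_smul, Real.norm_of_nonneg (by positivity)]
    calc _ ≤ 2 * S.card * (ε / (4 * S.card * √S.card)) * (2 * √S.card) := by 
          gcongr; exact hb s₀ hs₀
      _ = ε := by field_simp; norm_num
  · refine le_trans ?_ (Finset.single_le_sum (f := fun t => |⟪rightTrans t f - f, v⟫_ℝ|) 
      (fun _ _ => abs_nonneg _) hs₀)
    rw [← hv, real_inner_self_eq_norm_sq]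
    exact hs₀'.trans (le_abs_self _)

theorem abs_sub_le_of_mem_ball {S : Finset G} {F : G → ℝ} {L : ℝ}
    (hF : ∀ x, ∀ s ∈ S, |F (x * s) - F x| ≤ L) {n : ℕ} {g : G} (hg : g ∈ ball (S : Set G) n) 
    (hL : 0 ≤ L) (x : G) : |F (x * g) - F x| ≤ n * L := by
  obtain ⟨l, h1, h2, rfl⟩ := hg
  have key : |F (x * l.prod) - F x| ≤ l.length * L := by
    clear h2
    induction l generalizing x with
    | nil => simp
    | cons a l ih =>
      have h3 := ih (x * a) (fun y hy => h1 y (by simp [hy]))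
      have h4 := hF x a (h1 a (by simp))
      rw [List.prod_cons, List.length_cons, ← mul_assoc]
      push_cast
      have := abs_sub_le (F (x * a * l.prod)) (F (x * a)) (F x)
      linarith
  exact key.trans (by gcongr)

theorem exists_lipHarm_ne [Infinite G] {S : Finset G} (hS : IsSymmGen S)
    {d : ℕ} (hG : GrowthLE G d) : ∃ f ∈ lipHarm S, ∃ x, f x ≠ f 1 := by
  have hne : S.Nonempty := by
    rw [Finset.nonempty_iff_ne_empty]
    rintro rfl
    have := succ_le_growth hS 1
    have h2 : ball ((∅ : Finset G) : Set G) 1 ⊆ {1} := by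
      refine (ball_succ_subset _ 0).trans ?_
      simp [ball_zero]
    have h3 := Set.ncard_le_ncard h2 (by simp)
    rw [Set.ncard_singleton] at h3
    rw [growth] at this
    omega
  choose F hF1 hF2 hF3 hF4 using fun n : ℕ =>
    exists_almost_harmonic hS hne hG (show (0 : ℝ) < 1 / ((n : ℝ) + 1) by positivity)
  let U : Ultrafilter ℕ := Filter.hyperfilter ℕ
  have hU : (U : Filter ℕ) ≤ Filter.atTop := Nat.hyperfilter_le_atTop
  have hlim : ∀ x, ∃ y, Filter.Tendsto (fun n => F n x) U (nhds y) := by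
    intro x
    obtain ⟨m, hm⟩ := hS.exists_mem_ball x
    have hb : ∀ n, F n x ∈ Set.Icc (-(m * (4 * S.card) : ℝ)) (m * (4 * S.card)) := by
      intro n
      have := abs_sub_le_of_mem_ball (hF2 n) hm (by positivity) 1
      rw [one_mul, hF1, sub_zero] at this
      exact abs_le.1 this
    have hcomp : IsCompact (Set.Icc (-(m * (4 * S.card) : ℝ)) (m * (4 * S.card))) := isCompact_Icc
    obtain ⟨y, -, hy⟩ := hcomp.ultrafilter_le_nhds (U.map fun n => F n x) (by
      rw [Ultrafilter.coe_map, Filter.le_principal_iff]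
      exact Filter.mem_map.2 (Filter.univ_mem' hb))
    exact ⟨y, hy⟩
  choose f hf using hlim
  refine ⟨f, ⟨⟨4 * S.card, fun x s hs => ?_⟩, fun x => ?_⟩, ?_⟩
  · exact le_of_tendsto ((hf (x * s)).sub (hf x)).abs (Filter.Eventually.of_forall fun n => hF2 n x s hs)
  · have h1 : Filter.Tendsto (fun n => |∑ s ∈ S, (F n (x * s) - F n x)|) U
        (nhds |∑ s ∈ S, (f (x * s) - f x)|) :=
      (tendsto_finsetSum _ fun s _ => (hf (x * s)).sub (hf x)).abs
    have h2 := tendsto_one_div_add_atTop_nhds_zero_nat (𝕜 := ℝ) |>.mono_left hU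
    have := le_of_tendsto_of_tendsto h1 h2 (Filter.Eventually.of_forall fun n => hF3 n x)
    exact abs_nonpos_iff.1 this
  · have h1 : f 1 = 0 := tendsto_nhds_unique (hf 1) (by simp [hF1])
    have h2 : 4 ≤ ∑ t ∈ S, |f t| :=
      ge_of_tendsto (tendsto_finsetSum _ fun s _ => (hf s).abs) (Filter.Eventually.of_forall hF4)
    by_contra! hcon
    rw [Finset.sum_eq_zero] at h2
    · norm_num at h2
    · intro t _
      rw [hcon, h1, abs_zero]

end Harmonic

section Analysis

variable {G : Type*} [Group G]

/-- The ball of radius `n` as a finset. -/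
noncomputable def fball (S : Finset G) (n : ℕ) : Finset G :=
  (ball_finite S.finite_toSet n).toFinset

theorem mem_fball {S : Finset G} {n : ℕ} {g : G} : g ∈ fball S n ↔ g ∈ ball (S : Set G) n := by
  simp [fball]

theorem card_fball (S : Finset G) (n : ℕ) : (fball S n).card = growth (S : Set G) n := by
  rw [growth, Set.ncard_eq_toFinset_card _ (ball_finite S.finite_toSet n), fball]

theorem fball_mono (S : Finset G) {m n : ℕ} (h : m ≤ n) : fball S m ⊆ fball S n := fun g hg =>
  mem_fball.2 (ball_mono _ h (mem_fball.1 hg))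

theorem mul_mem_fball {S : Finset G} {m n : ℕ} {a b : G} (ha : a ∈ fball S m)
    (hb : b ∈ fball S n) : a * b ∈ fball S (m + n) :=
  mem_fball.2 (mul_mem_ball (mem_fball.1 ha) (mem_fball.1 hb))

theorem mem_fball_one {S : Finset G} {s : G} (hs : s ∈ S) : s ∈ fball S 1 :=
  mem_fball.2 (mem_ball_one hs)

theorem IsSymmGen.inv_mem_fball {S : Finset G} (hS : IsSymmGen S) {n : ℕ} {a : G}
    (ha : a ∈ fball S n) : a⁻¹ ∈ fball S n :=
  mem_fball.2 (hS.inv_mem_ball (mem_fball.1 ha))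

/-- The energy density of a function at a point. -/
def energy (S : Finset G) (f : G → ℝ) (x : G) : ℝ := ∑ s ∈ S, (f (x * s) - f x) ^ 2

theorem energy_nonneg (S : Finset G) (f : G → ℝ) (x : G) : 0 ≤ energy S f x :=
  Finset.sum_nonneg fun _ _ => sq_nonneg _

theorem sum_mul_right_le {S : Finset G} {F : G → ℝ} (hF : ∀ x, 0 ≤ F x) {m n : ℕ} {g : G}
    (hg : g ∈ fball S n) : ∑ x ∈ fball S m, F (x * g) ≤ ∑ x ∈ fball S (m + n), F x := by
  classical
  rw [← Finset.sum_image (f := F) (g := fun x => x * g) (fun x _ y _ h => mul_right_cancel h)]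
  refine Finset.sum_le_sum_of_subset_of_nonneg ?_ fun x _ _ => hF x
  intro y hy
  obtain ⟨x, hx, rfl⟩ := Finset.mem_image.1 hy
  exact mul_mem_fball hx hg

theorem sum_sq_sub_le {S : Finset G} (f : G → ℝ) (R : ℕ) (l : List G) (hl : ∀ x ∈ l, x ∈ S) (k : ℕ) 
    {p : G} (hp : p ∈ fball S k) :
    ∑ x ∈ fball S R, (f (x * p * l.prod) - f (x * p)) ^ 2
      ≤ l.length ^ 2 * ∑ x ∈ fball S (R + (k + l.length)), energy S f x := by
  induction l generalizing k p with
  | nil => simp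
  | cons s l ih =>
    have hs : s ∈ S := hl s (by simp)
    have h1 := ih (fun x hx => hl x (by simp [hx])) (k + 1) (mul_mem_fball hp (mem_fball_one hs))
    have h2 : ∑ x ∈ fball S R, (f (x * p * s) - f (x * p)) ^ 2 ≤
        ∑ x ∈ fball S (R + (k + (l.length + 1))), energy S f x := by
      calc _ ≤ ∑ x ∈ fball S R, energy S f (x * p) := Finset.sum_le_sum fun x _ =>
            Finset.single_le_sum (f := fun s => (f (x * p * s) - f (x * p)) ^ 2) 
              (fun _ _ => sq_nonneg _) hs
        _ ≤ ∑ x ∈ fball S (R + k), energy S f x := sum_mul_right_le (energy_nonneg S f) hp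
        _ ≤ _ := Finset.sum_le_sum_of_subset_of_nonneg (fball_mono S (by omega)) 
            fun x _ _ => energy_nonneg S f x
    simp only [List.prod_cons, List.length_cons, ← mul_assoc] at h1 ⊢
    rw [show k + 1 + l.length = k + (l.length + 1) by ring] at h1
    set n := l.length with hn
    set Q := ∑ x ∈ fball S (R + (k + (n + 1))), energy S f x with hQ
    rcases Nat.eq_zero_or_pos n with h0 | h0
    · have : l = [] := List.length_eq_zero_iff.1 h0
      subst this
      simp only [List.prod_nil, mul_one]
      refine h2.trans ?_
      rw [h0]; simp
    have hn0 : (0 : ℝ) < n := by exact_mod_cast h0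
    have key : ∀ a b : ℝ, (a + b) ^ 2 ≤ ((n : ℝ) + 1) * (a ^ 2 / n + b ^ 2) := by
      intro a b
      have : ((n : ℝ) + 1) * (a ^ 2 / n + b ^ 2) - (a + b) ^ 2 = (a - n * b) ^ 2 / n := by
        field_simp; ring
      have h3 : 0 ≤ (a - n * b) ^ 2 / n := by positivity
      linarith
    calc ∑ x ∈ fball S R, (f (x * p * s * l.prod) - f (x * p)) ^ 2 
        ≤ ∑ x ∈ fball S R, ((n : ℝ) + 1) * ((f (x * p * s * l.prod) - f (x * p * s)) ^ 2 / n
          + (f (x * p * s) - f (x * p)) ^ 2) := by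
          refine Finset.sum_le_sum fun x _ => le_trans (le_of_eq ?_) (key _ _)
          ring
      _ = ((n : ℝ) + 1) * ((∑ x ∈ fball S R, (f (x * p * s * l.prod) - f (x * p * s)) ^ 2) / n
          + ∑ x ∈ fball S R, (f (x * p * s) - f (x * p)) ^ 2) := by
          rw [← Finset.mul_sum, Finset.sum_add_distrib, Finset.sum_div]
      _ ≤ ((n : ℝ) + 1) * ((n ^ 2 * Q) / n + Q) := by gcongr
      _ = _ := by push_cast; field_simp

/-- The Poincaré inequality on balls. -/
theorem poincare {S : Finset G} (hS : IsSymmGen S) (f : G → ℝ) (R : ℕ)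
    (hf : ∑ x ∈ fball S R, f x = 0) :
    (fball S R).card * ∑ x ∈ fball S R, f x ^ 2 ≤
      2 * (R : ℝ) ^ 2 * (fball S (2 * R)).card * ∑ x ∈ fball S (3 * R), energy S f x := by
  have h1 : ∑ x ∈ fball S R, ∑ y ∈ fball S R, (f y - f x) ^ 2 =
      2 * ((fball S R).card * ∑ x ∈ fball S R, f x ^ 2) := by
    have : ∀ x ∈ fball S R, ∑ y ∈ fball S R, (f y - f x) ^ 2 = 
        ∑ y ∈ fball S R, f y ^ 2 + (fball S R).card * f x ^ 2 := by
      intro x _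
      have : ∀ y, (f y - f x) ^ 2 = f y ^ 2 - 2 * f x * f y + f x ^ 2 := fun y => by ring
      simp only [this, Finset.sum_add_distrib, Finset.sum_sub_distrib, ← Finset.mul_sum, hf]
      simp
    rw [Finset.sum_congr rfl this, Finset.sum_add_distrib, ← Finset.mul_sum]
    simp; ring
  have h2 : ∑ x ∈ fball S R, ∑ y ∈ fball S R, (f y - f x) ^ 2 ≤
      ∑ x ∈ fball S R, ∑ z ∈ fball S (2 * R), (f (x * z) - f x) ^ 2 := by
    classical
    refine Finset.sum_le_sum fun x hx => ?_
    rw [← Finset.sum_image (f := fun y => (f y - f x) ^ 2) (g := fun z => x * z)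
      (fun _ _ _ _ h => mul_left_cancel h)]
    refine Finset.sum_le_sum_of_subset_of_nonneg ?_ fun _ _ _ => sq_nonneg _
    intro y hy
    refine Finset.mem_image.2 ⟨x⁻¹ * y, ?_, by group⟩
    rw [two_mul]
    exact mul_mem_fball (hS.inv_mem_fball hx) hy
  have h3 : ∀ z ∈ fball S (2 * R), ∑ x ∈ fball S R, (f (x * z) - f x) ^ 2 ≤
      4 * (R : ℝ) ^ 2 * ∑ x ∈ fball S (3 * R), energy S f x := by
    intro z hz
    obtain ⟨l, hl1, hl2, rfl⟩ := mem_fball.1 hz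
    have := sum_sq_sub_le f R l hl1 0 (p := 1) (mem_fball.2 (one_mem_ball _ _))
    simp only [mul_one] at this
    refine this.trans ?_
    have h4 : (l.length : ℝ) ≤ 2 * R := by exact_mod_cast hl2
    calc _ ≤ (2 * (R : ℝ)) ^ 2 * ∑ x ∈ fball S (3 * R), energy S f x := by
          gcongr
          · exact Finset.sum_nonneg fun x _ => energy_nonneg S f x
          · exact fun _ _ _ => energy_nonneg S f _
          · exact fball_mono S (by omega)
      _ = _ := by ring
  rw [h1, Finset.sum_comm] at h2
  have h4 := Finset.sum_le_sum h3
  rw [Finset.sum_const, nsmul_eq_mul] at h4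
  linarith

theorem exists_cutoff (S : Finset G) (hS : IsSymmGen S) {R : ℕ} (hR : 1 ≤ R) : ∃ φ : G → ℝ,
    (∀ x ∈ fball S (R + 1), φ x = 1) ∧ (∀ x ∉ fball S (2 * R), φ x = 0) ∧
    ∀ x, ∀ s ∈ S, |φ (x * s) - φ x| ≤ 1 / R := by
  classical
  have hR0 : (0 : ℝ) < R := by exact_mod_cast hR
  let c : G → ℕ := fun x => ((Finset.Icc (R + 1) (2 * R)).filter fun n => x ∈ fball S n).card
  have hc : ∀ x, ∀ s ∈ S, c x ≤ c (x * s) + 1 := by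
    intro x s hs
    have hsub : (Finset.Icc (R + 1) (2 * R)).filter (fun n => x ∈ fball S n) ⊆
        insert (2 * R) (((Finset.Icc (R + 1) (2 * R)).filter 
          fun n => x * s ∈ fball S n).image fun n => n - 1) := by
      intro n hn
      simp only [Finset.mem_filter, Finset.mem_Icc, Finset.mem_insert, Finset.mem_image] at hn ⊢
      by_cases h : n = 2 * R
      · exact Or.inl h
      · refine Or.inr ⟨n + 1, ⟨by omega, mul_mem_fball hn.2 (mem_fball_one hs)⟩, by omega⟩
    refine (Finset.card_le_card hsub).trans ((Finset.card_insert_le _ _).trans ?_)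
    exact Nat.add_le_add_right Finset.card_image_le 1
  refine ⟨fun x => c x / R, fun x hx => ?_, fun x hx => ?_, fun x s hs => ?_⟩
  · have : c x = R := by
      simp only [c]
      rw [Finset.filter_true_of_mem, Nat.card_Icc]
      · omega
      · intro n hn
        exact fball_mono S (Finset.mem_Icc.1 hn).1 hx
    simp only [this, div_self hR0.ne']
  · have : c x = 0 := by
      simp only [c]
      rw [Finset.card_eq_zero, Finset.filter_eq_empty_iff]
      intro n hn h
      exact hx (fball_mono S (Finset.mem_Icc.1 hn).2 h)
    simp [this]
  · have h1 := hc x s hs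
    have h2 := hc (x * s) s⁻¹ (hS.1 s hs)
    rw [mul_inv_cancel_right] at h2
    rw [← sub_div, abs_div, abs_of_pos hR0]
    gcongr
    rw [abs_le]
    have h1' : (c x : ℝ) ≤ c (x * s) + 1 := by exact_mod_cast h1
    have h2' : (c (x * s) : ℝ) ≤ c x + 1 := by exact_mod_cast h2
    constructor <;> linarith

/-- The Caccioppoli inequality for harmonic functions. -/
theorem caccioppoli {S : Finset G} (hS : IsSymmGen S) {f : G → ℝ}
    (hf : ∀ x, ∑ s ∈ S, (f (x * s) - f x) = 0) {R : ℕ} (hR : 1 ≤ R) :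
    ∑ x ∈ fball S R, energy S f x ≤ S.card / (R : ℝ) ^ 2 * ∑ x ∈ fball S (4 * R), f x ^ 2 := by
  classical
  obtain ⟨φ, hφ1, hφ0, hφ⟩ := exists_cutoff S hS hR
  set h : G → ℝ := fun x => φ x ^ 2 * f x with hh
  have hh0 : ∀ x ∉ fball S (2 * R), h x = 0 := fun x hx => by simp [hh, hφ0 x hx]
  set T := fball S (2 * R + 1) with hT
  have e1 : ∑ x ∈ T, ∑ s ∈ S, (f (x * s) - f x) * h x = 0 :=
    Finset.sum_eq_zero fun x _ => by rw [← Finset.sum_mul, hf, zero_mul]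
  have e2 : ∑ x ∈ T, ∑ s ∈ S, (f (x * s) - f x) * h (x * s) = 0 := by
    rw [Finset.sum_comm]
    have : ∀ s ∈ S, ∑ x ∈ T, (f (x * s) - f x) * h (x * s) = 
        ∑ y ∈ fball S (2 * R), (f y - f (y * s⁻¹)) * h y := by
      intro s hs
      rw [← tsum_eq_sum (L := SummationFilter.unconditional G) (f := fun x => (f (x * s) - f x) * h (x * s)), 
        ← tsum_eq_sum (L := SummationFilter.unconditional G) (f := fun y => (f y - f (y * s⁻¹)) * h y), 
        ← (Equiv.mulRight s).tsum_eq (fun y => (f y - f (y * s⁻¹)) * h y)]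
      · simp
      · intro y hy
        rw [hh0 y hy, mul_zero]
      · intro x hx
        rw [hh0 (x * s), mul_zero]
        intro h'
        apply hx
        have := mul_mem_fball h' (mem_fball_one (hS.1 s hs))
        rwa [mul_inv_cancel_right] at this
    rw [Finset.sum_congr rfl this, Finset.sum_comm]
    refine Finset.sum_eq_zero fun y _ => ?_
    rw [← Finset.sum_mul]
    have : ∑ s ∈ S, (f y - f (y * s⁻¹)) = ∑ s ∈ S, (f y - f (y * s)) :=
      Finset.sum_nbij' (·⁻¹) (·⁻¹) hS.1 hS.1 (by simp) (by simp) (by simp)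
    have h2 : ∑ s ∈ S, (f y - f (y * s)) = - ∑ s ∈ S, (f (y * s) - f y) := by
      rw [← Finset.sum_neg_distrib]; simp
    rw [this, h2, hf, neg_zero, zero_mul]
  have e3 : ∑ x ∈ T, ∑ s ∈ S, (φ (x * s) * f (x * s) - φ x * f x) ^ 2 =
      ∑ x ∈ T, ∑ s ∈ S, f x * f (x * s) * (φ (x * s) - φ x) ^ 2 := by
    rw [← sub_eq_zero, ← Finset.sum_sub_distrib]
    simp only [← Finset.sum_sub_distrib]
    rw [← sub_eq_zero.2 (e2.trans e1.symm), ← Finset.sum_sub_distrib]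
    simp only [← Finset.sum_sub_distrib]
    refine Finset.sum_congr rfl fun x _ => Finset.sum_congr rfl fun s _ => ?_
    simp only [hh]; ring
  have e4 : ∑ x ∈ fball S R, energy S f x ≤ 
      ∑ x ∈ T, ∑ s ∈ S, (φ (x * s) * f (x * s) - φ x * f x) ^ 2 := by
    refine le_trans (le_of_eq ?_) (Finset.sum_le_sum_of_subset_of_nonneg 
      (fball_mono S (show R ≤ 2 * R + 1 by omega)) fun x _ _ => Finset.sum_nonneg fun _ _ => sq_nonneg _)
    refine Finset.sum_congr rfl fun x hx => Finset.sum_congr rfl fun s hs => ?_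
    rw [hφ1 x (fball_mono S (Nat.le_succ R) hx), hφ1 _ (mul_mem_fball hx (mem_fball_one hs)), 
      one_mul, one_mul]
  refine e4.trans (e3.le.trans ?_)
  have hR0 : (0 : ℝ) < R := by exact_mod_cast hR
  have e5 : ∀ x ∈ T, ∀ s ∈ S, f x * f (x * s) * (φ (x * s) - φ x) ^ 2 ≤ 
      (1 / (R : ℝ)) ^ 2 / 2 * (f x ^ 2 + f (x * s) ^ 2) := by
    intro x _ s hs
    have h1 : (φ (x * s) - φ x) ^ 2 ≤ (1 / (R : ℝ)) ^ 2 := by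
      rw [← sq_abs]; gcongr; exact hφ x s hs
    have h2 : f x * f (x * s) ≤ (f x ^ 2 + f (x * s) ^ 2) / 2 := by
      nlinarith [sq_nonneg (f x - f (x * s))]
    calc _ ≤ (f x ^ 2 + f (x * s) ^ 2) / 2 * (φ (x * s) - φ x) ^ 2 := by gcongr
      _ ≤ (f x ^ 2 + f (x * s) ^ 2) / 2 * (1 / (R : ℝ)) ^ 2 := by gcongr
      _ = _ := by ring
  have e6 : ∀ s ∈ S, ∑ x ∈ T, (f x ^ 2 + f (x * s) ^ 2) ≤ 2 * ∑ x ∈ fball S (4 * R), f x ^ 2 := by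
    intro s hs
    rw [Finset.sum_add_distrib, two_mul]
    refine add_le_add ?_ ?_
    · exact Finset.sum_le_sum_of_subset_of_nonneg (fball_mono S (by omega)) fun _ _ _ => sq_nonneg _
    · refine (sum_mul_right_le (F := fun x => f x ^ 2) (fun _ => sq_nonneg _) 
        (mem_fball_one hs)).trans ?_
      exact Finset.sum_le_sum_of_subset_of_nonneg (fball_mono S (by omega)) fun _ _ _ => sq_nonneg _
  calc _ ≤ ∑ x ∈ T, ∑ s ∈ S, (1 / (R : ℝ)) ^ 2 / 2 * (f x ^ 2 + f (x * s) ^ 2) :=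
        Finset.sum_le_sum fun x hx => Finset.sum_le_sum fun s hs => e5 x hx s hs
    _ = ∑ s ∈ S, (1 / (R : ℝ)) ^ 2 / 2 * ∑ x ∈ T, (f x ^ 2 + f (x * s) ^ 2) := by
        rw [Finset.sum_comm]; simp only [Finset.mul_sum]
    _ ≤ ∑ s ∈ S, (1 / (R : ℝ)) ^ 2 / 2 * (2 * ∑ x ∈ fball S (4 * R), f x ^ 2) := by
        refine Finset.sum_le_sum fun s hs => ?_
        gcongr
        exact e6 s hs
    _ = _ := by rw [Finset.sum_const, nsmul_eq_mul]; field_simp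

end Analysis

section Covering

variable {G : Type*} [Group G]

theorem card_mul_card_fball_le {S : Finset G} (hS : IsSymmGen S) {X : Finset G} {r k : ℕ} (z : G)
    (hX : ∀ x ∈ X, ∀ y ∈ X, x ≠ y → x⁻¹ * y ∉ fball S (2 * r))
    (hz : ∀ x ∈ X, z⁻¹ * x ∈ fball S k) :
    X.card * (fball S r).card ≤ (fball S (k + r)).card := by
  rw [← Finset.card_product]
  refine Finset.card_le_card_of_injOn (fun p => z⁻¹ * p.1 * p.2) ?_ ?_
  · rintro ⟨x, u⟩ hp
    simp only [Finset.coe_product, Set.mem_prod, Finset.mem_coe] at hp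
    exact mul_mem_fball (hz x hp.1) hp.2
  · rintro ⟨x, u⟩ hp ⟨y, v⟩ hq h
    simp only [Finset.coe_product, Set.mem_prod, Finset.mem_coe] at hp hq h
    have hxy : x = y := by
      by_contra hne
      apply hX x hp.1 y hq.1 hne
      have : x⁻¹ * y = u * v⁻¹ := by
        rw [mul_assoc, mul_assoc] at h
        have := mul_left_cancel h
        rw [inv_mul_eq_iff_eq_mul, ← mul_assoc, this, mul_inv_cancel_right]
      rw [this, two_mul]
      exact mul_mem_fball hp.2 (hS.inv_mem_fball hq.2)
    subst hxy
    rw [mul_left_cancel h]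

theorem exists_maximal_separated {S : Finset G} (hS : IsSymmGen S) (r R : ℕ) :
    ∃ X ⊆ fball S R, (∀ x ∈ X, ∀ y ∈ X, x ≠ y → x⁻¹ * y ∉ fball S (2 * r)) ∧
      ∀ z ∈ fball S R, ∃ x ∈ X, x⁻¹ * z ∈ fball S (2 * r) := by
  classical
  obtain ⟨X, hX, hmax⟩ := Finset.exists_max_image ((fball S R).powerset.filter fun X =>
    ∀ x ∈ X, ∀ y ∈ X, x ≠ y → x⁻¹ * y ∉ fball S (2 * r)) Finset.card ⟨∅, by simp⟩
  rw [Finset.mem_filter, Finset.mem_powerset] at hX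
  refine ⟨X, hX.1, hX.2, fun z hz => ?_⟩
  by_contra! hcon
  have hone : (1 : G) ∈ fball S (2 * r) := mem_fball.2 (one_mem_ball _ _)
  have hzX : z ∉ X := fun h => hcon z h (by simpa using hone)
  have := hmax (insert z X) (by
    rw [Finset.mem_filter, Finset.mem_powerset]
    refine ⟨Finset.insert_subset hz hX.1, fun x hx y hy hxy => ?_⟩
    rcases Finset.mem_insert.1 hx with rfl | hx' <;> rcases Finset.mem_insert.1 hy with rfl | hy'
    · exact absurd rfl hxy
    · intro h
      apply hcon y hy'
      simpa using hS.inv_mem_fball h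
    · exact hcon x hx'
    · exact hX.2 x hx' y hy' hxy)
  rw [Finset.card_insert_of_notMem hzX] at this
  omega

theorem exists_finset_reverse_doubling {S : Finset G} (hS : IsSymmGen S) {r M : ℕ} (hr : 1 ≤ r)
    (hM : 8 ≤ M) {ρ : ℝ}
    (hρ : ((fball S (8 * r)).card : ℝ) ≤ ρ * (fball S r).card) :
    ∃ X : Finset G, X.card * (fball S r).card ≤ (fball S (8 * (M * r))).card ∧
      ∀ f ∈ lipHarm S, (∀ x ∈ X, ∑ u ∈ fball S (2 * r), f (x * u) = 0) →
        ∑ x ∈ fball S (M * r), f x ^ 2 ≤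
          2 * S.card * ρ ^ 2 / (M : ℝ) ^ 2 * ∑ x ∈ fball S (8 * (M * r)), f x ^ 2 := by
  classical
  obtain ⟨X, hXR, hXs, hXc⟩ := exists_maximal_separated hS r (M * r)
  have hMr : 8 * r ≤ M * r := Nat.mul_le_mul_right r hM
  have hcard : ∀ n, (0 : ℝ) < (fball S n).card := fun n => by
    rw [card_fball]; exact_mod_cast growth_pos S.finite_toSet n
  have hmono : ∀ {m n}, m ≤ n → ((fball S m).card : ℝ) ≤ (fball S n).card := fun h => by
    exact_mod_cast Finset.card_le_card (fball_mono S h)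
  have hρ0 : 0 < ρ := by
    by_contra! hcon
    have := mul_nonpos_of_nonpos_of_nonneg hcon (hcard r).le
    linarith [hcard (8 * r)]
  have hr0 : (0 : ℝ) < r := by exact_mod_cast hr
  have hM0 : (0 : ℝ) < M := by exact_mod_cast (by omega : 0 < M)
  refine ⟨X, ?_, fun f hf hmean => ?_⟩
  · refine (card_mul_card_fball_le hS (k := M * r) 1 hXs fun x hx => ?_).trans 
      (Finset.card_le_card (fball_mono S (by omega)))
    simpa using hXR hx
  have h1 : ∑ x ∈ fball S (M * r), f x ^ 2 ≤ ∑ x ∈ X, ∑ u ∈ fball S (2 * r), f (x * u) ^ 2 := by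
    rw [← Finset.sum_product' X (fball S (2 * r)) fun x u => f (x * u) ^ 2]
    choose! c hc1 hc2 using hXc
    have : ∀ z ∈ fball S (M * r), f z ^ 2 = f (c z * ((c z)⁻¹ * z)) ^ 2 := by
      intro z _; rw [mul_inv_cancel_left]
    rw [Finset.sum_congr rfl this, ← Finset.sum_image (f := fun p : G × G => f (p.1 * p.2) ^ 2)
      (g := fun z => (c z, (c z)⁻¹ * z))]
    · refine Finset.sum_le_sum_of_subset_of_nonneg ?_ fun _ _ _ => sq_nonneg _
      intro p hp
      obtain ⟨z, hz, rfl⟩ := Finset.mem_image.1 hp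
      exact Finset.mem_product.2 ⟨hc1 z hz, hc2 z hz⟩
    · intro z _ z' _ h
      simp only [Prod.mk.injEq] at h
      have h' := h.2
      rw [h.1] at h'
      exact mul_left_cancel h'
  have h2 : ∀ x ∈ X, ∑ u ∈ fball S (2 * r), f (x * u) ^ 2 ≤ 
      8 * (r : ℝ) ^ 2 * ρ * ∑ u ∈ fball S (6 * r), energy S f (x * u) := by
    intro x hx
    have hp := poincare hS (fun u => f (x * u)) (2 * r) (hmean x hx)
    have he : ∀ u, energy S (fun u => f (x * u)) u = energy S f (x * u) := fun u => by
      simp only [energy, mul_assoc]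
    simp only [he] at hp
    rw [show 3 * (2 * r) = 6 * r by ring] at hp
    set E := ∑ u ∈ fball S (6 * r), energy S f (x * u) with hE
    have hE0 : 0 ≤ E := Finset.sum_nonneg fun u _ => energy_nonneg S f _
    have h3 : ((fball S (2 * (2 * r))).card : ℝ) ≤ ρ * (fball S (2 * r)).card := by
      refine (hmono (by omega)).trans (hρ.trans ?_)
      gcongr
      exact fball_mono S (by omega)
    have h4 : ((fball S (2 * r)).card : ℝ) * ∑ u ∈ fball S (2 * r), f (x * u) ^ 2 ≤ 
        (fball S (2 * r)).card * (8 * (r : ℝ) ^ 2 * ρ * E) := by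
      refine hp.trans ?_
      calc _ ≤ 2 * ((2 * r : ℕ) : ℝ) ^ 2 * (ρ * (fball S (2 * r)).card) * E := by gcongr
        _ = _ := by push_cast; ring
    exact le_of_mul_le_mul_left h4 (hcard _)
  have h3 : ∑ x ∈ X, ∑ u ∈ fball S (6 * r), energy S f (x * u) ≤ 
      ρ * ∑ y ∈ fball S (2 * (M * r)), energy S f y := by
    have : ∀ x ∈ X, ∑ u ∈ fball S (6 * r), energy S f (x * u) ≤ 
        ∑ y ∈ fball S (2 * (M * r)), if x⁻¹ * y ∈ fball S (6 * r) then energy S f y else 0 := by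
      intro x hx
      rw [← Finset.sum_image (f := energy S f) (g := fun u => x * u) 
        (fun _ _ _ _ h => mul_left_cancel h), ← Finset.sum_filter]
      refine Finset.sum_le_sum_of_subset_of_nonneg ?_ fun _ _ _ => energy_nonneg S f _
      intro y hy
      obtain ⟨u, hu, rfl⟩ := Finset.mem_image.1 hy
      rw [Finset.mem_filter]
      refine ⟨fball_mono S ?_ (mul_mem_fball (hXR hx) hu), by simpa using hu⟩
      omega
    refine (Finset.sum_le_sum this).trans ?_
    rw [Finset.sum_comm, Finset.mul_sum]
    refine Finset.sum_le_sum fun y _ => ?_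
    rw [← Finset.sum_filter, Finset.sum_const, nsmul_eq_mul]
    refine mul_le_mul_of_nonneg_right ?_ (energy_nonneg S f y)
    have := card_mul_card_fball_le hS (X := X.filter fun x => x⁻¹ * y ∈ fball S (6 * r)) (r := r)
      (k := 6 * r) y (fun x hx y hy => hXs x (Finset.mem_filter.1 hx).1 y (Finset.mem_filter.1 hy).1) 
      (fun x hx => by simpa using hS.inv_mem_fball (Finset.mem_filter.1 hx).2)
    have h' : (((X.filter fun x => x⁻¹ * y ∈ fball S (6 * r)).card * (fball S r).card : ℕ) : ℝ) ≤
      (fball S (6 * r + r)).card := by exact_mod_cast this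
    push_cast at h'
    exact le_of_mul_le_mul_right (h'.trans ((hmono (by omega)).trans hρ)) (hcard r)
  have h4 := caccioppoli hS hf.2 (R := 2 * (M * r)) (by omega)
  rw [show 4 * (2 * (M * r)) = 8 * (M * r) by ring] at h4
  calc _ ≤ _ := h1
    _ ≤ ∑ x ∈ X, 8 * (r : ℝ) ^ 2 * ρ * ∑ u ∈ fball S (6 * r), energy S f (x * u) := 
        Finset.sum_le_sum h2
    _ = 8 * (r : ℝ) ^ 2 * ρ * ∑ x ∈ X, ∑ u ∈ fball S (6 * r), energy S f (x * u) := by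
        rw [Finset.mul_sum]
    _ ≤ 8 * (r : ℝ) ^ 2 * ρ * (ρ * (S.card / ((2 * (M * r) : ℕ) : ℝ) ^ 2 * 
        ∑ x ∈ fball S (8 * (M * r)), f x ^ 2)) := by gcongr; exact h3.trans (by gcongr)
    _ = _ := by push_cast; field_simp; ring

end Covering

section DetBound

open Matrix

variable {n : Type*} [Fintype n] [DecidableEq n]

theorem exists_simultaneous_diagonalization {A B : Matrix n n ℝ} (hA : A.IsHermitian)
    (hB : B.PosDef) : ∃ (V : Matrix n n ℝ) (μ : n → ℝ), Vᵀ * B * V = 1 ∧ Vᵀ * A * V = diagonal μ := by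
  open scoped MatrixOrder in
  obtain ⟨Y, hY, hBY⟩ := CStarAlgebra.isStrictlyPositive_iff_eq_star_mul_self.mp hB.isStrictlyPositive
  have hBY' : B = Yᵀ * Y := by rw [hBY, star_eq_conjTranspose, conjTranspose_eq_transpose_of_trivial]
  have hdet : IsUnit Y.det := (Matrix.isUnit_iff_isUnit_det _).1 hY
  have hA' : (Y⁻¹ᵀ * A * Y⁻¹).IsHermitian := by
    have := isHermitian_conjTranspose_mul_mul Y⁻¹ hA
    rwa [conjTranspose_eq_transpose_of_trivial] at this
  set U : Matrix n n ℝ := (hA'.eigenvectorUnitary : Matrix n n ℝ) with hU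
  have hUU : Uᵀ * U = 1 := by
    have := Unitary.coe_star_mul_self hA'.eigenvectorUnitary
    rwa [star_eq_conjTranspose, conjTranspose_eq_transpose_of_trivial] at this
  refine ⟨Y⁻¹ * U, hA'.eigenvalues, ?_, ?_⟩
  · rw [hBY', transpose_mul]
    have h1 : Y * Y⁻¹ = 1 := mul_nonsing_inv Y hdet
    have h2 : Y⁻¹ᵀ * Yᵀ = 1 := by rw [← transpose_mul, h1, transpose_one]
    calc _ = Uᵀ * (Y⁻¹ᵀ * Yᵀ) * (Y * Y⁻¹) * U := by simp only [Matrix.mul_assoc]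
      _ = 1 := by rw [h1, h2, Matrix.mul_one, Matrix.mul_one, hUU]
  · have := hA'.conjStarAlgAut_star_eigenvectorUnitary
    rw [Unitary.conjStarAlgAut_star_apply, star_eq_conjTranspose, conjTranspose_eq_transpose_of_trivial] at this
    rw [transpose_mul]
    calc _ = Uᵀ * (Y⁻¹ᵀ * A * Y⁻¹) * U := by simp only [Matrix.mul_assoc]
      _ = _ := this

/-- If `A ≤ B` and `A ≤ δ B` on a subspace of small codimension, then `det A` is much smaller
than `det B`. -/
theorem det_le_pow_mul_det {A B : Matrix n n ℝ} (hA : A.PosSemidef) (hB : B.PosDef)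
    (hAB : ∀ v, v ⬝ᵥ A *ᵥ v ≤ v ⬝ᵥ B *ᵥ v) {E : Type*} [AddCommGroup E] [Module ℝ E]
    [FiniteDimensional ℝ E] (L : (n → ℝ) →ₗ[ℝ] E) {δ : ℝ} (hδ0 : 0 < δ) (hδ1 : δ ≤ 1)
    (hL : ∀ v, L v = 0 → v ⬝ᵥ A *ᵥ v ≤ δ * (v ⬝ᵥ B *ᵥ v)) :
    A.det ≤ δ ^ (Fintype.card n - Module.finrank ℝ E) * B.det := by
  obtain ⟨V, μ, hVB, hVA⟩ := exists_simultaneous_diagonalization hA.1 hB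
  have quad : ∀ (C : Matrix n n ℝ) (w : n → ℝ), (V *ᵥ w) ⬝ᵥ C *ᵥ (V *ᵥ w) =
      w ⬝ᵥ (Vᵀ * C * V) *ᵥ w := by
    intro C w
    rw [← mulVec_mulVec, ← mulVec_mulVec, ← vecMul_transpose, ← dotProduct_mulVec]
  have qA : ∀ w : n → ℝ, (V *ᵥ w) ⬝ᵥ A *ᵥ (V *ᵥ w) = ∑ i, μ i * w i ^ 2 := by
    intro w
    rw [quad, hVA]
    simp only [dotProduct, mulVec_diagonal]
    exact Finset.sum_congr rfl fun i _ => by ring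
  have qB : ∀ w : n → ℝ, (V *ᵥ w) ⬝ᵥ B *ᵥ (V *ᵥ w) = ∑ i, w i ^ 2 := by
    intro w
    rw [quad, hVB, one_mulVec]
    exact Finset.sum_congr rfl fun i _ => by ring
  have hμ0 : ∀ i, 0 ≤ μ i := by
    intro i
    have := hA.dotProduct_mulVec_nonneg (V *ᵥ Pi.single i 1)
    rw [star_trivial, qA] at this
    simpa [Pi.single_apply] using this
  have hμ1 : ∀ i, μ i ≤ 1 := by
    intro i
    have := hAB (V *ᵥ Pi.single i 1)
    rw [qA, qB] at this
    simpa [Pi.single_apply] using this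
  have hdet : A.det = (∏ i, μ i) * B.det := by
    have h1 := congrArg det hVB
    have h2 := congrArg det hVA
    rw [det_mul, det_mul, det_transpose] at h1 h2
    rw [det_one] at h1
    rw [det_diagonal] at h2
    calc A.det = (V.det * A.det * V.det) * B.det := by linear_combination (-A.det) * h1
      _ = _ := by rw [h2]
  rw [hdet]
  refine mul_le_mul_of_nonneg_right ?_ hB.det_pos.le
  set I : Finset n := Finset.univ.filter fun i => δ < μ i with hI
  have hIcard : I.card ≤ Module.finrank ℝ E := by
    by_contra! hcon
    let ext : (I → ℝ) →ₗ[ℝ] (n → ℝ) :=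
      { toFun := fun w i => if h : i ∈ I then w ⟨i, h⟩ else 0
        map_add' := fun w w' => by ext i; by_cases h : i ∈ I <;> simp [h]
        map_smul' := fun c w => by ext i; by_cases h : i ∈ I <;> simp [h] }
    have hker : LinearMap.ker (L ∘ₗ V.mulVecLin ∘ₗ ext) ≠ ⊥ :=
      LinearMap.ker_ne_bot_of_finrank_lt (by simpa using hcon)
    obtain ⟨w, hw, hw0⟩ := Submodule.exists_mem_ne_zero_of_ne_bot hker
    have h1 := hL (V *ᵥ ext w) (by simpa using hw)
    rw [qA, qB, Finset.mul_sum] at h1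
    obtain ⟨i, hi⟩ := Function.ne_iff.1 hw0
    have hle : ∀ j ∈ Finset.univ, δ * ext w j ^ 2 ≤ μ j * ext w j ^ 2 := by
      intro j _
      by_cases hj : j ∈ I
      · exact mul_le_mul_of_nonneg_right (Finset.mem_filter.1 hj).2.le (sq_nonneg _)
      · have : ext w j = 0 := dif_neg hj
        simp [this]
    refine absurd h1 (not_le.2 (Finset.sum_lt_sum hle ⟨i, Finset.mem_univ _, ?_⟩))
    have : ext w i = w i := dif_pos i.2
    rw [this]
    exact mul_lt_mul_of_pos_right (Finset.mem_filter.1 i.2).2 (sq_pos_of_ne_zero hi)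
  calc ∏ i, μ i = (∏ i ∈ I, μ i) * ∏ i ∈ Iᶜ, μ i := (Finset.prod_mul_prod_compl I μ).symm
    _ ≤ 1 * ∏ i ∈ Iᶜ, δ := by
        gcongr with i hi
        · exact Finset.prod_nonneg fun i _ => hμ0 i
        · exact Finset.prod_le_one (fun i _ => hμ0 i) fun i _ => hμ1 i
        · exact fun i _ => hμ0 i
        · simpa [hI] using hi
    _ = δ ^ (Fintype.card n - I.card) := by rw [one_mul, Finset.prod_const, Finset.card_compl]
    _ ≤ _ := pow_le_pow_of_le_one hδ0.le hδ1 (by omega)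

end DetBound

section FiniteDimensionality

theorem exists_small_increments {p q w : ℕ → ℝ} {j₀ : ℕ} {A x y z : ℝ} (hx : 0 < x) (hy : 0 < y)
    (hz : 0 < z) (hp : ∀ j ≥ j₀, p j ≤ p (j + 1)) (hq : ∀ j ≥ j₀, q j ≤ q (j + 1))
    (hw : ∀ j ≥ j₀, w j ≤ w (j + 1)) (hpx : ∀ j ≥ j₀, p j ≤ A + x * j)
    (hqy : ∀ j ≥ j₀, q j ≤ A + y * j) (hwz : ∀ j ≥ j₀, w j ≤ A + z * j) :
    ∃ j ≥ j₀, p (j + 1) - p j ≤ 4 * x ∧ q (j + 1) - q j ≤ 4 * y ∧ w (j + 1) - w j ≤ 4 * z := by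
  set u : ℕ → ℝ := fun j => p j / (4 * x) + q j / (4 * y) + w j / (4 * z) with hu
  have hinc : ∃ j ≥ j₀, u (j + 1) - u j ≤ 1 := by
    by_contra! hcon
    have h1 : ∀ n : ℕ, u j₀ + n ≤ u (j₀ + n) := by
      intro n
      induction n with
      | zero => simp
      | succ n ih =>
        have := hcon (j₀ + n) (by omega)
        rw [← add_assoc]; push_cast; linarith
    have h2 : ∀ j ≥ j₀, u j ≤ (A / (4 * x) + A / (4 * y) + A / (4 * z)) + 3 / 4 * j := by
      intro j hj
      have e1 : p j / (4 * x) ≤ A / (4 * x) + j / 4 := by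
        rw [show A / (4 * x) + (j : ℝ) / 4 = (A + x * j) / (4 * x) by field_simp]
        have := hpx j hj
        gcongr
      have e2 : q j / (4 * y) ≤ A / (4 * y) + j / 4 := by
        rw [show A / (4 * y) + (j : ℝ) / 4 = (A + y * j) / (4 * y) by field_simp]
        have := hqy j hj
        gcongr
      have e3 : w j / (4 * z) ≤ A / (4 * z) + j / 4 := by
        rw [show A / (4 * z) + (j : ℝ) / 4 = (A + z * j) / (4 * z) by field_simp]
        have := hwz j hj
        gcongr
      simp only [hu]; linarith
    set B := A / (4 * x) + A / (4 * y) + A / (4 * z)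
    obtain ⟨n, hn⟩ := exists_nat_gt (4 * (B + 3 / 4 * j₀ - u j₀))
    have h3 := h1 n
    have h4 := h2 (j₀ + n) (by omega)
    push_cast at h4
    linarith
  obtain ⟨j, hj, h⟩ := hinc
  refine ⟨j, hj, ?_⟩
  have e1 : 0 ≤ (p (j + 1) - p j) / (4 * x) := div_nonneg (sub_nonneg.2 (hp j hj)) (by positivity)
  have e2 : 0 ≤ (q (j + 1) - q j) / (4 * y) := div_nonneg (sub_nonneg.2 (hq j hj)) (by positivity)
  have e3 : 0 ≤ (w (j + 1) - w j) / (4 * z) := div_nonneg (sub_nonneg.2 (hw j hj)) (by positivity)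
  have e4 : (p (j + 1) - p j) / (4 * x) + (q (j + 1) - q j) / (4 * y) + 
      (w (j + 1) - w j) / (4 * z) ≤ 1 := by
    simp only [hu] at h
    simp only [sub_div]; linarith
  refine ⟨?_, ?_, ?_⟩
  · exact (div_le_one (by positivity)).1 (by linarith)
  · exact (div_le_one (by positivity)).1 (by linarith)
  · exact (div_le_one (by positivity)).1 (by linarith)

theorem le_pow_mul_of_log_sub_le {u v : ℝ} (hu : 0 < u) (hv : 0 < v) {k : ℕ}
    (h : Real.log u - Real.log v ≤ k * Real.log 8) : u ≤ 8 ^ k * v := by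
  rw [← Real.log_le_log_iff hu (by positivity), Real.log_mul (by positivity) hv.ne', Real.log_pow]
  linarith

variable {G : Type*} [Group G]

open Matrix

/-- The Gram matrix of a finite family of functions on a ball. -/
noncomputable def ballGram (S : Finset G) {D : ℕ} (f : Fin D → G → ℝ) (n : ℕ) :
    Matrix (Fin D) (Fin D) ℝ :=
  Matrix.of fun i j => ∑ x ∈ fball S n, f i x * f j x

theorem dotProduct_gram (S : Finset G) {D : ℕ} (f : Fin D → G → ℝ) (n : ℕ) (v : Fin D → ℝ) :
    v ⬝ᵥ ballGram S f n *ᵥ v = ∑ x ∈ fball S n, (∑ i, v i * f i x) ^ 2 := by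
  have h1 : ∀ i, (ballGram S f n *ᵥ v) i = ∑ x ∈ fball S n, ∑ j, f i x * (v j * f j x) := by
    intro i
    simp only [mulVec, dotProduct, ballGram, of_apply, Finset.sum_mul]
    rw [Finset.sum_comm]
    exact Finset.sum_congr rfl fun x _ => Finset.sum_congr rfl fun j _ => by ring
  simp only [dotProduct, h1, Finset.mul_sum]
  rw [Finset.sum_comm]
  refine Finset.sum_congr rfl fun x _ => ?_
  rw [sq, Finset.sum_mul_sum]
  exact Finset.sum_congr rfl fun i _ => Finset.sum_congr rfl fun j _ => by ring

theorem isHermitian_gram (S : Finset G) {D : ℕ} (f : Fin D → G → ℝ) (n : ℕ) :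
    (ballGram S f n).IsHermitian := by
  ext i j
  simp [ballGram, mul_comm]

theorem posSemidef_gram (S : Finset G) {D : ℕ} (f : Fin D → G → ℝ) (n : ℕ) :
    (ballGram S f n).PosSemidef := by
  refine PosSemidef.of_dotProduct_mulVec_nonneg (isHermitian_gram S f n) fun v => ?_
  rw [star_trivial, dotProduct_gram]
  exact Finset.sum_nonneg fun _ _ => sq_nonneg _

theorem exists_posDef_gram {S : Finset G} (hS : IsSymmGen S) {D : ℕ} {f : Fin D → G → ℝ}
    (hf : LinearIndependent ℝ f) : ∃ n₀, ∀ n ≥ n₀, (ballGram S f n).PosDef := by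
  let K : ℕ → Submodule ℝ (Fin D → ℝ) := fun n =>
    { carrier := {v | ∀ x ∈ fball S n, ∑ i, v i * f i x = 0}
      zero_mem' := by simp
      add_mem' := fun {a b} ha hb x hx => by
        simp only [Pi.add_apply, add_mul, Finset.sum_add_distrib, ha x hx, hb x hx, add_zero]
      smul_mem' := fun c a ha x hx => by
        simp only [Pi.smul_apply, smul_eq_mul, mul_assoc, ← Finset.mul_sum, ha x hx, mul_zero] }
  have hK : Antitone K := fun m n hmn v hv x hx => hv x (fball_mono S hmn hx)
  obtain ⟨n₀, hn₀⟩ := IsArtinian.monotone_stabilizes (R := ℝ) (M := Fin D → ℝ) ⟨fun n => OrderDual.toDual (K n), hK⟩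
  refine ⟨n₀, fun n hn => ?_⟩
  refine PosDef.of_dotProduct_mulVec_pos (isHermitian_gram S f n) fun v hv => ?_
  rw [star_trivial, dotProduct_gram]
  refine lt_of_le_of_ne (Finset.sum_nonneg fun _ _ => sq_nonneg _) fun h0 => hv ?_
  have h1 := (Finset.sum_eq_zero_iff_of_nonneg fun _ _ => sq_nonneg _).1 h0.symm
  have hvK : v ∈ K n := fun x hx => pow_eq_zero_iff (two_ne_zero) |>.1 (h1 x hx)
  have hall : ∀ x, ∑ i, v i * f i x = 0 := by
    intro x
    obtain ⟨k, hk⟩ := hS.exists_mem_ball x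
    have e1 : K n₀ = K n := hn₀ n hn
    have e2 : K n₀ = K (n₀ + k) := hn₀ (n₀ + k) (by omega)
    rw [← e1, e2] at hvK
    exact hvK x (fball_mono S (by omega) (mem_fball.2 hk))
  have := Fintype.linearIndependent_iff.1 hf v (by ext x; simpa using hall x)
  exact funext this

theorem det_gram_le {S : Finset G} {D : ℕ} {f : Fin D → G → ℝ}
    (hf : ∀ i, f i ∈ lipHarm S) {C : ℝ} {d : ℕ} (hC : ∀ n : ℕ, 1 ≤ n →
      (growth (S : Set G) n : ℝ) ≤ C * (n : ℝ) ^ d) :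
    ∃ K : ℝ, 0 < K ∧ ∀ n : ℕ, 1 ≤ n → (ballGram S f n).det ≤ K * ((n : ℝ) ^ (d + 2)) ^ D := by
  choose L hL using fun i => (hf i).1
  set M : ℝ := 1 + ∑ i, (|f i 1| + |L i|) with hM
  have hM0 : 0 < M := by positivity
  have hfM : ∀ i, ∀ n : ℕ, 1 ≤ n → ∀ x ∈ fball S n, |f i x| ≤ M * n := by
    intro i n hn x hx
    have h1 := abs_sub_le_of_mem_ball (L := |L i|) (fun x s hs => (hL i x s hs).trans (le_abs_self _)) 
      (mem_fball.1 hx) (abs_nonneg _) 1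
    rw [one_mul] at h1
    have h2 : |f i 1| + |L i| ≤ M := by
      have := Finset.single_le_sum (f := fun i => |f i 1| + |L i|) (fun _ _ => by positivity) 
        (Finset.mem_univ i)
      linarith
    have hn1 : (1 : ℝ) ≤ n := by exact_mod_cast hn
    have h3 : |f i x| ≤ |f i x - f i 1| + |f i 1| := by
      simpa using abs_add_le (f i x - f i 1) (f i 1)
    nlinarith [abs_nonneg (f i 1), abs_nonneg (L i)]
  have hC0 : 0 < C := by
    have := hC 1 le_rfl
    have h2 : (0 : ℝ) < growth (S : Set G) 1 := by exact_mod_cast growth_pos S.finite_toSet 1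
    simp at this; linarith
  refine ⟨D.factorial * (C * M ^ 2) ^ D, by positivity, fun n hn => ?_⟩
  have := Matrix.det_le (A := ballGram S f n) (abv := AbsoluteValue.abs) (x := C * n ^ d * (M * n) ^ 2) ?_
  · refine (le_abs_self _).trans (le_trans this (le_of_eq ?_))
    simp only [Fintype.card_fin, nsmul_eq_mul]
    rw [mul_assoc (D.factorial : ℝ), ← mul_pow]
    congr 2
    ring
  · intro i j
    simp only [ballGram, of_apply, AbsoluteValue.abs_apply]
    refine (Finset.abs_sum_le_sum_abs _ _).trans ?_
    calc _ ≤ ∑ x ∈ fball S n, (M * n) ^ 2 := by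
          refine Finset.sum_le_sum fun x hx => ?_
          rw [abs_mul, sq]
          gcongr
          exacts [hfM i n hn x hx, hfM j n hn x hx]
      _ = (fball S n).card * (M * n) ^ 2 := by rw [Finset.sum_const, nsmul_eq_mul]
      _ ≤ _ := by
          gcongr
          rw [card_fball]; exact hC n hn

set_option maxHeartbeats 1000000 in
theorem card_le_of_linearIndependent_lipHarm {S : Finset G} (hS : IsSymmGen S) {d : ℕ}
    (hG : GrowthLE G d) : ∃ D₀ : ℕ, ∀ (D : ℕ) (f : Fin D → G → ℝ), (∀ i, f i ∈ lipHarm S) →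
      LinearIndependent ℝ f → D ≤ D₀ := by
  obtain ⟨C, hC0, hC⟩ := hG S
  set ρ : ℝ := 8 ^ (4 * (d + 1)) with hρ
  obtain ⟨m₀, hm₀⟩ := pow_unbounded_of_one_lt (2 * ((S.card : ℝ) + 1) * ρ ^ 2 * 8 ^ (8 * (d + 2)))
    (show (1 : ℝ) < 64 by norm_num)
  set m := m₀ + 1 with hm
  set N : ℕ := 8 ^ (4 * ((m + 1) * (d + 1))) with hN
  refine ⟨2 * N, fun D f hf hli => ?_⟩
  by_contra! hD
  set lam := Real.log 8 with hlam
  have hlam0 : 0 < lam := Real.log_pos (by norm_num)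
  have hb0 : ∀ n, (0 : ℝ) < (fball S n).card := fun n => by
    rw [card_fball]; exact_mod_cast growth_pos S.finite_toSet n
  obtain ⟨j₀, hj₀⟩ := exists_posDef_gram hS hli
  have hpd : ∀ j ≥ j₀, (ballGram S f (8 ^ j)).PosDef := fun j hj =>
    hj₀ _ (hj.trans (Nat.lt_pow_self (by norm_num)).le)
  obtain ⟨K, hK0, hK⟩ := det_gram_le hf hC
  set a : ℕ → ℝ := fun j => Real.log (fball S (8 ^ j)).card with ha
  set Φ : ℕ → ℝ := fun j => Real.log (ballGram S f (8 ^ j)).det with hΦ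
  set x : ℝ := (d + 1) * lam with hx
  have hx0 : 0 < x := by positivity
  have hamono : Monotone a := fun i j hij => Real.log_le_log (hb0 _) (by
    exact_mod_cast Finset.card_le_card (fball_mono S (Nat.pow_le_pow_right (by norm_num) hij)))
  have hax : ∀ j, a j ≤ |Real.log C| + x * j := by
    intro j
    have h1 : a j ≤ Real.log (C * ((8 ^ j : ℕ) : ℝ) ^ d) := Real.log_le_log (hb0 _) (by
      rw [card_fball]; exact hC _ (Nat.one_le_pow _ _ (by norm_num)))
    rw [Real.log_mul hC0.ne' (by positivity), Nat.cast_pow, Real.log_pow, Real.log_pow] at h1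
    push_cast at h1
    rw [← hlam] at h1
    have := le_abs_self (Real.log C)
    have h2 : (0 : ℝ) ≤ lam * j := by positivity
    rw [hx]
    linarith
  have hquad : ∀ {k l : ℕ}, k ≤ l → ∀ v, v ⬝ᵥ ballGram S f k *ᵥ v ≤ v ⬝ᵥ ballGram S f l *ᵥ v := by
    intro k l hkl v
    rw [dotProduct_gram, dotProduct_gram]
    exact Finset.sum_le_sum_of_subset_of_nonneg (fball_mono S hkl) fun _ _ _ => sq_nonneg _
  have hΦmono : ∀ j ≥ j₀, Φ j ≤ Φ (j + 1) := by
    intro j hj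
    refine Real.log_le_log (hpd j hj).det_pos ?_
    have := det_le_pow_mul_det (posSemidef_gram S f (8 ^ j)) (hpd (j + 1) (by omega))
      (hquad (Nat.pow_le_pow_right (by norm_num) (by omega))) (0 : (Fin D → ℝ) →ₗ[ℝ] ℝ) one_pos le_rfl 
      (fun v _ => by rw [one_mul]; exact hquad (Nat.pow_le_pow_right (by norm_num) (by omega)) v)
    simpa using this
  set z : ℝ := D * (d + 2) * lam with hz
  have hD0 : 0 < D := by omega
  have hz0 : 0 < z := by positivity
  have hΦz : ∀ j ≥ j₀, Φ j ≤ |Real.log K| + z * j := by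
    intro j hj
    have h1 : Φ j ≤ Real.log (K * ((((8 ^ j : ℕ) : ℝ)) ^ (d + 2)) ^ D) := 
      Real.log_le_log (hpd j hj).det_pos (hK _ (Nat.one_le_pow _ _ (by norm_num)))
    rw [Real.log_mul hK0.ne' (by positivity), Nat.cast_pow, Real.log_pow, Real.log_pow, 
      Real.log_pow] at h1
    push_cast at h1
    rw [← hlam] at h1
    have := le_abs_self (Real.log K)
    rw [hz]
    linarith
  set q : ℕ → ℝ := fun j => ∑ i ∈ Finset.range (m + 1), a (j + i) with hq
  have hqinc : ∀ j, q (j + 1) - q j = a (j + (m + 1)) - a j := by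
    intro j
    have h1 := Finset.sum_range_succ (fun i => a (j + i)) (m + 1)
    have h2 := Finset.sum_range_succ' (fun i => a (j + i)) (m + 1)
    have h3 : q (j + 1) = ∑ i ∈ Finset.range (m + 1), a (j + (i + 1)) := by
      simp only [hq]
      exact Finset.sum_congr rfl fun i _ => by congr 1; ring
    rw [h3]
    simp only [hq]
    simp only [add_zero] at h2
    linarith
  set A : ℝ := (m + 1) * (|Real.log C| + x * m) + (|Real.log K| + z * m) with hA
  obtain ⟨j, hj, hj1, hj2, hj3⟩ := exists_small_increments (p := a) (q := q) (w := fun j => Φ (j + m))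
    (j₀ := j₀) (A := A) (x := x) (y := (m + 1) * x) (z := z) hx0 (by positivity) hz0 
    (fun j _ => hamono (Nat.le_succ j)) (fun j _ => by
      have := hqinc j
      have h2 := hamono (show j ≤ j + (m + 1) by omega)
      linarith) (fun j hj => by
      have := hΦmono (j + m) (by omega)
      rwa [show j + m + 1 = j + 1 + m by ring] at this) 
    (fun j _ => by
      have h1 := hax j
      have h2 : 0 ≤ (m : ℝ) * (|Real.log C| + x * m) := by positivity
      have h3 : 0 ≤ (|Real.log K| + z * m) := by positivity
      have h4 : 0 ≤ x * m := by positivity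
      rw [hA]; linarith)
    (fun j _ => by
      have h1 : q j ≤ ∑ i ∈ Finset.range (m + 1), (|Real.log C| + x * (j + m)) := by
        refine Finset.sum_le_sum fun i hi => (hax (j + i)).trans ?_
        have : (i : ℝ) ≤ m := by exact_mod_cast Nat.lt_succ_iff.1 (Finset.mem_range.1 hi)
        push_cast
        gcongr
      rw [Finset.sum_const, Finset.card_range, nsmul_eq_mul] at h1
      push_cast at h1
      have h3 : 0 ≤ (|Real.log K| + z * m) := by positivity
      rw [hA]; linarith)
    (fun j hj => by
      have h1 := hΦz (j + m) (by omega)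
      have h2 : 0 ≤ ((m : ℝ) + 1) * (|Real.log C| + x * m) := by positivity
      push_cast at h1
      rw [hA]; linarith)
  have k1 : ((fball S (8 * 8 ^ j)).card : ℝ) ≤ ρ * (fball S (8 ^ j)).card := by
    rw [← pow_succ']
    refine le_pow_mul_of_log_sub_le (hb0 _) (hb0 _) (hj1.trans (le_of_eq ?_))
    rw [hx]; push_cast; ring
  have k2 : ((fball S (8 * (8 ^ m * 8 ^ j))).card : ℝ) ≤ N * (fball S (8 ^ j)).card := by
    rw [hqinc] at hj2
    rw [show 8 * (8 ^ m * 8 ^ j) = 8 ^ (j + (m + 1)) by ring, hN, Nat.cast_pow]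
    refine le_pow_mul_of_log_sub_le (hb0 _) (hb0 _) (hj2.trans (le_of_eq ?_))
    rw [hx]; push_cast; ring
  have k3 : (ballGram S f (8 * (8 ^ m * 8 ^ j))).det ≤ 
      8 ^ (4 * (D * (d + 2))) * (ballGram S f (8 ^ m * 8 ^ j)).det := by
    rw [show 8 * (8 ^ m * 8 ^ j) = 8 ^ (j + 1 + m) by ring, show 8 ^ m * 8 ^ j = 8 ^ (j + m) by ring]
    refine le_pow_mul_of_log_sub_le (hpd _ (by omega)).det_pos (hpd _ (by omega)).det_pos 
      (hj3.trans (le_of_eq ?_))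
    rw [hz]; push_cast; ring
  obtain ⟨X, hXc, hX⟩ := exists_finset_reverse_doubling hS (r := 8 ^ j) (M := 8 ^ m) (ρ := ρ)
    (Nat.one_le_pow _ _ (by norm_num)) (by
      calc 8 = 8 ^ 1 := by norm_num
        _ ≤ 8 ^ m := Nat.pow_le_pow_right (by norm_num) (by omega)) k1
  have hXN : X.card ≤ N := by
    have : ((X.card * (fball S (8 ^ j)).card : ℕ) : ℝ) ≤ (fball S (8 * (8 ^ m * 8 ^ j))).card := by
      exact_mod_cast hXc
    push_cast at this
    exact_mod_cast le_of_mul_le_mul_right (this.trans k2) (hb0 _)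
  set δ : ℝ := 2 * (S.card + 1) * ρ ^ 2 / 64 ^ m with hδ
  have hρ0 : 0 < ρ := by positivity
  have hδ0 : 0 < δ := by positivity
  have hδ8 : δ * 8 ^ (8 * (d + 2)) < 1 := by
    rw [hδ, div_mul_eq_mul_div, div_lt_one (by positivity)]
    refine hm₀.trans ?_
    exact pow_lt_pow_right₀ (by norm_num) (by omega)
  have hδ1 : δ ≤ 1 := by
    have : (1 : ℝ) ≤ 8 ^ (8 * (d + 2)) := one_le_pow₀ (by norm_num)
    nlinarith
  let Lm : (Fin D → ℝ) →ₗ[ℝ] (X → ℝ) :=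
    { toFun := fun v x => ∑ u ∈ fball S (2 * 8 ^ j), ∑ i, v i * f i (x * u)
      map_add' := fun v w => by
        ext x; simp [add_mul, Finset.sum_add_distrib]
      map_smul' := fun c v => by
        ext x; simp [mul_assoc, Finset.mul_sum] }
  have key := det_le_pow_mul_det (posSemidef_gram S f (8 ^ m * 8 ^ j)) 
    (hj₀ (8 * (8 ^ m * 8 ^ j)) (by
      rw [show 8 * (8 ^ m * 8 ^ j) = 8 ^ (j + 1 + m) by ring]
      exact (show j₀ ≤ j + 1 + m by omega).trans (Nat.lt_pow_self (by norm_num)).le)) 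
    (hquad (by omega)) Lm hδ0 hδ1 (fun v hv => by
      rw [dotProduct_gram, dotProduct_gram]
      have hmem : (∑ i, v i • f i) ∈ lipHarm S := Submodule.sum_mem _ fun i _ => 
        Submodule.smul_mem _ _ (hf i)
      have happ : ∀ y, (∑ i, v i • f i) y = ∑ i, v i * f i y := fun y => by simp
      have := hX _ hmem (fun x hx => by
        have := congrFun hv ⟨x, hx⟩
        simp only [happ]
        exact this)
      simp only [happ] at this
      refine this.trans (mul_le_mul_of_nonneg_right ?_ (Finset.sum_nonneg fun _ _ => sq_nonneg _))
      rw [hδ]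
      push_cast
      rw [← pow_mul (8 : ℝ) m 2, mul_comm m 2, pow_mul (8 : ℝ) 2 m, show (8 : ℝ) ^ 2 = 64 by norm_num]
      gcongr
      linarith)
  rw [Fintype.card_fin, Module.finrank_fintype_fun_eq_card, Fintype.card_coe] at key
  set k := D - X.card with hk
  have hdp : 0 < (ballGram S f (8 ^ m * 8 ^ j)).det := by
    rw [show 8 ^ m * 8 ^ j = 8 ^ (j + m) by ring]
    exact (hpd _ (by omega)).det_pos
  have h1 : (ballGram S f (8 ^ m * 8 ^ j)).det ≤ 
      (δ ^ k * 8 ^ (4 * (D * (d + 2)))) * (ballGram S f (8 ^ m * 8 ^ j)).det := by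
    rw [mul_assoc]
    exact key.trans (by gcongr)
  have h2 : δ ^ k * 8 ^ (4 * (D * (d + 2))) < 1 := by
    calc δ ^ k * 8 ^ (4 * (D * (d + 2))) ≤ δ ^ k * 8 ^ (8 * (d + 2) * k) := by
          refine mul_le_mul_of_nonneg_left (pow_le_pow_right₀ (by norm_num) ?_) (pow_nonneg hδ0.le k)
          have : D ≤ 2 * k := by omega
          calc 4 * (D * (d + 2)) ≤ 4 * (2 * k * (d + 2)) := by gcongr
            _ = 8 * (d + 2) * k := by ring
      _ = (δ * 8 ^ (8 * (d + 2))) ^ k := by rw [mul_pow, ← pow_mul]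
      _ < 1 := pow_lt_one₀ (mul_nonneg hδ0.le (by positivity)) hδ8 (by omega)
  nlinarith

theorem finiteDimensional_lipHarm {S : Finset G} (hS : IsSymmGen S) {d : ℕ} (hG : GrowthLE G d) :
    FiniteDimensional ℝ (lipHarm S) := by
  obtain ⟨D₀, hD₀⟩ := card_le_of_linearIndependent_lipHarm hS hG
  have : Module.rank ℝ (lipHarm S) ≤ D₀ := by
    refine rank_le fun s hs => ?_
    have h1 : LinearIndependent ℝ (fun i : Fin s.card => ((s.equivFin.symm i : lipHarm S) : G → ℝ)) := by
      have h2 := (hs.comp _ s.equivFin.symm.injective).map' (lipHarm S).subtype (by simp)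
      exact h2
    exact hD₀ _ _ (fun i => Subtype.mem _) h1
  exact Module.rank_lt_aleph0_iff.1 (this.trans_lt (Cardinal.natCast_lt_aleph0))

end FiniteDimensionality

section LeftNormed

open scoped commutatorElement

variable {G : Type*} [Group G]

/-- Left-normed commutators of weight `k + 1` in the elements of `T`. -/
def leftNormed (T : Set G) : ℕ → Set G
  | 0 => T
  | k + 1 => {y | ∃ x ∈ leftNormed T k, ∃ t ∈ T, y = ⁅x, t⁆}

theorem image_leftNormed {H : Type*} [Group H] (f : G →* H) (T : Set G) (k : ℕ) :
    leftNormed (f '' T) k ⊆ f '' leftNormed T k := by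
  induction k with
  | zero => exact subset_rfl
  | succ k ih =>
    rintro y ⟨x, hx, t, ⟨t, ht, rfl⟩, rfl⟩
    obtain ⟨x', hx', rfl⟩ := ih hx
    exact ⟨⁅x', t⁆, ⟨x', hx', t, ht, rfl⟩, map_commutatorElement f x' t⟩

theorem commutator_mem_of_closure {N : Subgroup G} [N.Normal] {T : Set G}
    (hT : Subgroup.closure T = ⊤) {x : G} (h : ∀ t ∈ T, ⁅x, t⁆ ∈ N) (y : G) : ⁅x, y⁆ ∈ N := by
  have key : ∀ y, ⁅x, y⁆ ∈ N ↔
      y ∈ (Subgroup.centralizer {(x : G ⧸ N)}).comap (QuotientGroup.mk' N) := by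
    intro y
    rw [Subgroup.mem_comap, Subgroup.mem_centralizer_singleton_iff, ← QuotientGroup.eq_one_iff,
      QuotientGroup.mk'_apply]
    change ((QuotientGroup.mk' N) ⁅x, y⁆ = 1) ↔ _
    rw [map_commutatorElement, commutatorElement_eq_one_iff_mul_comm]
    exact eq_comm
  have : Subgroup.closure T ≤
      (Subgroup.centralizer {(x : G ⧸ N)}).comap (QuotientGroup.mk' N) := by
    rw [Subgroup.closure_le]
    exact fun t ht => (key t).1 (h t ht)
  rw [hT] at this
  exact (key y).2 (this trivial)

theorem isNilpotent_of_leftNormed {T : Set G} (hT : Subgroup.closure T = ⊤) {K : ℕ}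
    (h : ∀ x ∈ leftNormed T K, x = 1) : Group.IsNilpotent G := by
  have main : ∀ i ≤ K, ∀ x ∈ leftNormed T (K - i), x ∈ Subgroup.upperCentralSeries G i := by
    intro i
    induction i with
    | zero =>
      intro _ x hx
      simpa using h x hx
    | succ i ih =>
      intro hi x hx
      rw [Subgroup.mem_upperCentralSeries_succ_iff]
      intro y
      refine commutator_mem_of_closure hT (fun t ht => ih (by omega) _ ?_) y
      have : K - i = K - (i + 1) + 1 := by omega
      rw [this]
      exact ⟨x, hx, t, ht, rfl⟩
  refine ⟨⟨K, ?_⟩⟩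
  rw [eq_top_iff, ← hT, Subgroup.closure_le]
  intro t ht
  exact main K le_rfl t (by simpa [leftNormed] using ht)

end LeftNormed

section SmallElements

variable {A : Type*} [NormedRing A]

theorem norm_mul_sub_one_le {u v : A} (hu : ‖u‖ ≤ 1) : ‖u * v - 1‖ ≤ ‖u - 1‖ + ‖v - 1‖ := by
  have : u * v - 1 = (u - 1) + u * (v - 1) := by noncomm_ring
  rw [this]
  refine (norm_add_le _ _).trans ?_
  gcongr
  refine (norm_mul_le _ _).trans ?_
  exact mul_le_of_le_one_left (norm_nonneg _) hu

theorem norm_pow_sub_one_le {u : A} (hu : ‖u‖ ≤ 1) (j : ℕ) : ‖u ^ j - 1‖ ≤ j * ‖u - 1‖ := by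
  induction j with
  | zero => simp
  | succ j ih =>
    rw [pow_succ']
    have := norm_mul_sub_one_le (v := u ^ j) hu
    push_cast
    linarith

theorem norm_inv_sub_one_le {u : Aˣ} (hu : ‖(↑u⁻¹ : A)‖ ≤ 1) :
    ‖(↑u⁻¹ : A) - 1‖ ≤ ‖(u : A) - 1‖ := by
  have : (↑u⁻¹ : A) - 1 = - (↑u⁻¹ * ((u : A) - 1)) := by
    rw [mul_sub, Units.inv_mul]; simp
  rw [this, norm_neg]
  refine (norm_mul_le _ _).trans ?_
  exact mul_le_of_le_one_left (norm_nonneg _) hu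

variable [NormedAlgebra ℝ A]

theorem norm_pow_sub_one_sub_le {u : A} (hu : ‖u‖ ≤ 1) (j : ℕ) :
    ‖u ^ j - 1 - (j : ℝ) • (u - 1)‖ ≤ (j : ℝ) ^ 2 * ‖u - 1‖ ^ 2 := by
  induction j with
  | zero => simp
  | succ j ih =>
    have h1 : u ^ (j + 1) - 1 - ((j + 1 : ℕ) : ℝ) • (u - 1) =
        u * (u ^ j - 1 - (j : ℝ) • (u - 1)) + (j : ℝ) • ((u - 1) * (u - 1)) := by
      push_cast
      simp only [mul_sub, sub_mul, smul_sub, add_smul, mul_smul_comm, mul_one, one_mul, one_smul,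
        pow_succ']
      abel
    rw [h1]
    have h2 := norm_add_le (u * (u ^ j - 1 - (j : ℝ) • (u - 1))) ((j : ℝ) • ((u - 1) * (u - 1)))
    have h3 := norm_mul_le u (u ^ j - 1 - (j : ℝ) • (u - 1))
    have h4 := norm_mul_le (u - 1) (u - 1)
    rw [norm_smul, Real.norm_natCast] at h2
    have h5 : ‖u‖ * ‖u ^ j - 1 - (j : ℝ) • (u - 1)‖ ≤ 1 * ‖u ^ j - 1 - (j : ℝ) • (u - 1)‖ := by
      gcongr
    have h6 : (j : ℝ) * ‖(u - 1) * (u - 1)‖ ≤ j * (‖u - 1‖ * ‖u - 1‖) := by gcongr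
    have h7 : 0 ≤ ((j : ℝ) + 1) * ‖u - 1‖ ^ 2 := by positivity
    push_cast
    nlinarith

theorem norm_pow_sub_one_ge {u : A} (hu : ‖u‖ ≤ 1) {j m : ℕ} (hj : 1 ≤ j) (hjm : j ≤ m)
    (hm : m * ‖u - 1‖ ≤ 1 / 2) : ‖u - 1‖ / 2 ≤ ‖u ^ j - 1‖ := by
  have h1 := norm_pow_sub_one_sub_le hu j
  have h2 : (j : ℝ) * ‖u - 1‖ ≤ ‖u ^ j - 1‖ + ‖u ^ j - 1 - (j : ℝ) • (u - 1)‖ := by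
    have := norm_sub_le (u ^ j - 1) (u ^ j - 1 - (j : ℝ) • (u - 1))
    rwa [sub_sub_cancel, norm_smul, Real.norm_natCast] at this
  have h3 : (1 : ℝ) ≤ j := by exact_mod_cast hj
  have h4 : (j : ℝ) ≤ m := by exact_mod_cast hjm
  have h5 : (j : ℝ) * ‖u - 1‖ ≤ 1 / 2 := le_trans (by gcongr) hm
  have h0 := norm_nonneg (u - 1)
  have h6 : (j : ℝ) ^ 2 * ‖u - 1‖ ^ 2 ≤ 1 / 2 * (j * ‖u - 1‖) := by
    nlinarith [mul_le_mul_of_nonneg_right h5 (mul_nonneg (zero_le_one.trans h3) h0)]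
  nlinarith

end SmallElements

section SmallGenerators

open scoped commutatorElement

variable {A : Type*} [NormedRing A] {G : Type*} [Group G]

/-- There is a chain of `n` iterated commutators with elements of `T`, starting at `x`, whose last
element is not in the kernel of `ρ`. -/
def HasChain (ρ : G →* Aˣ) (T : Set G) : ℕ → G → Prop
  | 0, x => ρ x ≠ 1
  | n + 1, x => ∃ t ∈ T, HasChain ρ T n ⁅x, t⁆

theorem HasChain.ne_one {ρ : G →* Aˣ} {T : Set G} {n : ℕ} {x : G} (h : HasChain ρ T n x) :
    ρ x ≠ 1 := by
  induction n generalizing x with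
  | zero => exact h
  | succ n ih =>
    obtain ⟨t, -, h⟩ := h
    intro hx
    exact ih h (by rw [map_commutatorElement, hx, commutatorElement_one_left])

theorem exists_hasChain {ρ : G →* Aˣ} {T : Set G} {k n : ℕ} {x : G} (hx : x ∈ leftNormed T k)
    (h : HasChain ρ T n x) : ∃ x₀ ∈ T, HasChain ρ T (n + k) x₀ := by
  induction k generalizing n x with
  | zero => exact ⟨x, hx, h⟩
  | succ k ih =>
    obtain ⟨y, hy, t, ht, rfl⟩ := hx
    obtain ⟨x₀, hx₀, h'⟩ := ih hy (n := n + 1) ⟨t, ht, h⟩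
    exact ⟨x₀, hx₀, by rwa [add_assoc, add_comm 1 k] at h'⟩

variable [NormedAlgebra ℝ A]

theorem HasChain.exists_finset {ρ : G →* Aˣ} (hρ : ∀ g, ‖(ρ g : A)‖ ≤ 1) {T U : Set G}
    (hTU : T ⊆ U) (hU : ∀ x ∈ U, x⁻¹ ∈ U) {m : ℕ} (hm : 1 ≤ m)
    (hT : ∀ t ∈ T, ‖(ρ t : A) - 1‖ * (32 * m) ≤ 1)
    {n : ℕ} {x : G} (h : HasChain ρ T n x) (hx : ‖(ρ x : A) - 1‖ * (32 * m) ≤ 1)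
    {L : ℕ} (hL : 1 ≤ L) (hxL : x ∈ ball U L) :
    ∃ P : Finset G, P.card = m ^ n ∧ Set.InjOn ρ (P : Set G) ∧
      (∀ p ∈ P, ‖(ρ p : A) - 1‖ ≤ 2 * m * ‖(ρ x : A) - 1‖) ∧ ∀ p ∈ P, p ∈ ball U (m * L * 8 ^ n) := by
  classical
  induction n generalizing x L with
  | zero =>
    refine ⟨{1}, by simp, by simp, ?_, ?_⟩
    · simp; positivity
    · simp [one_mem_ball]
  | succ n ih =>
    have hne := h.ne_one
    obtain ⟨t, ht, h⟩ := h
    set a := ‖(ρ x : A) - 1‖ with ha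
    have ha0 : 0 < a := by
      rw [ha, norm_pos_iff, sub_ne_zero]
      exact fun h => hne (Units.ext h)
    have hm1 : (1 : ℝ) ≤ m := by exact_mod_cast hm
    have hy : ‖(ρ ⁅x, t⁆ : A) - 1‖ ≤ 2 * a * ‖(ρ t : A) - 1‖ := by
      have h1 := norm_commutator_units_sub_one_le (ρ x) (ρ t)
      rw [map_commutatorElement]
      refine h1.trans ?_
      rw [← map_inv, ← map_inv]
      have h2 := hρ x⁻¹
      have h3 := hρ t⁻¹
      have : 2 * ‖(ρ x⁻¹ : A)‖ * ‖(ρ t⁻¹ : A)‖ ≤ 2 := by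
        have := mul_le_one₀ h2 (norm_nonneg _) h3
        linarith
      calc _ ≤ 2 * a * ‖(ρ t : A) - 1‖ := by rw [ha]; gcongr
        _ ≤ _ := le_rfl
    have hya : ‖(ρ ⁅x, t⁆ : A) - 1‖ * (16 * m) ≤ a := by
      have := mul_le_mul_of_nonneg_left (hT t ht) ha0.le
      have := mul_le_mul_of_nonneg_right hy (show (0 : ℝ) ≤ 16 * m by positivity)
      nlinarith
    have hyL : ⁅x, t⁆ ∈ ball U (4 * L) := by
      have h1 : t ∈ ball U 1 := mem_ball_one (hTU ht)
      have := mul_mem_ball (mul_mem_ball (mul_mem_ball hxL h1) (inv_mem_ball hU hxL))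
        (inv_mem_ball hU h1)
      exact ball_mono U (by omega) this
    have hy32 : ‖(ρ ⁅x, t⁆ : A) - 1‖ * (32 * m) ≤ 1 := by
      have h1 : a ≤ a * m := le_mul_of_one_le_right ha0.le hm1
      nlinarith
    obtain ⟨P, hcard, hinj, hnorm, hball⟩ := ih h hy32 (L := 4 * L) (by omega) hyL
    have hsmall : ∀ p ∈ P, ‖(ρ p : A) - 1‖ ≤ a / 8 := by
      intro p hp
      have := hnorm p hp
      nlinarith
    have key : ∀ i j : ℕ, ∀ p ∈ P, ∀ q ∈ P, i < j → j < m →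
        ρ (x ^ i * p) ≠ ρ (x ^ j * q) := by
      intro i j p hp q hq hij hjm heq
      have h1 : ρ x ^ (j - i) = ρ (p * q⁻¹) := by
        simp only [map_mul, map_pow, map_inv] at heq ⊢
        rw [eq_mul_inv_iff_mul_eq]
        have : ρ x ^ j = ρ x ^ i * ρ x ^ (j - i) := by rw [← pow_add]; congr 1; omega
        rw [this, mul_assoc] at heq
        exact (mul_left_cancel heq).symm
      have h2 := norm_pow_sub_one_ge (hρ x) (j := j - i) (m := m) (by omega) (by omega)
        (by rw [← ha]; nlinarith)
      rw [← ha] at h2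
      have h3 : ‖(ρ (p * q⁻¹) : A) - 1‖ ≤ a / 8 + a / 8 := by
        rw [map_mul, Units.val_mul]
        refine (norm_mul_sub_one_le (hρ p)).trans (add_le_add (hsmall p hp) ?_)
        rw [map_inv]
        exact (norm_inv_sub_one_le (by rw [← map_inv]; exact hρ _)).trans (hsmall q hq)
      rw [← h1, Units.val_pow_eq_pow_val] at h3
      linarith
    have inj : Set.InjOn (fun z : ℕ × G => ρ (x ^ z.1 * z.2))
        (((Finset.range m) ×ˢ P : Finset (ℕ × G)) : Set (ℕ × G)) := by
      rintro ⟨i, p⟩ hip ⟨j, q⟩ hjq heq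
      simp only [Finset.coe_product, Set.mem_prod, Finset.mem_coe, Finset.mem_range] at hip hjq
      rcases lt_trichotomy i j with hij | hij | hij
      · exact absurd heq (key i j p hip.2 q hjq.2 hij hjq.1)
      · subst hij
        simp only [map_mul, mul_right_inj] at heq
        rw [hinj hip.2 hjq.2 heq]
      · exact absurd heq.symm (key j i q hjq.2 p hip.2 hij hip.1)
    refine ⟨((Finset.range m) ×ˢ P).image (fun z : ℕ × G => x ^ z.1 * z.2), ?_, ?_, ?_, ?_⟩
    · rw [Finset.card_image_of_injOn, Finset.card_product, Finset.card_range, hcard, pow_succ']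
      exact fun z hz w hw hzw => inj hz hw (congrArg ρ hzw)
    · rw [Finset.coe_image]
      rintro _ ⟨z, hz, rfl⟩ _ ⟨w, hw, rfl⟩ hzw
      exact congrArg (fun z : ℕ × G => x ^ z.1 * z.2) (inj hz hw hzw)
    · intro p hp
      simp only [Finset.mem_image, Finset.mem_product, Finset.mem_range] at hp
      obtain ⟨⟨i, p⟩, ⟨hi, hp⟩, rfl⟩ := hp
      simp only [map_mul, map_pow, Units.val_mul, Units.val_pow_eq_pow_val]
      have h1 : ‖(ρ x : A) ^ i‖ ≤ 1 := by
        have := hρ (x ^ i)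
        rwa [map_pow, Units.val_pow_eq_pow_val] at this
      refine (norm_mul_sub_one_le h1).trans ?_
      have h2 := norm_pow_sub_one_le (hρ x) i
      rw [← ha] at h2
      have h3 : (i : ℝ) * a ≤ m * a := by
        have : (i : ℝ) ≤ m := by exact_mod_cast hi.le
        gcongr
      have := hsmall p hp
      nlinarith
    · intro p hp
      simp only [Finset.mem_image, Finset.mem_product, Finset.mem_range] at hp
      obtain ⟨⟨i, p⟩, ⟨hi, hp⟩, rfl⟩ := hp
      refine ball_mono U ?_ (mul_mem_ball (pow_mem_ball_mul hxL i) (hball p hp))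
      have h1 : i * L ≤ m * L := Nat.mul_le_mul_right _ hi.le
      have h2 : 1 ≤ 8 ^ n := Nat.one_le_pow _ _ (by norm_num)
      have h3 : m * L * 1 ≤ m * L * 8 ^ n := Nat.mul_le_mul_left _ h2
      calc i * L + m * (4 * L) * 8 ^ n ≤ m * L * 8 ^ n + 4 * (m * L * 8 ^ n) := by
            have : m * (4 * L) * 8 ^ n = 4 * (m * L * 8 ^ n) := by ring
            omega
        _ ≤ m * L * 8 ^ (n + 1) := by rw [pow_succ]; nlinarith

theorem isNilpotent_range_of_small {ρ : G →* Aˣ} (hρ : ∀ g, ‖(ρ g : A)‖ ≤ 1) {d : ℕ}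
    (hG : GrowthLE G d) {T : Finset G} (hgen : Subgroup.closure (T : Set G) = ⊤)
    (hT : ∀ t ∈ T, ‖(ρ t : A) - 1‖ * (32 * (2 * 8 ^ d)) ≤ 1) : Group.IsNilpotent ρ.range := by
  classical
  have main : ∃ K, ∀ x ∈ leftNormed (T : Set G) K, ρ x = 1 := by
    by_contra! hcon
    let U : Finset G := T ∪ T.image (·⁻¹)
    have hU : ∀ x ∈ (U : Set G), x⁻¹ ∈ (U : Set G) := by
      intro x hx
      simp only [U, Finset.coe_union, Finset.coe_image, Set.mem_union, Finset.mem_coe,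
        Set.mem_image] at hx ⊢
      rcases hx with hx | ⟨y, hy, rfl⟩
      · exact Or.inr ⟨x, hx, rfl⟩
      · exact Or.inl (by simpa using hy)
    have hTU : (T : Set G) ⊆ U := by simp [U]
    obtain ⟨C, hC, hgr⟩ := hG U
    have hbound : ∀ n : ℕ, (2 : ℝ) ^ n ≤ C * (2 * 8 ^ d) ^ d := by
      intro n
      obtain ⟨x, hx, hx1⟩ := hcon n
      obtain ⟨x₀, hx₀, hch⟩ := exists_hasChain hx (n := 0) (ρ := ρ) hx1
      rw [zero_add] at hch
      have hcast : ((2 * 8 ^ d : ℕ) : ℝ) = 2 * 8 ^ d := by push_cast; rfl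
      obtain ⟨P, hcard, -, -, hball⟩ := hch.exists_finset hρ hTU hU (m := 2 * 8 ^ d)
        (Nat.mul_pos (by norm_num) (by positivity)) (by rw [hcast]; exact hT)
        (by rw [hcast]; exact hT x₀ hx₀) le_rfl (mem_ball_one (hTU hx₀))
      have h1 : (2 * 8 ^ d) ^ n ≤ growth (U : Set G) (2 * 8 ^ d * 1 * 8 ^ n) := by
        rw [← hcard, ← Set.ncard_coe_finset]
        exact Set.ncard_le_ncard hball (ball_finite U.finite_toSet _)
      have h2 := hgr (2 * 8 ^ d * 1 * 8 ^ n) (Nat.mul_pos (by positivity) (by positivity))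
      have h3 : ((2 * 8 ^ d : ℕ) : ℝ) ^ n ≤ C * ((2 * 8 ^ d * 1 * 8 ^ n : ℕ) : ℝ) ^ d :=
        le_trans (by exact_mod_cast h1) h2
      push_cast at h3
      have h4 : (0 : ℝ) < (8 ^ d) ^ n := by positivity
      have h5 : C * (2 * 8 ^ d * 1 * 8 ^ n : ℝ) ^ d = C * (2 * 8 ^ d) ^ d * (8 ^ d) ^ n := by
        rw [mul_one, mul_pow _ ((8 : ℝ) ^ n), ← pow_mul 8 n d, ← pow_mul 8 d n, mul_comm n d]; ring
      rw [h5, mul_pow] at h3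
      exact le_of_mul_le_mul_right h3 h4
    obtain ⟨n, hn⟩ := pow_unbounded_of_one_lt (C * (2 * 8 ^ d) ^ d) (one_lt_two (α := ℝ))
    exact absurd (hbound n) (not_le.2 hn)
  obtain ⟨K, hK⟩ := main
  refine isNilpotent_of_leftNormed (T := ρ.rangeRestrict '' (T : Set G)) (K := K) ?_ ?_
  · rw [← MonoidHom.map_closure, hgen, ← MonoidHom.range_eq_map, MonoidHom.range_eq_top]
    exact ρ.rangeRestrict_surjective
  · intro x hx
    obtain ⟨y, hy, rfl⟩ := image_leftNormed ρ.rangeRestrict _ _ hx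
    exact Subtype.ext (hK y hy)

end SmallGenerators

theorem exists_finset_subset_of_mem_closure {G : Type*} [Group G] {P : Set G} {x : G}
    (hx : x ∈ Subgroup.closure P) :
    ∃ F : Finset G, (F : Set G) ⊆ P ∧ x ∈ Subgroup.closure (F : Set G) := by
  classical
  induction hx using Subgroup.closure_induction with
  | mem x hx => exact ⟨{x}, by simpa using hx, Subgroup.subset_closure (by simp)⟩
  | one => exact ⟨∅, by simp, one_mem _⟩
  | mul x y _ _ hx hy =>
    obtain ⟨F, hF, hx⟩ := hx
    obtain ⟨F', hF', hy⟩ := hy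
    refine ⟨F ∪ F', by simp [hF, hF'], mul_mem ?_ ?_⟩
    · exact Subgroup.closure_mono (by simp) hx
    · exact Subgroup.closure_mono (by simp) hy
  | inv x _ hx =>
    obtain ⟨F, hF, hx⟩ := hx
    exact ⟨F, hF, inv_mem hx⟩

theorem exists_finset_closure_eq_of_fg {G : Type*} [Group G] {P : Set G}
    (h : (Subgroup.closure P).FG) :
    ∃ F : Finset G, (F : Set G) ⊆ P ∧ Subgroup.closure (F : Set G) = Subgroup.closure P := by
  classical
  obtain ⟨E, hE⟩ := h
  have h1 : ∀ x ∈ E, ∃ F : Finset G, (F : Set G) ⊆ P ∧ x ∈ Subgroup.closure (F : Set G) :=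
    fun x hx => exists_finset_subset_of_mem_closure (hE ▸ Subgroup.subset_closure hx)
  choose! F hF hxF using h1
  have hsub : ((E.biUnion F : Finset G) : Set G) ⊆ P := by
    intro y hy
    simp only [Finset.coe_biUnion, Set.mem_iUnion] at hy
    obtain ⟨x, hx, hy⟩ := hy
    exact hF x hx hy
  refine ⟨E.biUnion F, hsub, le_antisymm (Subgroup.closure_mono hsub) ?_⟩
  rw [← hE, Subgroup.closure_le]
  intro x hx
  exact Subgroup.closure_mono (by
    intro y hy
    simp only [Finset.coe_biUnion, Set.mem_iUnion]
    exact ⟨x, hx, hy⟩) (hxF x hx)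

section

variable {A : Type*} [NormedRing A] {G : Type*} [Group G]

theorem finiteIndex_closure_small [ProperSpace A] {ρ : G →* Aˣ} (hρ : ∀ g, ‖(ρ g : A)‖ ≤ 1) {ε : ℝ}
    (hε : 0 < ε) : (Subgroup.closure {g | ‖(ρ g : A) - 1‖ < ε}).FiniteIndex := by
  set Γ := Subgroup.closure {g | ‖(ρ g : A) - 1‖ < ε} with hΓ
  obtain ⟨t, -, htf, ht⟩ := (isCompact_closedBall (0 : A) 1).finite_cover_balls (half_pos hε)
  have h1 : ∀ g, ∃ c ∈ t, (ρ g : A) ∈ Metric.ball c (ε / 2) := by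
    intro g
    have := ht (show (ρ g : A) ∈ Metric.closedBall 0 1 by simpa using hρ g)
    simpa using this
  choose c hct hc using h1
  have h2 : ∀ g h, c g = c h → g⁻¹ * h ∈ Γ := by
    intro g h hgh
    apply Subgroup.subset_closure
    have h3 : ‖(ρ h : A) - ρ g‖ < ε := by
      have h4 := hc g
      have h5 := hc h
      rw [← hgh] at h5
      rw [← dist_eq_norm]
      have := dist_triangle_right (ρ h : A) (ρ g) (c g)
      rw [Metric.mem_ball] at h4 h5
      linarith
    have h6 : (ρ (g⁻¹ * h) : A) - 1 = ρ g⁻¹ * ((ρ h : A) - ρ g) := by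
      rw [mul_sub, ← Units.val_mul, ← map_mul, ← Units.val_mul, ← map_mul]; simp
    rw [Set.mem_ofPred_eq, h6]
    refine (norm_mul_le _ _).trans_lt ?_
    exact (mul_le_of_le_one_left (norm_nonneg _) (hρ _)).trans_lt h3
  have hfin : Finite (G ⧸ Γ) := by
    have := htf.to_subtype
    refine Finite.of_injective (fun q : G ⧸ Γ => (⟨c q.out, hct _⟩ : t)) ?_
    intro q r hqr
    have := h2 _ _ (congrArg Subtype.val hqr)
    rw [← QuotientGroup.out_eq' q, ← QuotientGroup.out_eq' r]
    exact QuotientGroup.eq.2 this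
  exact Subgroup.finiteIndex_of_finite_quotient

theorem exists_finiteIndex_isNilpotent_range [NormedAlgebra ℝ A] [ProperSpace A] {ρ : G →* Aˣ}
    (hρ : ∀ g, ‖(ρ g : A)‖ ≤ 1) {d : ℕ} (hG : GrowthLE G d) (hfg : Group.FG G) :
    ∃ Γ : Subgroup G, Γ.FiniteIndex ∧ Group.IsNilpotent (ρ.comp Γ.subtype).range := by
  classical
  set ε : ℝ := 1 / (32 * (2 * 8 ^ d)) with hε
  have hε0 : 0 < ε := by positivity
  have hfi := finiteIndex_closure_small hρ hε0
  set Γ := Subgroup.closure {g | ‖(ρ g : A) - 1‖ < ε} with hΓ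
  have hΓfg : Γ.FG := (Group.fg_iff_subgroup_fg Γ).1 inferInstance
  obtain ⟨F, hFP, hF⟩ := exists_finset_closure_eq_of_fg hΓfg
  rw [← hΓ] at hF
  refine ⟨Γ, hfi, ?_⟩
  have hmem : ∀ x ∈ F, x ∈ Γ := fun x hx => hF ▸ Subgroup.subset_closure hx
  refine isNilpotent_range_of_small (ρ := ρ.comp Γ.subtype) (fun g => hρ g)
    (hG.of_injective Γ.subtype Γ.subtype_injective) (T := F.subtype (· ∈ Γ)) ?_ ?_
  · have : (Γ.subtype : Γ → G) '' ((F.subtype (· ∈ Γ) : Finset Γ) : Set Γ) = F := by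
      ext x
      simp only [Set.mem_image, Finset.mem_coe, Finset.mem_subtype, Subgroup.coe_subtype]
      constructor
      · rintro ⟨y, hy, rfl⟩; exact hy
      · intro hx; exact ⟨⟨x, hmem x hx⟩, hx, rfl⟩
    apply Subgroup.map_injective Γ.subtype_injective
    rw [MonoidHom.map_closure, this, hF, ← MonoidHom.range_eq_map, Subgroup.range_subtype]
  · intro t ht
    have h1 : ‖(ρ t : A) - 1‖ < ε := hFP (by simpa using ht)
    rw [hε, lt_div_iff₀ (by positivity)] at h1
    exact h1.le

end

section Translation

variable {G : Type*} [Group G]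

/-- Lipschitz harmonic functions vanishing at `1`. -/
def lipHarmZero (S : Finset G) : Submodule ℝ (G → ℝ) :=
  lipHarm S ⊓ LinearMap.ker (LinearMap.proj 1 : (G → ℝ) →ₗ[ℝ] ℝ)

theorem translate_mem_lipHarm {S : Finset G} {f : G → ℝ} (hf : f ∈ lipHarm S) (g : G) (c : ℝ) :
    (fun x => f (g * x) - c) ∈ lipHarm S := by
  obtain ⟨⟨L, hL⟩, h⟩ := hf
  refine ⟨⟨L, fun x s hs => ?_⟩, fun x => ?_⟩
  · simpa [mul_assoc] using hL (g * x) s hs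
  · simpa [mul_assoc] using h (g * x)

/-- The translation action on `lipHarmZero S`. -/
def translateHom (S : Finset G) : G →* Module.End ℝ (lipHarmZero S) where
  toFun g :=
    { toFun := fun f => ⟨fun x => f.1 (g⁻¹ * x) - f.1 g⁻¹,
        translate_mem_lipHarm f.2.1 _ _, by simp⟩
      map_add' := fun f f' => by ext x; simp; ring
      map_smul' := fun c f => by ext x; simp; ring }
  map_one' := by
    ext f x
    have : f.1 1 = 0 := f.2.2
    simp [this]
  map_mul' g h := by
    ext f x
    simp [mul_assoc]

theorem translateHom_apply (S : Finset G) (g : G) (f : lipHarmZero S) (x : G) :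
    (translateHom S g f).1 x = f.1 (g⁻¹ * x) - f.1 g⁻¹ := rfl

/-- The best Lipschitz constant. -/
noncomputable def lipNorm (S : Finset G) (f : G → ℝ) : ℝ :=
  ⨆ p : G × S, |f (p.1 * p.2) - f p.1|

theorem bddAbove_lipNorm {S : Finset G} {f : G → ℝ} (hf : f ∈ lipHarm S) :
    BddAbove (Set.range fun p : G × S => |f (p.1 * p.2) - f p.1|) := by
  obtain ⟨⟨L, hL⟩, -⟩ := hf
  refine ⟨L, ?_⟩
  rintro _ ⟨p, rfl⟩
  exact hL p.1 p.2 p.2.2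

theorem lipNorm_nonneg (S : Finset G) (f : G → ℝ) : 0 ≤ lipNorm S f :=
  Real.iSup_nonneg fun _ => abs_nonneg _

theorem le_lipNorm {S : Finset G} {f : G → ℝ} (hf : f ∈ lipHarm S) (x : G) {s : G} (hs : s ∈ S) :
    |f (x * s) - f x| ≤ lipNorm S f :=
  le_ciSup (bddAbove_lipNorm hf) (⟨x, ⟨s, hs⟩⟩ : G × S)

theorem lipNorm_core {S : Finset G} (hS : IsSymmGen S) :
    letI : Norm (lipHarmZero S) := ⟨fun f => lipNorm S f.1⟩
    NormedSpace.Core ℝ (lipHarmZero S) := by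
  let _ : Norm (lipHarmZero S) := ⟨fun f => lipNorm S f.1⟩
  refine { norm_nonneg := fun f => lipNorm_nonneg S f.1, norm_smul := fun c f => ?_,
           norm_triangle := fun f f' => ?_, norm_eq_zero_iff := fun f => ⟨fun h => ?_, ?_⟩ }
  · change lipNorm S (c • f.1) = |c| * lipNorm S f.1
    rw [lipNorm, lipNorm, Real.mul_iSup_of_nonneg (abs_nonneg c)]
    congr 1
    ext p
    simp [← abs_mul, mul_sub]
  · change lipNorm S (f.1 + f'.1) ≤ lipNorm S f.1 + lipNorm S f'.1
    refine Real.iSup_le (fun p => ?_) (add_nonneg (lipNorm_nonneg _ _) (lipNorm_nonneg _ _))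
    have h1 := le_lipNorm f.2.1 p.1 p.2.2
    have h2 := le_lipNorm f'.2.1 p.1 p.2.2
    refine le_trans ?_ (add_le_add h1 h2)
    rw [Pi.add_apply, Pi.add_apply, add_sub_add_comm]
    exact abs_add_le _ _
  · change lipNorm S f.1 = 0 at h
    ext x
    obtain ⟨n, hn⟩ := hS.exists_mem_ball x
    have := abs_sub_le_of_mem_ball (F := f.1) (S := S) (L := 0)
      (fun x s hs => h ▸ le_lipNorm f.2.1 x hs) hn le_rfl 1
    have h1 : f.1 1 = 0 := f.2.2
    simpa [h1] using this
  · rintro rfl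
    change lipNorm S (0 : G → ℝ) = 0
    simp [lipNorm]

theorem lipNorm_translate_le {S : Finset G} (g : G) (f : lipHarmZero S) :
    lipNorm S (translateHom S g f).1 ≤ lipNorm S f.1 := by
  refine Real.iSup_le (fun p => ?_) (lipNorm_nonneg _ _)
  rw [translateHom_apply, translateHom_apply, sub_sub_sub_cancel_right, ← mul_assoc]
  exact le_lipNorm f.2.1 _ p.2.2

end Translation

theorem exists_nilpotent_quotient_of_isometric.{u} {G : Type u} [Group G] (hfg : Group.FG G)
    {d : ℕ} (hG : GrowthLE G d) {V : Type*} [AddCommGroup V] [Module ℝ V] [Norm V]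
    (core : NormedSpace.Core ℝ V) [FiniteDimensional ℝ V] (τ : G →* Module.End ℝ V)
    (hτ : ∀ g v, ‖τ g v‖ ≤ ‖v‖) :
    ∃ Γ : Subgroup G, Γ.FiniteIndex ∧ ∃ (Q : Type u) (_ : Group Q) (π : Γ →* Q),
      Function.Surjective π ∧ Group.IsNilpotent Q ∧ ∀ g ∈ π.ker, τ g = 1 := by
  let _ : NormedAddCommGroup V := NormedAddCommGroup.ofCore core
  let _ : NormedSpace ℝ V := NormedSpace.ofCore core
  have : ProperSpace (V →L[ℝ] V) := FiniteDimensional.proper_real _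
  let ρ : G →* (V →L[ℝ] V)ˣ := MonoidHom.toHomUnits
    ((Module.End.toContinuousLinearMap (𝕜 := ℝ) V : Module.End ℝ V →* (V →L[ℝ] V)).comp τ)
  have hρ : ∀ g, ‖(ρ g : V →L[ℝ] V)‖ ≤ 1 := by
    intro g
    refine ContinuousLinearMap.opNorm_le_bound _ zero_le_one fun f => ?_
    rw [one_mul]
    exact hτ g f
  obtain ⟨Γ, hΓ, hnil⟩ := exists_finiteIndex_isNilpotent_range hρ hG hfg
  refine ⟨Γ, hΓ, Γ ⧸ (ρ.comp Γ.subtype).ker, inferInstance, QuotientGroup.mk' _,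
    QuotientGroup.mk'_surjective _,
    (Group.isNilpotent_congr (QuotientGroup.quotientKerEquivRange _)).2 hnil, ?_⟩
  intro g hg
  rw [QuotientGroup.ker_mk'] at hg
  have h1 : ρ (g : G) = 1 := hg
  ext v
  exact congrArg (fun u : (V →L[ℝ] V)ˣ => (u : V →L[ℝ] V) v) h1

theorem exists_nilpotent_quotient.{u} {G : Type u} [Group G] (hfg : Group.FG G) {S : Finset G}
    (hS : IsSymmGen S) {d : ℕ} (hG : GrowthLE G d) :
    ∃ Γ : Subgroup G, Γ.FiniteIndex ∧ ∃ (Q : Type u) (_ : Group Q) (π : Γ →* Q),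
      Function.Surjective π ∧ Group.IsNilpotent Q ∧
      ∀ g ∈ π.ker, ∀ f ∈ lipHarm S, ∀ x, f (g * x) - f x = f g - f 1 := by
  have hfin : FiniteDimensional ℝ (lipHarm S) := finiteDimensional_lipHarm hS hG
  have hfin' : FiniteDimensional ℝ (lipHarmZero S) :=
    Submodule.finiteDimensional_of_le (inf_le_left : lipHarmZero S ≤ lipHarm S)
  let _ : Norm (lipHarmZero S) := ⟨fun f => lipNorm S f.1⟩
  obtain ⟨Γ, hΓ, Q, _, π, hπ, hQ, hker⟩ := exists_nilpotent_quotient_of_isometric hfg hG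
    (lipNorm_core hS) (translateHom S) lipNorm_translate_le
  refine ⟨Γ, hΓ, Q, _, π, hπ, hQ, fun g hg f hf x => ?_⟩
  have h1 := hker g⁻¹ (inv_mem hg)
  let f' : lipHarmZero S := ⟨fun x => f (1 * x) - f 1, translate_mem_lipHarm hf 1 (f 1), by simp⟩
  have h3 := congrArg (fun u : Module.End ℝ (lipHarmZero S) => (u f').1 x) h1
  simp only [translateHom_apply] at h3
  simp [f'] at h3
  linarith

theorem finite_commutatorSet_of_finite_quotient_center {G : Type*} [Group G]
    [Finite (G ⧸ Subgroup.center G)] : Finite (commutatorSet G) := by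
  let f : (G ⧸ Subgroup.center G) × (G ⧸ Subgroup.center G) → G :=
    fun p => p.1.out * p.2.out * p.1.out⁻¹ * p.2.out⁻¹
  refine ((Set.finite_range f).subset ?_).to_subtype
  rintro _ ⟨a, b, rfl⟩
  refine ⟨((a : G ⧸ Subgroup.center G), (b : G ⧸ Subgroup.center G)), ?_⟩
  obtain ⟨z, hz⟩ := QuotientGroup.mk_out_eq_mul (Subgroup.center G) a
  obtain ⟨w, hw⟩ := QuotientGroup.mk_out_eq_mul (Subgroup.center G) b
  simp only [f]
  rw [hz, hw, commutatorElement_def]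
  have hz := Subgroup.mem_center_iff.1 z.2
  have hw := Subgroup.mem_center_iff.1 w.2
  rw [mul_assoc a z.1, ← hz (b * w.1)]
  simp only [mul_inv_rev, mul_assoc]
  rw [mul_inv_cancel_left, ← mul_assoc (w : G) (a⁻¹), ← hw, mul_assoc, mul_inv_cancel_left]

theorem finite_of_finite_abelianization {G : Type*} [Group G] [Group.IsNilpotent G]
    (h : Finite (Abelianization G)) : Finite G := by
  revert h
  refine Group.nilpotent_center_quotient_ind
    (P := fun G [Group G] [Group.IsNilpotent G] => Finite (Abelianization G) → Finite G) G ?_ ?_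
  · intro G _ _ _
    infer_instance
  · intro G _ _ ih h
    have h1 : Finite (Abelianization (G ⧸ Subgroup.center G)) := by
      refine Finite.of_surjective (Abelianization.map (QuotientGroup.mk' (Subgroup.center G))) ?_
      intro x
      obtain ⟨x, rfl⟩ := QuotientGroup.mk_surjective x
      obtain ⟨x, rfl⟩ := QuotientGroup.mk_surjective x
      exact ⟨Abelianization.of x, rfl⟩
    have := ih h1
    have := finite_commutatorSet_of_finite_quotient_center (G := G)
    have h2 : Finite (G ⧸ commutator G) := h
    exact Finite.of_subgroup_quotient (commutator G)

theorem exists_surjective_int_of_infinite_range {G M : Type*} [Group G] (hfg : Group.FG G)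
    [CommGroup M] (ψ : G →* M) (h : (Set.range ψ).Infinite) :
    ∃ φ : G →* Multiplicative ℤ, Function.Surjective φ := by
  have hfg' : Group.FG ψ.range := Group.fg_of_surjective ψ.rangeRestrict_surjective
  obtain ⟨ι, n, _, _, p, hp, e, ⟨f⟩⟩ := CommGroup.equiv_free_prod_prod_multiplicative_zmod ψ.range
  rcases isEmpty_or_nonempty n with hn | ⟨⟨i₀⟩⟩
  · exfalso
    have : ∀ i, NeZero (p i ^ e i) := fun i => ⟨pow_ne_zero _ (hp i).ne_zero⟩
    have : ∀ i, Finite (Multiplicative (ZMod (p i ^ e i))) := fun i =>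
      inferInstanceAs (Finite (ZMod (p i ^ e i)))
    have : Finite ψ.range := Finite.of_equiv _ f.symm.toEquiv
    exact h (Set.toFinite (ψ.range : Set M))
  · refine ⟨((Pi.evalMonoidHom (fun _ : n => Multiplicative ℤ) i₀).comp
      (MonoidHom.fst _ _)).comp (f.toMonoidHom.comp ψ.rangeRestrict), ?_⟩
    intro z
    obtain ⟨x, hx⟩ := f.surjective ((fun _ => z), 1)
    obtain ⟨g, rfl⟩ := ψ.rangeRestrict_surjective x
    exact ⟨g, by simp [hx]⟩

theorem lipHarm_eq_of_finite_range {G : Type*} [Group G] {S : Finset G} (hS : IsSymmGen S)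
    {f : G → ℝ} (hf : f ∈ lipHarm S) (hfin : (Set.range f).Finite) (x : G) : f x = f 1 := by
  obtain ⟨y, ⟨x₀, rfl⟩, hmax⟩ := Set.exists_max_image (Set.range f) id hfin ⟨f 1, 1, rfl⟩
  have hmax : ∀ y, f y ≤ f x₀ := fun y => hmax _ ⟨y, rfl⟩
  have hstep : ∀ y, f y = f x₀ → ∀ s ∈ S, f (y * s) = f x₀ := by
    intro y hy s hs
    have h1 := (Finset.sum_eq_zero_iff_of_nonpos (s := S) (f := fun s => f (y * s) - f y)
      (fun s _ => by rw [hy]; exact sub_nonpos.2 (hmax _))).1 (hf.2 y) s hs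
    linarith
  have hlist : ∀ l : List G, (∀ s ∈ l, s ∈ S) → ∀ y, f y = f x₀ → f (y * l.prod) = f x₀ := by
    intro l
    induction l with
    | nil => intro _ y hy; simpa using hy
    | cons s l ih =>
      intro hl y hy
      rw [List.prod_cons, ← mul_assoc]
      exact ih (fun t ht => hl t (by simp [ht])) _ (hstep y hy s (hl s (by simp)))
  have hall : ∀ z, f z = f x₀ := by
    intro z
    obtain ⟨n, l, hl, -, hlz⟩ := hS.exists_mem_ball (x₀⁻¹ * z)
    have := hlist l hl x₀ rfl
    rwa [hlz, mul_inv_cancel_left] at this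
  rw [hall x, hall 1]

theorem exists_finiteIndex_surjective_int {G : Type*} [Group G] [Infinite G] (hfg : Group.FG G)
    {d : ℕ} (hG : GrowthLE G d) :
    ∃ Γ : Subgroup G, Γ.FiniteIndex ∧ ∃ φ : Γ →* Multiplicative ℤ, Function.Surjective φ := by
  obtain ⟨S, hS⟩ := exists_isSymmGen hfg
  obtain ⟨f, hf, x, hx⟩ := exists_lipHarm_ne hS hG
  obtain ⟨Γ, hΓ, Q, _, π, hπ, hQ, hker⟩ := exists_nilpotent_quotient hfg hS hG
  have hΓfg : Group.FG Γ := inferInstance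
  by_cases hfin : Finite Q
  · have hk : π.ker.FiniteIndex := by
      have : Finite π.range := inferInstance
      infer_instance
    set N : Subgroup G := π.ker.map Γ.subtype with hN
    have hNfi : N.FiniteIndex := by
      refine ⟨?_⟩
      rw [hN, Subgroup.index_map_subtype]
      exact mul_ne_zero hk.index_ne_zero hΓ.index_ne_zero
    have hNker : ∀ g ∈ N, ∀ x, f (g * x) - f x = f g - f 1 := by
      rintro _ ⟨g, hg, rfl⟩ x
      exact hker g hg f hf x
    let ψ : N →* Multiplicative ℝ :=
      { toFun := fun g => Multiplicative.ofAdd (f g - f 1)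
        map_one' := by simp
        map_mul' := fun g h => by
          rw [← ofAdd_add]
          congr 1
          have := hNker g g.2 h
          push_cast
          linarith }
    refine ⟨N, hNfi, exists_surjective_int_of_infinite_range inferInstance ψ ?_⟩
    by_contra hcon
    rw [Set.not_infinite] at hcon
    have hzero : ∀ g ∈ N, f g = f 1 := by
      intro g hg
      by_contra hne
      refine Set.infinite_of_injective_forall_mem (f := fun n : ℕ => ψ ((⟨g, hg⟩ : N) ^ n)) ?_
        (fun n => Set.mem_range_self _) hcon
      intro m n hmn
      simp only [map_pow] at hmn
      have h1 : (m : ℝ) * (f g - f 1) = n * (f g - f 1) := by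
        have := congrArg Multiplicative.toAdd hmn
        rw [toAdd_pow, toAdd_pow] at this
        simpa [ψ] using this
      exact_mod_cast mul_right_cancel₀ (sub_ne_zero.2 hne) h1
    refine hx (lipHarm_eq_of_finite_range hS hf ?_ x)
    have : Finite (G ⧸ N) := inferInstance
    refine (Set.finite_range fun q : G ⧸ N => f (q.out)⁻¹).subset ?_
    rintro _ ⟨y, rfl⟩
    refine ⟨((y⁻¹ : G) : G ⧸ N), ?_⟩
    obtain ⟨z, hz⟩ := QuotientGroup.mk_out_eq_mul N y⁻¹
    simp only
    rw [hz, mul_inv_rev, inv_inv]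
    have h1 := hNker _ (inv_mem z.2) y
    have h2 := hzero _ (inv_mem z.2)
    linarith
  · refine ⟨Γ, hΓ, exists_surjective_int_of_infinite_range hΓfg (Abelianization.of.comp π) ?_⟩
    have hsurj : Function.Surjective (Abelianization.of.comp π) := by
      intro y
      obtain ⟨q, rfl⟩ := QuotientGroup.mk_surjective y
      obtain ⟨g, rfl⟩ := hπ q
      exact ⟨g, rfl⟩
    rw [hsurj.range_eq]
    have : Infinite (Abelianization Q) := by
      by_contra hcon
      exact hfin (finite_of_finite_abelianization (not_infinite_iff_finite.1 hcon))
    exact Set.infinite_univ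

section Coincidence

variable {G : Type*} [Group G]

/-- The product of the elements `t ^ j * e * t ^ (-j)` over the positions `j` where the list of
bits is `true`. -/
def conjWord (t e : G) : List Bool → G
  | [] => 1
  | b :: l => (if b then e else 1) * (t * conjWord t e l * t⁻¹)

theorem conjWord_mul_pow_mem_ball (t e : G) {U : Set G} (ht : t ∈ U) (he : e ∈ U) (l : List Bool) :
    conjWord t e l * t ^ l.length ∈ ball U (2 * l.length) := by
  induction l with
  | nil => simpa [conjWord] using one_mem_ball U 0
  | cons b l ih =>
    have h1 : conjWord t e (b :: l) * t ^ (b :: l).length =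
        (if b then e else 1) * (t * (conjWord t e l * t ^ l.length)) := by
      simp [conjWord, pow_succ', mul_assoc]
    rw [h1]
    have h2 : (if b then e else 1) ∈ ball U 1 := by
      split_ifs
      exacts [mem_ball_one he, one_mem_ball U 1]
    exact ball_mono U (by simp; omega) (mul_mem_ball h2 (mul_mem_ball (mem_ball_one ht) ih))

theorem exists_two_pow_gt (C : ℝ) (d : ℕ) : ∃ n : ℕ, 1 ≤ n ∧ C * (n : ℝ) ^ d < 2 ^ n := by
  have h := tendsto_pow_const_div_const_pow_of_one_lt d (one_lt_two (α := ℝ))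
  have h1 : Filter.Tendsto (fun n : ℕ => C * ((n : ℝ) ^ d / 2 ^ n)) Filter.atTop (nhds 0) := by
    simpa using h.const_mul C
  obtain ⟨n, hn, hn1⟩ := ((h1.eventually (gt_mem_nhds one_pos)).and
    (Filter.eventually_ge_atTop 1)).exists
  refine ⟨n, hn1, ?_⟩
  rw [← mul_div_assoc, div_lt_one (by positivity)] at hn
  exact hn

theorem exists_conjWord_eq {d : ℕ} (hG : GrowthLE G d) (t e : G) :
    ∃ l l' : List Bool, l.length = l'.length ∧ l ≠ l' ∧ conjWord t e l = conjWord t e l' := by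
  classical
  by_contra! hcon
  let U : Finset G := {t, e}
  obtain ⟨C, -, hgr⟩ := hG U
  obtain ⟨n, hn1, hn⟩ := exists_two_pow_gt (C * 2 ^ d) d
  let F : List.Vector Bool n → G := fun v => conjWord t e v.1 * t ^ n
  have hF : Function.Injective F := by
    intro v w hvw
    by_contra hne
    exact hcon v.1 w.1 (v.2.trans w.2.symm) (fun h => hne (Subtype.ext h)) (mul_right_cancel hvw)
  have h1 : 2 ^ n ≤ growth (U : Set G) (2 * n) := by
    have hcard : Nat.card (List.Vector Bool n) = 2 ^ n := by simp
    rw [← hcard, ← Set.ncard_univ, ← Set.ncard_image_of_injective _ hF]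
    refine Set.ncard_le_ncard ?_ (ball_finite U.finite_toSet _)
    rintro _ ⟨v, -, rfl⟩
    have := conjWord_mul_pow_mem_ball t e (U := (U : Set G)) (by simp [U]) (by simp [U]) v.1
    rwa [v.2] at this
  have h2 := hgr (2 * n) (by omega)
  have h3 : ((2 : ℝ)) ^ n ≤ C * ((2 * n : ℕ) : ℝ) ^ d := le_trans (by exact_mod_cast h1) h2
  push_cast at h3
  rw [mul_pow, ← mul_assoc] at h3
  linarith

theorem conjWord_concat (t e : G) (l : List Bool) (b : Bool) :
    conjWord t e (l ++ [b]) =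
      conjWord t e l * (t ^ l.length * (if b then e else 1) * (t ^ l.length)⁻¹) := by
  induction l with
  | nil => simp [conjWord]
  | cons a l ih =>
    simp only [List.cons_append, conjWord, ih, List.length_cons, pow_succ', mul_inv_rev]
    group

theorem conjWord_mem (t e : G) (l : List Bool) {n : ℕ} (hl : l.length ≤ n) :
    conjWord t e l ∈ Subgroup.closure ((fun j : ℕ => t ^ j * e * (t ^ j)⁻¹) '' Set.Iio n) := by
  induction l using List.reverseRecOn with
  | nil => exact one_mem _
  | append_singleton l b ih =>
    simp only [List.length_append, List.length_singleton] at hl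
    rw [conjWord_concat]
    refine mul_mem (ih (by omega)) ?_
    split_ifs
    · exact Subgroup.subset_closure ⟨l.length, Set.mem_Iio.2 (by omega), rfl⟩
    · simp

theorem conj_pow_mem_of_conjWord_eq {t e : G} {l l' : List Bool} (hlen : l.length = l'.length)
    (hne : l ≠ l') (h : conjWord t e l = conjWord t e l') :
    ∃ m : ℕ, t ^ m * e * (t ^ m)⁻¹ ∈
      Subgroup.closure ((fun j : ℕ => t ^ j * e * (t ^ j)⁻¹) '' Set.Iio m) := by
  induction l using List.reverseRecOn generalizing l' with
  | nil => exact absurd (List.length_eq_zero_iff.1 hlen.symm).symm hne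
  | append_singleton l b ih =>
    rcases List.eq_nil_or_concat l' with rfl | ⟨l', b', rfl⟩
    · simp at hlen
    · have hlen' : l.length = l'.length := by simpa using hlen
      rw [List.concat_eq_append] at h hne
      rw [conjWord_concat, conjWord_concat, ← hlen'] at h
      by_cases hb : b = b'
      · subst hb
        exact ih hlen' (fun h => hne (by rw [h])) (mul_right_cancel h)
      · refine ⟨l.length, ?_⟩
        have h1 := conjWord_mem t e l le_rfl
        have h2 := conjWord_mem t e l' hlen'.ge
        cases b <;> cases b' <;> simp at hb h
        · rw [h] at h1
          exact (Subgroup.mul_mem_cancel_left _ h2).1 h1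
        · rw [← h] at h2
          exact (Subgroup.mul_mem_cancel_left _ h1).1 h2

theorem exists_conj_pow_mem {d : ℕ} (hG : GrowthLE G d) (t e : G) :
    ∃ m : ℕ, t ^ m * e * (t ^ m)⁻¹ ∈
      Subgroup.closure ((fun j : ℕ => t ^ j * e * (t ^ j)⁻¹) '' Set.Iio m) := by
  obtain ⟨l, l', hlen, hne, h⟩ := exists_conjWord_eq hG t e
  exact conj_pow_mem_of_conjWord_eq hlen hne h

theorem exists_forall_conj_pow_mem {d : ℕ} (hG : GrowthLE G d) (t e : G) :
    ∃ m : ℕ, ∀ i : ℕ, t ^ i * e * (t ^ i)⁻¹ ∈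
      Subgroup.closure ((fun j : ℕ => t ^ j * e * (t ^ j)⁻¹) '' Set.Iio m) := by
  obtain ⟨m, hm⟩ := exists_conj_pow_mem hG t e
  refine ⟨m, ?_⟩
  set H := Subgroup.closure ((fun j : ℕ => t ^ j * e * (t ^ j)⁻¹) '' Set.Iio m) with hH
  have hconj : H ≤ H.comap (MulAut.conj t).toMonoidHom := by
    conv_lhs => rw [hH]
    rw [Subgroup.closure_le]
    rintro _ ⟨j, hj, rfl⟩
    have h1 : (MulAut.conj t) (t ^ j * e * (t ^ j)⁻¹) = t ^ (j + 1) * e * (t ^ (j + 1))⁻¹ := by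
      simp [MulAut.conj_apply, pow_succ', mul_assoc]
    change (MulAut.conj t) (t ^ j * e * (t ^ j)⁻¹) ∈ H
    rw [h1]
    rcases Nat.lt_or_ge (j + 1) m with h | h
    · exact Subgroup.subset_closure ⟨j + 1, h, rfl⟩
    · have : j + 1 = m := le_antisymm hj h
      rw [this]
      exact hm
  intro i
  rcases Nat.lt_or_ge i m with h | h
  · exact Subgroup.subset_closure ⟨i, h, rfl⟩
  · induction i, h using Nat.le_induction with
    | base => exact hm
    | succ i hi ih =>
      have h1 : (MulAut.conj t) (t ^ i * e * (t ^ i)⁻¹) = t ^ (i + 1) * e * (t ^ (i + 1))⁻¹ := by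
        simp [MulAut.conj_apply, pow_succ', mul_assoc]
      rw [← h1]
      exact hconj ih

end Coincidence

section Kernel

variable {G : Type*} [Group G]

theorem conj_zpow_closure_fg {d : ℕ} (hG : GrowthLE G d) (t : G) {E : Set G} (hE : E.Finite) :
    (Subgroup.closure {x | ∃ e ∈ E, ∃ j : ℤ, t ^ j * e * (t ^ j)⁻¹ = x}).FG := by
  choose m hm using exists_forall_conj_pow_mem hG t
  choose m' hm' using exists_forall_conj_pow_mem hG t⁻¹
  let F : Set G := ⋃ e ∈ E, ((fun j : ℕ => t ^ j * e * (t ^ j)⁻¹) '' Set.Iio (m e) ∪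
    (fun j : ℕ => t⁻¹ ^ j * e * (t⁻¹ ^ j)⁻¹) '' Set.Iio (m' e))
  have hF : F.Finite :=
    hE.biUnion fun e _ => ((Set.finite_Iio _).image _).union ((Set.finite_Iio _).image _)
  refine (Subgroup.fg_iff _).2 ⟨F, le_antisymm ?_ ?_, hF⟩
  · refine Subgroup.closure_mono ?_
    intro x hx
    obtain ⟨e, he, hx⟩ := Set.mem_iUnion₂.1 hx
    rcases hx with ⟨j, -, rfl⟩ | ⟨j, -, rfl⟩
    · exact ⟨e, he, j, by simp⟩
    · exact ⟨e, he, -j, by simp⟩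
  · rw [Subgroup.closure_le]
    rintro _ ⟨e, he, j, rfl⟩
    have h1 : ∀ x, x ∈ ((fun j : ℕ => t ^ j * e * (t ^ j)⁻¹) '' Set.Iio (m e) ∪
        (fun j : ℕ => t⁻¹ ^ j * e * (t⁻¹ ^ j)⁻¹) '' Set.Iio (m' e)) → x ∈ F :=
      fun x hx => Set.mem_iUnion₂.2 ⟨e, he, hx⟩
    obtain ⟨n, rfl | rfl⟩ := j.eq_nat_or_neg
    · have := Subgroup.closure_mono (fun x hx => h1 x (Or.inl hx)) (hm e n)
      simpa using this
    · have := Subgroup.closure_mono (fun x hx => h1 x (Or.inr hx)) (hm' e n)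
      simpa using this

theorem conj_zpow_closure_normal {t : G} {E : Set G}
    (hgen : Subgroup.closure (insert t E) = ⊤) :
    (Subgroup.closure {x | ∃ e ∈ E, ∃ j : ℤ, t ^ j * e * (t ^ j)⁻¹ = x}).Normal := by
  set L := Subgroup.closure {x | ∃ e ∈ E, ∃ j : ℤ, t ^ j * e * (t ^ j)⁻¹ = x} with hL
  have hconj : ∀ i : ℤ, ∀ x ∈ L, t ^ i * x * (t ^ i)⁻¹ ∈ L := by
    intro i x hx
    have : L ≤ L.comap (MulAut.conj (t ^ i)).toMonoidHom := by
      conv_lhs => rw [hL]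
      rw [Subgroup.closure_le]
      rintro _ ⟨e, he, j, rfl⟩
      refine Subgroup.subset_closure ⟨e, he, i + j, ?_⟩
      change _ = t ^ i * (t ^ j * e * (t ^ j)⁻¹) * (t ^ i)⁻¹
      simp [zpow_add, mul_assoc]
    exact this hx
  rw [← Subgroup.normalizer_eq_top_iff, eq_top_iff, ← hgen, Subgroup.closure_le]
  rintro g (rfl | hg)
  · refine Subgroup.mem_normalizer_iff.2 fun h => ⟨fun hh => by simpa using hconj 1 h hh, ?_⟩
    intro hh
    have := hconj (-1) _ hh
    simpa [mul_assoc] using this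
  · exact Subgroup.le_normalizer (Subgroup.subset_closure ⟨g, hg, 0, by simp⟩)

theorem ker_fg_of_surjective_int (hfg : Group.FG G) {d : ℕ} (hG : GrowthLE G d)
    {φ : G →* Multiplicative ℤ} {t : G} (ht : φ t = Multiplicative.ofAdd 1) :
    φ.ker.FG := by
  have hφt : ∀ n : ℤ, φ (t ^ n) = Multiplicative.ofAdd n := by
    intro n
    rw [map_zpow, ht, ← ofAdd_zsmul]
    simp
  obtain ⟨S, hS⟩ := hfg.out
  let e : G → G := fun s => s * (t ^ (Multiplicative.toAdd (φ s)))⁻¹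
  have he : ∀ s, e s ∈ φ.ker := fun s => by
    rw [MonoidHom.mem_ker, map_mul, map_inv, hφt]; simp
  let E : Set G := e '' S
  have hE : E.Finite := S.finite_toSet.image _
  have hgen : Subgroup.closure (insert t E) = ⊤ := by
    rw [eq_top_iff, ← hS, Subgroup.closure_le]
    intro s hs
    have h1 : e s ∈ Subgroup.closure (insert t E) :=
      Subgroup.subset_closure (Or.inr ⟨s, hs, rfl⟩)
    have h2 : t ∈ Subgroup.closure (insert t E) := Subgroup.subset_closure (Or.inl rfl)
    have : s = e s * t ^ (Multiplicative.toAdd (φ s)) := by simp [e]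
    rw [this]
    exact mul_mem h1 (zpow_mem h2 _)
  have hfg := conj_zpow_closure_fg hG t hE
  have hnor := conj_zpow_closure_normal hgen
  set L := Subgroup.closure {x | ∃ e ∈ E, ∃ j : ℤ, t ^ j * e * (t ^ j)⁻¹ = x} with hL
  have hLK : L ≤ φ.ker := by
    rw [hL, Subgroup.closure_le]
    rintro _ ⟨_, ⟨s, -, rfl⟩, j, rfl⟩
    exact (inferInstance : φ.ker.Normal).conj_mem _ (he s) _
  have hsup : L ⊔ Subgroup.zpowers t = ⊤ := by
    rw [eq_top_iff, ← hgen, Subgroup.closure_le]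
    rintro g (rfl | hg)
    · exact Subgroup.mem_sup_right (Subgroup.mem_zpowers g)
    · exact Subgroup.mem_sup_left (Subgroup.subset_closure ⟨g, hg, 0, by simp⟩)
  have : φ.ker = L := by
    refine le_antisymm (fun k hk => ?_) hLK
    have hk' : k ∈ L ⊔ Subgroup.zpowers t := by rw [hsup]; trivial
    obtain ⟨l, hl, _, ⟨n, rfl⟩, rfl⟩ := Subgroup.mem_sup_of_normal_left.1 hk'
    have h1 := hLK hl
    rw [MonoidHom.mem_ker] at h1 hk
    simp only [map_mul, h1, hφt, one_mul] at hk
    have h2 : n = 0 := hk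
    simpa [h2] using hl
  rw [this]
  exact hfg

theorem growthLE_ker {d : ℕ} (hG : GrowthLE G (d + 1))
    {φ : G →* Multiplicative ℤ} {t : G} (ht : φ t = Multiplicative.ofAdd 1) :
    GrowthLE φ.ker d := by
  classical
  intro T
  let U : Finset G := insert t (T.image Subtype.val)
  obtain ⟨C, hC, h⟩ := hG U
  refine ⟨C * 2 ^ (d + 1), by positivity, fun n hn => ?_⟩
  let F : G × Fin n → G := fun p => p.1 * t ^ (p.2 : ℕ)
  let B : Set G := Subtype.val '' ball (T : Set φ.ker) n
  have hBk : ∀ x ∈ B, φ x = 1 := by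
    rintro _ ⟨x, -, rfl⟩
    exact x.2
  have hB : B ⊆ ball (U : Set G) n := by
    have := image_ball φ.ker.subtype (T : Set φ.ker) n
    have h2 : B = ball (φ.ker.subtype '' (T : Set φ.ker)) n := this
    rw [h2]
    have := ball_subset_ball_of_subset (S := (U : Set G)) (L := 1)
      (T := φ.ker.subtype '' (T : Set φ.ker)) (by
        rintro _ ⟨x, hx, rfl⟩
        refine mem_ball_one ?_
        simp only [U, Finset.coe_insert, Finset.coe_image]
        exact Or.inr ⟨x, hx, rfl⟩) n
    simpa using this
  have htU : t ∈ (U : Set G) := by simp [U]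
  have hF : Set.InjOn F (B ×ˢ (Set.univ : Set (Fin n))) := by
    rintro ⟨a, i⟩ ⟨ha, -⟩ ⟨b, j⟩ ⟨hb, -⟩ hab
    have h1 := congrArg φ hab
    simp only [F, map_mul, hBk a ha, hBk b hb, one_mul, map_pow, ht, ← ofAdd_nsmul] at h1
    have h2 : (i : ℕ) = j := by
      have h3 := Multiplicative.ofAdd.injective h1
      simpa using h3
    have h3 : i = j := Fin.ext h2
    subst h3
    simp only [F, mul_left_inj] at hab
    rw [hab]
  have hsub : F '' (B ×ˢ (Set.univ : Set (Fin n))) ⊆ ball (U : Set G) (2 * n) := by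
    rintro _ ⟨⟨a, i⟩, ⟨ha, -⟩, rfl⟩
    have := mul_mem_ball (hB ha) (pow_mem_ball_mul (mem_ball_one htU) (i : ℕ))
    exact ball_mono _ (by have := i.2; omega) this
  have hcard : growth (T : Set φ.ker) n * n ≤ growth (U : Set G) (2 * n) := by
    have h1 := Set.ncard_le_ncard hsub (ball_finite U.finite_toSet _)
    rw [hF.ncard_image, Set.ncard_prod, Set.ncard_univ, Nat.card_eq_fintype_card,
      Fintype.card_fin] at h1
    rwa [Set.ncard_image_of_injective _ Subtype.val_injective] at h1
  have h2 := h (2 * n) (by omega)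
  have hn0 : (0 : ℝ) < n := by exact_mod_cast hn
  have h3 : (growth (T : Set φ.ker) n : ℝ) * n ≤ C * 2 ^ (d + 1) * n ^ d * n := by
    calc (growth (T : Set φ.ker) n : ℝ) * n ≤ growth (U : Set G) (2 * n) := by exact_mod_cast hcard
      _ ≤ _ := h2
      _ = _ := by push_cast; ring
  exact le_of_mul_le_mul_right h3 hn0

end Kernel

section Unipotent

open Polynomial

theorem norm_le_two_of_aeval_eq_zero {q : ℤ[X]} (hq : q ≠ 0) (hc : ∀ i, |q.coeff i| ≤ 1) {z : ℂ}
    (hz : aeval z q = 0) : ‖z‖ ≤ 2 := by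
  have hinj : Function.Injective (Int.castRingHom ℂ) := RingHom.injective_int _
  have hq' : q.map (Int.castRingHom ℂ) ≠ 0 := (Polynomial.map_ne_zero_iff hinj).2 hq
  have hroot : (q.map (Int.castRingHom ℂ)).IsRoot z := by
    rw [IsRoot.def, eval_map]
    exact hz
  have h1 := IsRoot.norm_lt_cauchyBound hq' hroot
  have h2 : cauchyBound (q.map (Int.castRingHom ℂ)) ≤ 2 := by
    have h3 : 1 ≤ ‖(q.map (Int.castRingHom ℂ)).leadingCoeff‖₊ := by
      rw [leadingCoeff_map_of_injective hinj]
      have : 1 ≤ |q.leadingCoeff| := Int.one_le_abs (leadingCoeff_ne_zero.2 hq)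
      rw [← NNReal.coe_le_coe]
      simp only [eq_intCast, coe_nnnorm, Complex.norm_intCast, NNReal.coe_one]
      exact_mod_cast this
    have h4 : Finset.sup (Finset.range (q.map (Int.castRingHom ℂ)).natDegree)
        (‖(q.map (Int.castRingHom ℂ)).coeff ·‖₊) ≤ 1 := by
      refine Finset.sup_le fun i _ => ?_
      rw [← NNReal.coe_le_coe]
      simp only [coeff_map, eq_intCast, coe_nnnorm, Complex.norm_intCast, NNReal.coe_one]
      exact_mod_cast hc i
    rw [cauchyBound, ← one_add_one_eq_two]
    gcongr
    exact div_le_one_of_le₀ (h4.trans h3) zero_le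
  exact_mod_cast (h1.trans_le h2).le

theorem norm_le_one_of_forall_norm_pow_le {z : ℂ} {C : ℝ} (h : ∀ l : ℕ, 1 ≤ l → ‖z ^ l‖ ≤ C) :
    ‖z‖ ≤ 1 := by
  by_contra! hz
  obtain ⟨l, hl⟩ := pow_unbounded_of_one_lt C hz
  have := h (l + 1) (by omega)
  rw [norm_pow, pow_succ] at this
  have h0 : 0 < ‖z‖ ^ l := by positivity
  nlinarith

open IntermediateField in
theorem exists_pow_eq_one_of_forall_root_norm_le_one {I : Set ℤ[X]} {χ : ℤ[X]} (hχ : χ ∈ I)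
    (hmonic : χ.Monic) (hI : ∀ z : ℂ, (∀ p ∈ I, aeval z p = 0) → ‖z‖ ≤ 1) {z : ℂ} (hz0 : z ≠ 0)
    (hz : ∀ p ∈ I, aeval z p = 0) : ∃ n, 0 < n ∧ z ^ n = 1 := by
  have hint : IsIntegral ℤ z := ⟨χ, hmonic, hz χ hχ⟩
  let K := ℚ⟮z⟯
  let : NumberField K := {
    to_charZero := ℚ⟮z⟯.charZero
    to_finiteDimensional := adjoin.finiteDimensional hint.tower_top }
  let y : K := ⟨z, mem_adjoin_simple_self ℚ z⟩
  suffices ∃ (n : ℕ) (_ : 0 < n), y ^ n = 1 by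
    obtain ⟨n, hn₀, hn₁⟩ := this
    exact ⟨n, hn₀, congrArg (algebraMap K ℂ) hn₁⟩
  refine NumberField.Embeddings.pow_eq_one_of_norm_le_one (x := y) K ℂ (Subtype.coe_ne_coe.mp hz0)
    (coe_isIntegral_iff.mp hint) fun φ ↦ hI _ fun p hp => ?_
  have H (ψ : K →+* ℂ) : ψ ((aeval y) p) = (aeval (ψ y)) p := by
    conv_rhs => rw [← map_id (p := p)]
    exact p.map_aeval_eq_aeval_map (by ext; simp) y
  rw [← H, map_eq_zero_iff _ φ.injective,
    ← map_eq_zero_iff _ (FaithfulSMul.algebraMap_injective ↥K ℂ), H]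
  exact hz p hp

theorem multiset_prod_map_dvd_pow {α R : Type*} [CommMonoid R] {s : Multiset α} {f : α → R} {Q : R}
    (h : ∀ a ∈ s, f a ∣ Q) : (s.map f).prod ∣ Q ^ s.card := by
  induction s using Multiset.induction with
  | empty => simp
  | cons a s ih =>
    rw [Multiset.map_cons, Multiset.prod_cons, Multiset.card_cons, pow_succ']
    exact mul_dvd_mul (h a (Multiset.mem_cons_self a s))
      (ih fun b hb => h b (Multiset.mem_cons_of_mem hb))

theorem exists_dvd_pow_of_roots {g : ℚ[X]} (hg : g ≠ 0)
    (h : ∀ z : ℂ, aeval z g = 0 → z ≠ 0 → ∃ n, 0 < n ∧ z ^ n = 1) :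
    ∃ k r : ℕ, 1 ≤ k ∧ g ∣ (X * (X ^ k - 1)) ^ r := by
  have hinj : Function.Injective (algebraMap ℚ ℂ) := (algebraMap ℚ ℂ).injective
  set G := g.map (algebraMap ℚ ℂ) with hG
  have hG0 : G ≠ 0 := (Polynomial.map_ne_zero_iff hinj).2 hg
  have hroots : ∀ z ∈ G.roots, z ≠ 0 → ∃ n, 0 < n ∧ z ^ n = 1 := by
    intro z hz
    refine h z ?_
    rw [← eval_map_algebraMap]
    exact isRoot_of_mem_roots hz
  choose! n hn hzn using hroots
  let k := ∏ z ∈ G.roots.toFinset, if z = 0 then 1 else n z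
  have hk : 1 ≤ k := by
    refine Nat.one_le_iff_ne_zero.2 (Finset.prod_ne_zero_iff.2 fun z hz => ?_)
    split_ifs with h0
    · exact one_ne_zero
    · exact (hn z (Multiset.mem_toFinset.1 hz) h0).ne'
  refine ⟨k, G.roots.card, hk, ?_⟩
  have hdvd : G ∣ (X * (X ^ k - 1)) ^ G.roots.card := by
    have hsplit := (IsAlgClosed.splits G).eq_prod_roots
    have h1 : (G.roots.map (X - C ·)).prod ∣ (X * (X ^ k - 1)) ^ G.roots.card := by
      refine multiset_prod_map_dvd_pow fun z hz => ?_
      rw [dvd_iff_isRoot, IsRoot.def]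
      simp only [eval_mul, eval_X, eval_sub, eval_pow, eval_one, mul_eq_zero]
      by_cases h0 : z = 0
      · exact Or.inl h0
      · right
        have h2 : n z ∣ k := by
          have := Finset.dvd_prod_of_mem (fun z => if z = 0 then 1 else n z)
            (Multiset.mem_toFinset.2 hz)
          simpa [h0] using this
        obtain ⟨c, hc⟩ := h2
        rw [hc, pow_mul, hzn z hz h0, one_pow, sub_self]
    have h3 : IsUnit (C G.leadingCoeff) := isUnit_C.2 (isUnit_iff_ne_zero.2
      (leadingCoeff_ne_zero.2 hG0))
    conv_lhs => rw [hsplit]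
    exact (h3.mul_left_dvd).2 h1
  have h4 : G ∣ ((X * (X ^ k - 1)) ^ G.roots.card : ℚ[X]).map (algebraMap ℚ ℂ) := by
    simpa using hdvd
  exact (Polynomial.map_dvd_map' (algebraMap ℚ ℂ)).1 h4

end Unipotent

section UnipotentModule

open Polynomial TensorProduct

variable {M : Type*} [AddCommGroup M] [Module.Finite ℤ M]

theorem exists_monic_aeval_eq_zero_of_finite (τ : Module.End ℤ M) :
    ∃ χ : ℤ[X], χ.Monic ∧ aeval τ χ = 0 :=
  Algebra.IsIntegral.isIntegral (R := ℤ) τ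

theorem exists_smul_aeval_eq_zero {τ : Module.End ℤ M}
    {A : Set M} (hA : A.Finite) (hspan : Submodule.span ℤ A = ⊤)
    (h : ∀ a ∈ A, ∀ l : ℕ, 1 ≤ l →
      ∃ q : ℤ[X], q ≠ 0 ∧ (∀ i, |q.coeff i| ≤ 1) ∧ aeval (τ ^ l) q a = 0) :
    ∃ k r : ℕ, 1 ≤ k ∧ ∀ x : M, ∃ N : ℤ, N ≠ 0 ∧ N • ((τ * (τ ^ k - 1)) ^ r) x = 0 := by
  classical
  let I : Set ℤ[X] := {p | aeval τ p = 0}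
  obtain ⟨χ, hχm, hχ⟩ := exists_monic_aeval_eq_zero_of_finite τ
  have hI : ∀ z : ℂ, (∀ p ∈ I, aeval z p = 0) → ‖z‖ ≤ 1 := by
    intro z hz
    refine norm_le_one_of_forall_norm_pow_le (C := 2) fun l hl => ?_
    choose! q hq0 hqc hq using fun a ha => h a ha l hl
    let P : ℤ[X] := ∏ a ∈ hA.toFinset, (q a).comp (X ^ l)
    have hcomp : ∀ a, aeval τ ((q a).comp (X ^ l)) = aeval (τ ^ l) (q a) := fun a => by
      rw [aeval_comp]; simp
    have hP : P ∈ I := by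
      change aeval τ P = 0
      refine LinearMap.ext_on hspan fun a ha => ?_
      have hmem : a ∈ hA.toFinset := hA.mem_toFinset.2 ha
      simp only [P]
      rw [← Finset.prod_erase_mul _ _ hmem, map_mul, hcomp, Module.End.mul_apply, hq a ha]
      simp
    have h1 := hz P hP
    simp only [P, map_prod, Finset.prod_eq_zero_iff] at h1
    obtain ⟨a, ha, h2⟩ := h1
    rw [aeval_comp] at h2
    have ha' := hA.mem_toFinset.1 ha
    exact norm_le_two_of_aeval_eq_zero (hq0 a ha') (hqc a ha') (by simpa using h2)
  let f : Module.End ℚ (ℚ ⊗[ℤ] M) := τ.baseChange ℚ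
  have hf : ∀ p : ℤ[X], aeval f (p.map (algebraMap ℤ ℚ)) = (aeval τ p).baseChange ℚ := by
    intro p
    rw [aeval_map_algebraMap]
    exact aeval_algHom_apply (Module.End.baseChangeHom ℤ ℚ M) τ p
  have hχf : aeval f (χ.map (algebraMap ℤ ℚ)) = 0 := by
    rw [hf, hχ, LinearMap.baseChange_zero]
  have hg0 : minpoly ℚ f ≠ 0 := minpoly.ne_zero ⟨_, hχm.map _, hχf⟩
  obtain ⟨k, r, hk, hdvd⟩ := exists_dvd_pow_of_roots hg0 fun z hz hz0 =>
    exists_pow_eq_one_of_forall_root_norm_le_one (I := I) hχ hχm hI hz0 fun p hp => by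
      have h1 : minpoly ℚ f ∣ p.map (algebraMap ℤ ℚ) :=
        minpoly.dvd _ _ (by rw [hf, show aeval τ p = 0 from hp, LinearMap.baseChange_zero])
      have h2 := aeval_eq_zero_of_dvd_aeval_eq_zero h1 hz
      rwa [aeval_map_algebraMap] at h2
  refine ⟨k, r, hk, fun x => ?_⟩
  have h1 : aeval f (((X * (X ^ k - 1)) ^ r : ℤ[X]).map (algebraMap ℤ ℚ)) = 0 := by
    refine aeval_eq_zero_of_dvd_aeval_eq_zero ?_ (minpoly.aeval ℚ f)
    simpa using hdvd
  rw [hf] at h1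
  have h2 : aeval τ ((X * (X ^ k - 1)) ^ r : ℤ[X]) = (τ * (τ ^ k - 1)) ^ r := by simp
  rw [h2] at h1
  have h3 : TensorProduct.mk ℤ ℚ M 1 (((τ * (τ ^ k - 1)) ^ r) x) = 0 := by
    have := LinearMap.congr_fun h1 ((1 : ℚ) ⊗ₜ[ℤ] x)
    simpa using this
  obtain ⟨⟨N, hN⟩, h4⟩ := (IsLocalizedModule.eq_zero_iff (nonZeroDivisors ℤ) _).1 h3
  exact ⟨N, nonZeroDivisors.ne_zero hN, h4⟩

theorem exists_pow_apply_eq_self_of_torsion {τ : Module.End ℤ M} (hτ : Function.Injective τ) :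
    ∃ m : ℕ, 1 ≤ m ∧ ∀ x ∈ Submodule.torsion ℤ M, (τ ^ m) x = x := by
  have hfin : Finite (Submodule.torsion ℤ M) :=
    Module.finite_of_fg_torsion _ Submodule.torsion_isTorsion
  have hmaps : ∀ n, ∀ x ∈ Submodule.torsion ℤ M, (τ ^ n) x ∈ Submodule.torsion ℤ M := by
    rintro n x ⟨a, ha⟩
    exact ⟨a, by rw [← LinearMap.map_smul_of_tower, ha, map_zero]⟩
  obtain ⟨i, j, hne, hij⟩ := Finite.exists_ne_map_eq_of_infinite
    (fun n : ℕ => fun x : Submodule.torsion ℤ M =>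
      (⟨(τ ^ n) x, hmaps n x x.2⟩ : Submodule.torsion ℤ M))
  have key : ∀ i j : ℕ, i < j → (∀ x ∈ Submodule.torsion ℤ M, (τ ^ i) x = (τ ^ j) x) →
      ∃ m : ℕ, 1 ≤ m ∧ ∀ x ∈ Submodule.torsion ℤ M, (τ ^ m) x = x := by
    intro i j hlt h
    refine ⟨j - i, by omega, fun x hx => ?_⟩
    have hinj : Function.Injective (τ ^ i) := by
      rw [Module.End.coe_pow]; exact hτ.iterate i
    apply hinj
    rw [h x hx, ← Module.End.mul_apply, ← pow_add]
    congr 2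
    omega
  have hij' : ∀ x ∈ Submodule.torsion ℤ M, (τ ^ i) x = (τ ^ j) x := fun x hx =>
    congrArg Subtype.val (congrFun hij ⟨x, hx⟩)
  rcases lt_or_gt_of_ne hne with h | h
  · exact key i j h hij'
  · exact key j i h fun x hx => (hij' x hx).symm

theorem exists_one_sub_pow_pow_eq_zero {τ : Module.End ℤ M} (hτ : Function.Injective τ)
    {A : Set M} (hA : A.Finite) (hspan : Submodule.span ℤ A = ⊤)
    (h : ∀ a ∈ A, ∀ l : ℕ, 1 ≤ l →
      ∃ q : ℤ[X], q ≠ 0 ∧ (∀ i, |q.coeff i| ≤ 1) ∧ aeval (τ ^ l) q a = 0) :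
    ∃ k r : ℕ, 1 ≤ k ∧ ∀ j : ℕ, (1 - τ ^ (k * j)) ^ r = 0 := by
  obtain ⟨k, r, hk, hkr⟩ := exists_smul_aeval_eq_zero hA hspan h
  obtain ⟨m, hm, hm'⟩ := exists_pow_apply_eq_self_of_torsion hτ
  refine ⟨k * m, r + 1, Nat.mul_pos hk hm, fun j => ?_⟩
  have hcomm : Commute τ (τ ^ k - 1) := ((Commute.refl τ).pow_right k).sub_right (Commute.one_right τ)
  have htors : ∀ x : M, ((τ ^ k - 1) ^ r) x ∈ Submodule.torsion ℤ M := by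
    intro x
    obtain ⟨N, hN, hx⟩ := hkr x
    refine ⟨⟨N, mem_nonZeroDivisors_of_ne_zero hN⟩, ?_⟩
    rw [hcomm.mul_pow, Module.End.mul_apply, ← map_zsmul] at hx
    have hinj : Function.Injective (τ ^ r) := by
      rw [Module.End.coe_pow]; exact hτ.iterate r
    exact hinj (hx.trans (map_zero _).symm)
  have hfix : ∀ c : ℕ, ∀ x ∈ Submodule.torsion ℤ M, (τ ^ (m * c)) x = x := by
    intro c x hx
    induction c with
    | zero => simp
    | succ c ih => rw [Nat.mul_succ, pow_add, Module.End.mul_apply, hm' x hx, ih]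
  obtain ⟨u, hu⟩ : ∃ u : Module.End ℤ M, 1 - τ ^ (k * m * j) = u * (τ ^ k - 1) ∧ Commute u (τ ^ k - 1) := by
    refine ⟨-∑ i ∈ Finset.range (m * j), (τ ^ k) ^ i, ?_, ?_⟩
    · rw [neg_mul, geom_sum_mul, ← pow_mul, neg_sub, mul_assoc]
    · refine Commute.neg_left (Commute.sum_left _ _ _ fun i _ => ?_)
      exact ((Commute.refl _).pow_left i).sub_right (Commute.one_right _)
  ext x
  rw [pow_succ', Module.End.mul_apply]
  have h1 : ((1 - τ ^ (k * m * j)) ^ r) x ∈ Submodule.torsion ℤ M := by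
    rw [hu.1, hu.2.mul_pow, (hu.2.pow_pow r r).eq, Module.End.mul_apply]
    exact htors _
  rw [show k * m * j = m * (k * j) by ring] at h1 ⊢
  rw [LinearMap.sub_apply, Module.End.one_apply, hfix _ _ h1, sub_self, LinearMap.zero_apply]

end UnipotentModule

section ConjugationUnipotent

open Polynomial
open scoped commutatorElement

/-- The polynomial with the given list of bits as coefficients. -/
noncomputable def bitPoly : List Bool → ℤ[X]
  | [] => 0
  | b :: l => (if b then 1 else 0) + X * bitPoly l

theorem bitPoly_coeff (l : List Bool) (i : ℕ) :
    (bitPoly l).coeff i = if l.getD i false then 1 else 0 := by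
  induction l generalizing i with
  | nil => simp [bitPoly]
  | cons b l ih =>
    rw [bitPoly, coeff_add]
    cases i with
    | zero => cases b <;> simp
    | succ i =>
      rw [coeff_X_mul, ih]
      cases b <;> simp [coeff_one]

theorem bitPoly_injective {l l' : List Bool} (hlen : l.length = l'.length)
    (h : bitPoly l = bitPoly l') : l = l' := by
  refine List.ext_getElem hlen fun i h1 h2 => ?_
  have := congrArg (fun p => p.coeff i) h
  simp only [bitPoly_coeff, List.getD_eq_getElem _ _ h1, List.getD_eq_getElem _ _ h2] at this
  revert this
  cases l[i] <;> cases l'[i] <;> simp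

theorem bitPoly_sub_coeff_le (l l' : List Bool) (i : ℕ) :
    |(bitPoly l - bitPoly l').coeff i| ≤ 1 := by
  rw [coeff_sub, bitPoly_coeff, bitPoly_coeff]
  split_ifs <;> simp

theorem map_conjWord {G H : Type*} [Group G] [Group H] (f : G →* H) (t e : G) (l : List Bool) :
    f (conjWord t e l) = conjWord (f t) (f e) l := by
  induction l with
  | nil => simp [conjWord]
  | cons b l ih => cases b <;> simp [conjWord, ih]

theorem exists_commutator_iterate_eq_one {G : Type*} [Group G] (t : G) (A : Subgroup G) [A.Normal]
    (hcomm : ∀ x ∈ A, ∀ y ∈ A, x * y = y * x) (hfg : A.FG)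
    (hw : ∀ s : G, ∀ e ∈ A, ∃ l l' : List Bool,
      l.length = l'.length ∧ l ≠ l' ∧ conjWord s e l = conjWord s e l') :
    ∃ k r : ℕ, 1 ≤ k ∧ ∀ j : ℕ, ∀ y ∈ A, (fun y => ⁅y, t ^ (k * j)⁆)^[r] y = 1 := by
  let _ : CommGroup A := { (inferInstance : Group A) with
    mul_comm := fun x y => Subtype.ext (hcomm x x.2 y y.2) }
  have hfin : Module.Finite ℤ (Additive A) := by
    rw [Module.Finite.iff_addGroup_fg]
    have : Group.FG A := (Group.fg_iff_subgroup_fg A).2 hfg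
    infer_instance
  let τ : Module.End ℤ (Additive A) :=
    (MonoidHom.toAdditive (MulAut.conjNormal (H := A) t).toMonoidHom).toIntLinearMap
  have hτ : ∀ (l : ℕ) (a : Additive A),
      ((((τ ^ l) a).toMul : A) : G) = t ^ l * ((a.toMul : A) : G) * (t ^ l)⁻¹ := by
    intro l a
    induction l with
    | zero => simp
    | succ l ih =>
      rw [pow_succ', Module.End.mul_apply]
      change ((MulAut.conjNormal (H := A) t ((τ ^ l) a).toMul : A) : G) = _
      rw [MulAut.conjNormal_apply, ih]
      simp [pow_succ', mul_assoc]
  have hinj : Function.Injective τ := by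
    intro a b hab
    exact (MulAut.conjNormal (H := A) t).injective hab
  have hword : ∀ (l : ℕ) (w : List Bool) (a : Additive A),
      (((aeval (τ ^ l) (bitPoly w) a).toMul : A) : G) = conjWord (t ^ l) ((a.toMul : A) : G) w := by
    intro l w a
    induction w with
    | nil => simp [bitPoly, conjWord]
    | cons b w ih =>
      rw [bitPoly, map_add, map_mul, aeval_X, LinearMap.add_apply, Module.End.mul_apply, conjWord,
        toMul_add, Subgroup.coe_mul, hτ, ih]
      cases b <;> simp
  obtain ⟨F, hF⟩ := hfin.fg_top
  obtain ⟨k, r, hk, hkr⟩ := exists_one_sub_pow_pow_eq_zero hinj F.finite_toSet hF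
    fun a _ l _ => by
      obtain ⟨w, w', hlen, hne, h⟩ := hw (t ^ l) _ (a.toMul : A).2
      refine ⟨bitPoly w - bitPoly w', sub_ne_zero.2 fun h => hne (bitPoly_injective hlen h),
        bitPoly_sub_coeff_le w w', ?_⟩
      rw [map_sub, LinearMap.sub_apply, sub_eq_zero]
      have : (aeval (τ ^ l) (bitPoly w) a).toMul = (aeval (τ ^ l) (bitPoly w') a).toMul :=
        Subtype.ext (by rw [hword, hword, h])
      exact this
  refine ⟨k, r, hk, fun j y hy => ?_⟩
  have hstep : ∀ n : ℕ, ∀ a : Additive A,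
      (((((1 - τ ^ (k * j)) ^ n) a).toMul : A) : G) =
        (fun y => ⁅y, t ^ (k * j)⁆)^[n] ((a.toMul : A) : G) := by
    intro n a
    induction n with
    | zero => simp
    | succ n ih =>
      rw [pow_succ', Module.End.mul_apply, Function.iterate_succ_apply', ← ih,
        LinearMap.sub_apply, Module.End.one_apply, toMul_sub, Subgroup.coe_div, hτ,
        commutatorElement_def, div_eq_mul_inv]
      simp [mul_assoc]
  have := hstep r (Additive.ofMul ⟨y, hy⟩)
  rw [hkr j] at this
  simpa using this.symm

end ConjugationUnipotent

section Extension

open scoped commutatorElement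

variable {G : Type*} [Group G]

theorem isNilpotent_of_commutator_iterate {N : Subgroup G} [N.Normal] {s : G}
    (hgen : Subgroup.closure (insert s (N : Set G)) = ⊤) {c : ℕ} (hc : N.lowerCentralSeries c = ⊥)
    (h : ∀ i, ∃ r, ∀ y ∈ N.lowerCentralSeries i,
      (fun y => ⁅y, s⁆)^[r] y ∈ N.lowerCentralSeries (i + 1)) :
    Group.IsNilpotent G := by
  have key : ∀ j, j ≤ c → ∃ m, N.lowerCentralSeries (c - j) ≤ Subgroup.upperCentralSeries G m := by
    intro j
    induction j with
    | zero => exact fun _ => ⟨0, by rw [Nat.sub_zero, hc]; exact bot_le⟩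
    | succ j ih =>
      intro hj
      obtain ⟨m, hm⟩ := ih (by omega)
      obtain ⟨i, hi⟩ : ∃ i, i = c - (j + 1) := ⟨_, rfl⟩
      rw [show c - j = i + 1 by omega] at hm
      rw [← hi]
      obtain ⟨r, hr⟩ := h i
      refine ⟨m + r, fun y hy => ?_⟩
      have haux : ∀ r, ∀ y ∈ N.lowerCentralSeries i,
          (fun y => ⁅y, s⁆)^[r] y ∈ N.lowerCentralSeries (i + 1) →
          y ∈ Subgroup.upperCentralSeries G (m + r) := by
        intro r
        induction r with
        | zero => exact fun y _ hy => hm hy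
        | succ r ih =>
          intro y hy hyr
          rw [← add_assoc, Subgroup.mem_upperCentralSeries_succ_iff]
          refine commutator_mem_of_closure hgen ?_
          rintro g (rfl | hg)
          · refine ih _ ?_ hyr
            rw [commutatorElement_def, mul_assoc, mul_assoc]
            refine mul_mem hy ?_
            rw [← mul_assoc]
            exact (inferInstance : (N.lowerCentralSeries i).Normal).conj_mem _ (inv_mem hy) g
          · exact Subgroup.upperCentralSeries_mono G (Nat.le_add_right m r)
              (hm (Subgroup.commutator_mem_commutator hy hg))
      exact haux r y hy (hr y hy)
  obtain ⟨m, hm⟩ := key c le_rfl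
  rw [Nat.sub_self, Subgroup.lowerCentralSeries_zero] at hm
  refine ⟨m + 1, ?_⟩
  rw [eq_top_iff, ← hgen, Subgroup.closure_le]
  rintro g (rfl | hg)
  · refine Subgroup.mem_upperCentralSeries_succ_iff.2 (commutator_mem_of_closure hgen ?_)
    rintro x (rfl | hx)
    · rw [commutatorElement_self]; exact one_mem _
    · refine hm ?_
      rw [commutatorElement_def]
      exact mul_mem ((inferInstance : N.Normal).conj_mem _ hx g) (inv_mem hx)
  · exact Subgroup.upperCentralSeries_mono G (Nat.le_succ m) (hm hg)

theorem subgroup_fg_map {H : Type*} [Group H] {P : Subgroup G} (hP : P.FG) (f : G →* H) :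
    (P.map f).FG := by
  obtain ⟨F, hF, hfin⟩ := (Subgroup.fg_iff P).1 hP
  exact (Subgroup.fg_iff _).2 ⟨f '' F, by rw [← MonoidHom.map_closure, hF], hfin.image f⟩

theorem exists_commutator_iterate_mem (t : G) {N : Subgroup G} [N.Normal]
    (hfg : ∀ H : Subgroup G, H.FG)
    (hw : ∀ s e : G, ∃ l l' : List Bool,
      l.length = l'.length ∧ l ≠ l' ∧ conjWord s e l = conjWord s e l') (i : ℕ) :
    ∃ k r : ℕ, 1 ≤ k ∧ ∀ j : ℕ, ∀ y ∈ N.lowerCentralSeries i,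
      (fun y => ⁅y, t ^ (k * j)⁆)^[r] y ∈ N.lowerCentralSeries (i + 1) := by
  let B := N.lowerCentralSeries (i + 1)
  let π := QuotientGroup.mk' B
  have hsurj : Function.Surjective π := QuotientGroup.mk'_surjective B
  have : ((N.lowerCentralSeries i).map π).Normal := Subgroup.Normal.map inferInstance π hsurj
  obtain ⟨k, r, hk, hkr⟩ := exists_commutator_iterate_eq_one (π t)
    ((N.lowerCentralSeries i).map π) (by
      rintro _ ⟨x, hx, rfl⟩ _ ⟨y, hy, rfl⟩
      have h1 : ⁅x, y⁆ ∈ B :=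
        Subgroup.commutator_mem_commutator hx (Subgroup.lowerCentralSeries_le_self N i hy)
      have h2 : π ⁅x, y⁆ = 1 := (QuotientGroup.eq_one_iff _).2 h1
      rwa [map_commutatorElement, commutatorElement_eq_one_iff_mul_comm] at h2)
    (subgroup_fg_map (hfg _) π) (by
      rintro s' _ ⟨e, -, rfl⟩
      obtain ⟨s, rfl⟩ := hsurj s'
      obtain ⟨l, l', h1, h2, h3⟩ := hw s e
      exact ⟨l, l', h1, h2, by rw [← map_conjWord, ← map_conjWord, h3]⟩)
  refine ⟨k, r, hk, fun j y hy => ?_⟩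
  have hiter : ∀ n, π ((fun y => ⁅y, t ^ (k * j)⁆)^[n] y) =
      (fun y => ⁅y, (π t) ^ (k * j)⁆)^[n] (π y) := by
    intro n
    induction n with
    | zero => rfl
    | succ n ih =>
      rw [Function.iterate_succ_apply', Function.iterate_succ_apply', ← ih]
      simp only [map_commutatorElement, map_pow]
  have h1 := hkr j (π y) ⟨y, hy, rfl⟩
  rw [← hiter] at h1
  exact (QuotientGroup.eq_one_iff _).1 h1

theorem exists_isNilpotent_closure (t : G) {N : Subgroup G} [N.Normal] [Group.IsNilpotent N]
    (hfg : ∀ H : Subgroup G, H.FG)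
    (hw : ∀ s e : G, ∃ l l' : List Bool,
      l.length = l'.length ∧ l ≠ l' ∧ conjWord s e l = conjWord s e l') :
    ∃ k : ℕ, 1 ≤ k ∧ Group.IsNilpotent (Subgroup.closure (insert (t ^ k) (N : Set G))) := by
  obtain ⟨c, hc⟩ := (Subgroup.isNilpotent_iff_lowerCentralSeries N).1 inferInstance
  choose k r hk hkr using exists_commutator_iterate_mem t hfg hw (N := N)
  refine ⟨∏ i ∈ Finset.range c, k i,
    Nat.one_le_iff_ne_zero.2 (Finset.prod_ne_zero_iff.2 fun i _ => Nat.one_le_iff_ne_zero.1 (hk i)), ?_⟩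
  set s := t ^ ∏ i ∈ Finset.range c, k i with hs
  have hsN : ∀ i, ∃ r, ∀ y ∈ N.lowerCentralSeries i,
      (fun y => ⁅y, s⁆)^[r] y ∈ N.lowerCentralSeries (i + 1) := by
    intro i
    rcases lt_or_ge i c with hi | hi
    · obtain ⟨j, hj⟩ := Finset.dvd_prod_of_mem k (Finset.mem_range.2 hi)
      refine ⟨r i, ?_⟩
      rw [hs, hj]
      exact hkr i j
    · refine ⟨0, fun y hy => ?_⟩
      have h1 := Subgroup.lowerCentralSeries_antitone N hi hy
      rw [hc, Subgroup.mem_bot] at h1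
      rw [h1]
      exact one_mem _
  set H := Subgroup.closure (insert s (N : Set G)) with hH
  have hNH : N ≤ H := fun x hx => Subgroup.subset_closure (Or.inr hx)
  have hsH : s ∈ H := Subgroup.subset_closure (Or.inl rfl)
  have hmap : ∀ i, ((N.subgroupOf H).lowerCentralSeries i).map H.subtype =
      N.lowerCentralSeries i := fun i => by
    rw [Subgroup.map_lowerCentralSeries, Subgroup.map_subgroupOf_eq_of_le hNH]
  have hmem : ∀ i (y : H), y ∈ (N.subgroupOf H).lowerCentralSeries i ↔
      (y : G) ∈ N.lowerCentralSeries i := fun i y => by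
    rw [← hmap]
    exact (Subgroup.mem_map_iff_mem H.subtype_injective (x := y)).symm
  refine isNilpotent_of_commutator_iterate (N := N.subgroupOf H) (s := ⟨s, hsH⟩) (c := c) ?_ ?_ ?_
  · apply Subgroup.map_injective H.subtype_injective
    rw [MonoidHom.map_closure, ← MonoidHom.range_eq_map, Subgroup.range_subtype]
    conv_rhs => rw [hH]
    congr 1
    ext x
    constructor
    · rintro ⟨y, rfl | hy, rfl⟩
      exacts [Or.inl rfl, Or.inr hy]
    · rintro (rfl | hx)
      exacts [⟨⟨s, hsH⟩, Or.inl rfl, rfl⟩, ⟨⟨x, hNH hx⟩, Or.inr hx, rfl⟩]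
  · apply Subgroup.map_injective H.subtype_injective
    rw [hmap, hc, Subgroup.map_bot]
  · intro i
    obtain ⟨r, hr⟩ := hsN i
    refine ⟨r, fun y hy => ?_⟩
    rw [hmem] at hy ⊢
    have hiter : ∀ n, (((fun y => ⁅y, (⟨s, hsH⟩ : H)⁆)^[n] y : H) : G) =
        (fun y => ⁅y, s⁆)^[n] (y : G) := by
      intro n
      induction n with
      | zero => rfl
      | succ n ih =>
        rw [Function.iterate_succ_apply', Function.iterate_succ_apply', ← ih]
        rfl
    rw [hiter]
    exact hr _ hy

end Extension

section FinalAssembly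

theorem subgroup_fg_of_ker {G : Type*} [Group G] {φ : G →* Multiplicative ℤ}
    (hK : ∀ P : Subgroup φ.ker, P.FG) (H : Subgroup G) : H.FG := by
  have h1 : (H ⊓ φ.ker).FG := by
    rw [← Subgroup.subgroupOf_map_subtype]
    exact subgroup_fg_map (hK _) _
  obtain ⟨F, hF, hfin⟩ := (Subgroup.fg_iff _).1 h1
  have hcyc : IsCyclic (H.map φ) := inferInstance
  obtain ⟨⟨_, h0, h0H, rfl⟩, hgen⟩ := hcyc.exists_generator
  refine (Subgroup.fg_iff H).2 ⟨insert h0 F, le_antisymm ?_ ?_, hfin.insert h0⟩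
  · rw [Subgroup.closure_le]
    rintro x (rfl | hx)
    · exact h0H
    · exact (hF.le (Subgroup.subset_closure hx)).1
  · intro h hh
    obtain ⟨n, hn⟩ := hgen ⟨φ h, h, hh, rfl⟩
    have hn' : φ h0 ^ n = φ h := congrArg Subtype.val hn
    have h2 : h * (h0 ^ n)⁻¹ ∈ Subgroup.closure F := by
      rw [hF]
      refine ⟨H.mul_mem hh (H.inv_mem (H.zpow_mem h0H n)), ?_⟩
      change φ _ = 1
      rw [map_mul, map_inv, map_zpow, hn', mul_inv_cancel]
    have h3 : h = h * (h0 ^ n)⁻¹ * h0 ^ n := by simp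
    rw [h3]
    exact mul_mem (Subgroup.closure_mono (Set.subset_insert _ _) h2)
      (zpow_mem (Subgroup.subset_closure (Set.mem_insert _ _)) n)

theorem group_fg_of_finiteIndex {G : Type*} [Group G] {P : Subgroup G} [P.FiniteIndex]
    (hP : P.FG) : Group.FG G := by
  obtain ⟨F, hF, hfin⟩ := (Subgroup.fg_iff _).1 hP
  have : Finite (Quotient (QuotientGroup.leftRel P)) := inferInstanceAs (Finite (G ⧸ P))
  refine Group.fg_iff.2 ⟨F ∪ Set.range (Quotient.out : G ⧸ P → G), ?_,
    hfin.union (Set.finite_range _)⟩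
  rw [eq_top_iff]
  intro g _
  obtain ⟨p, hp⟩ := QuotientGroup.mk_out_eq_mul P g
  have h1 : (p : G) ∈ Subgroup.closure F := by rw [hF]; exact p.2
  have h2 : g = Quotient.out (g : G ⧸ P) * (p : G)⁻¹ := by rw [hp]; simp
  rw [h2]
  exact mul_mem (Subgroup.subset_closure (Or.inr ⟨_, rfl⟩))
    (inv_mem (Subgroup.closure_mono Set.subset_union_left h1))

theorem subgroup_fg_of_finiteIndex {G : Type*} [Group G] {Γ : Subgroup G} [Γ.FiniteIndex]
    (hΓ : ∀ P : Subgroup Γ, P.FG) (H : Subgroup G) : H.FG := by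
  have h1 : (H ⊓ Γ).FG := by
    rw [← Subgroup.subgroupOf_map_subtype]
    exact subgroup_fg_map (hΓ _) _
  have h2 : (Γ.subgroupOf H).FG := by
    obtain ⟨F, hF, hfin⟩ := (Subgroup.fg_iff _).1 h1
    refine (Subgroup.fg_iff _).2 ⟨H.subtype ⁻¹' F, ?_, hfin.preimage H.subtype_injective.injOn⟩
    apply Subgroup.map_injective H.subtype_injective
    rw [MonoidHom.map_closure, Subgroup.subgroupOf_map_subtype, inf_comm, ← hF,
      Set.image_preimage_eq_of_subset]
    intro x hx
    rw [Subgroup.coe_subtype, Subtype.range_coe]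
    exact (hF.le (Subgroup.subset_closure hx)).1
  exact (Group.fg_iff_subgroup_fg H).1 (group_fg_of_finiteIndex h2)

theorem isNilpotent_of_subgroup_le {G : Type*} [Group G] {H K : Subgroup G} (h : H ≤ K)
    (hK : Group.IsNilpotent K) : Group.IsNilpotent H := by
  obtain ⟨n, hn⟩ := (Subgroup.isNilpotent_iff_lowerCentralSeries K).1 hK
  refine (Subgroup.isNilpotent_iff_lowerCentralSeries H).2 ⟨n, ?_⟩
  rw [eq_bot_iff, ← hn]
  exact Subgroup.lowerCentralSeries_mono n h

theorem isNilpotent_map_of_isNilpotent {G H : Type*} [Group G] [Group H] {N : Subgroup G}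
    (hN : Group.IsNilpotent N) (f : G →* H) : Group.IsNilpotent (N.map f) := by
  obtain ⟨n, hn⟩ := (Subgroup.isNilpotent_iff_lowerCentralSeries N).1 hN
  refine (Subgroup.isNilpotent_iff_lowerCentralSeries _).2 ⟨n, ?_⟩
  rw [← Subgroup.map_lowerCentralSeries, hn, Subgroup.map_bot]

theorem finite_monoidHom_of_fg {K Q : Type*} [Group K] [Group Q] [Finite Q] (hK : Group.FG K) :
    Finite (K →* Q) := by
  obtain ⟨F, hF⟩ := hK.out
  refine Finite.of_injective (fun (f : K →* Q) (x : F) => f x) fun f g h => ?_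
  exact MonoidHom.eq_of_eqOn_dense hF fun x hx => congrFun h ⟨x, hx⟩

theorem exists_characteristic_le {K : Type*} [Group K] (hK : Group.FG K) (N : Subgroup K)
    [N.FiniteIndex] : ∃ M : Subgroup K, M.Characteristic ∧ M.FiniteIndex ∧ M ≤ N := by
  have hfin : Finite (K →* K ⧸ N.normalCore) := finite_monoidHom_of_fg hK
  refine ⟨⨅ f : K →* K ⧸ N.normalCore, f.ker, ?_, ?_, ?_⟩
  · refine Subgroup.characteristic_iff_le_comap.2 fun α x hx => ?_
    rw [Subgroup.mem_comap, Subgroup.mem_iInf]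
    intro f
    exact (Subgroup.mem_iInf.1 hx) (f.comp α.toMonoidHom)
  · refine Subgroup.finiteIndex_iInf fun f => ?_
    infer_instance
  · refine (iInf_le _ (QuotientGroup.mk' N.normalCore)).trans ?_
    rw [QuotientGroup.ker_mk']
    exact N.normalCore_le

theorem finiteIndex_closure_insert_pow {G : Type*} [Group G] {φ : G →* Multiplicative ℤ} {t : G}
    (ht : φ t = Multiplicative.ofAdd 1) {M : Subgroup φ.ker} [M.FiniteIndex]
    (hM : (M.map φ.ker.subtype).Normal) {k : ℕ} (hk : 1 ≤ k) :
    (Subgroup.closure (insert (t ^ k) (M.map φ.ker.subtype : Set G))).FiniteIndex := by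
  set N := M.map φ.ker.subtype
  set H := Subgroup.closure (insert (t ^ k) (N : Set G))
  let F : (φ.ker ⧸ M) × Fin k → G ⧸ H := fun p =>
    ((((Quotient.out p.1 : φ.ker) : G) * t ^ (p.2 : ℕ) : G) : G ⧸ H)
  have hF : Function.Surjective F := by
    intro q
    obtain ⟨g, rfl⟩ := QuotientGroup.mk_surjective q
    let n : ℤ := Multiplicative.toAdd (φ g)
    have hx : g * (t ^ n)⁻¹ ∈ φ.ker := by
      rw [MonoidHom.mem_ker, map_mul, map_inv, map_zpow, ht, ← ofAdd_zsmul]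
      simp [n]
    let x : φ.ker := ⟨g * (t ^ n)⁻¹, hx⟩
    have hk0 : (0 : ℤ) < k := by exact_mod_cast hk
    obtain ⟨r, hr⟩ := Int.eq_ofNat_of_zero_le (Int.emod_nonneg n hk0.ne')
    have hrk : r < k := by
      have := Int.emod_lt_of_pos n hk0
      omega
    refine ⟨((x : φ.ker ⧸ M), ⟨r, hrk⟩), ?_⟩
    obtain ⟨m, hm⟩ := QuotientGroup.mk_out_eq_mul M x
    refine QuotientGroup.eq.2 ?_
    rw [hm]
    have hmN : ((m : φ.ker) : G)⁻¹ ∈ N := N.inv_mem ⟨m, m.2, rfl⟩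
    have hdecomp : (((x * (m : φ.ker) : φ.ker) : G) * t ^ r)⁻¹ * g =
        ((t ^ r)⁻¹ * ((m : φ.ker) : G)⁻¹ * ((t ^ r)⁻¹)⁻¹) * (t ^ k) ^ (n / k) := by
      have hn : g = (x : G) * (t ^ r * (t ^ k) ^ (n / k)) := by
        have h1 : t ^ r * (t ^ k) ^ (n / k) = t ^ n := by
          rw [← zpow_natCast, ← zpow_natCast, ← zpow_mul, ← zpow_add, ← hr,
            Int.emod_add_mul_ediv]
        rw [h1]
        simp [x]
      conv_lhs => rw [hn]
      simp [mul_assoc]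
    change (((x * (m : φ.ker) : φ.ker) : G) * t ^ r)⁻¹ * g ∈ H
    rw [hdecomp]
    have htH : t ^ k ∈ H := Subgroup.subset_closure (Set.mem_insert _ _)
    have hcH : (t ^ r)⁻¹ * ((m : φ.ker) : G)⁻¹ * ((t ^ r)⁻¹)⁻¹ ∈ H :=
      Subgroup.subset_closure (Set.mem_insert_of_mem _ (hM.conj_mem _ hmN _))
    exact H.mul_mem hcH (H.zpow_mem htH _)
  have : Finite (G ⧸ H) := Finite.of_surjective F hF
  exact Subgroup.finiteIndex_of_finite_quotient

universe u

theorem exists_nilpotent_finiteIndex_of_growthLE (d : ℕ) : ∀ (G : Type u) [Group G],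
    Group.FG G → GrowthLE G d →
      (∃ H : Subgroup G, Group.IsNilpotent H ∧ H.FiniteIndex) ∧ ∀ H : Subgroup G, H.FG := by
  induction d with
  | zero =>
    intro G _ hfg hG
    rcases finite_or_infinite G with hfin | hinf
    · refine ⟨⟨⊥, inferInstance, inferInstance⟩, fun H => ?_⟩
      exact (Subgroup.fg_iff H).2 ⟨H, Subgroup.closure_eq H, Set.toFinite _⟩
    · exfalso
      obtain ⟨S, hS⟩ := exists_isSymmGen hfg
      obtain ⟨C, -, hC⟩ := hG S
      obtain ⟨n, hn⟩ := exists_nat_gt C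
      have h1 := hC (n + 1) (by omega)
      have h2 : ((n + 1 + 1 : ℕ) : ℝ) ≤ growth (S : Set G) (n + 1) := by
        exact_mod_cast succ_le_growth hS (n + 1)
      push_cast at h2
      simp only [pow_zero, mul_one] at h1
      linarith
  | succ d ih =>
    intro G _ hfg hG
    rcases finite_or_infinite G with hfin | hinf
    · refine ⟨⟨⊥, inferInstance, inferInstance⟩, fun H => ?_⟩
      exact (Subgroup.fg_iff H).2 ⟨H, Subgroup.closure_eq H, Set.toFinite _⟩
    obtain ⟨Γ, hΓ, φ, hφ⟩ := exists_finiteIndex_surjective_int hfg hG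
    have hΓfg : Group.FG Γ := inferInstance
    have hΓG : GrowthLE Γ (d + 1) := hG.of_injective Γ.subtype Γ.subtype_injective
    obtain ⟨t, ht⟩ := hφ (Multiplicative.ofAdd 1)
    have hKfg : Group.FG φ.ker :=
      (Group.fg_iff_subgroup_fg _).2 (ker_fg_of_surjective_int hΓfg hΓG ht)
    obtain ⟨⟨N, hN, hNfin⟩, hsub⟩ := ih φ.ker hKfg (growthLE_ker hΓG ht)
    have hΓsub : ∀ P : Subgroup Γ, P.FG := subgroup_fg_of_ker hsub
    refine ⟨?_, subgroup_fg_of_finiteIndex hΓsub⟩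
    obtain ⟨M, hMchar, hMfin, hMN⟩ := exists_characteristic_le hKfg N
    have hMnil : Group.IsNilpotent (M.map φ.ker.subtype) :=
      isNilpotent_map_of_isNilpotent (isNilpotent_of_subgroup_le hMN hN) _
    have hMnor : (M.map φ.ker.subtype).Normal := inferInstance
    obtain ⟨k, hk, hnil⟩ := exists_isNilpotent_closure t (N := M.map φ.ker.subtype) hΓsub
      fun s e => exists_conjWord_eq hΓG s e
    have hidx := finiteIndex_closure_insert_pow ht hMnor hk
    refine ⟨_, isNilpotent_map_of_isNilpotent hnil Γ.subtype, ⟨?_⟩⟩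
    rw [Subgroup.index_map_subtype]
    exact mul_ne_zero hidx.index_ne_zero hΓ.index_ne_zero

end FinalAssembly

/-- (Gromov) If a finitely generated group `G` has polynomial growth, then `G` contains
a nilpotent subgroup of finite index. -/
theorem stmt8 {G : Type*} [Group G] (hfg : Group.FG G) (hpg : HasPolyGrowth G) :
    ∃ H : Subgroup G, Group.IsNilpotent H ∧ H.FiniteIndex := by
  obtain ⟨d, hd⟩ := hpg.exists_growthLE
  exact (exists_nilpotent_finiteIndex_of_growthLE d G hfg hd).1
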